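/- arXiv:math/0509518 — 3 statements merged into one kernel-verified Lean document; each statement's English description precedes it below -/
import Mathlib

section
/- Let 𝕋 be the set of pointed isometry classes of complete, locally compact rooted real trees, equipped with the pointed Gromov–Hausdorff metric δ. Then (𝕋, δ) is a complete and separable metric space. -/
/-- The property of `f` being the (unique) isometric arc-parametrisation joining `s` to `t`
in a metric space. -/
def arcProp {T : Type*} [MetricSpace T] (s t : T)
    (f : Set.Icc (0 : ℝ) (dist s t) → T) : Prop :=
  Isometry f ∧ f ⟨0, Set.left_mem_Icc.2 dist_nonneg⟩ = s ∧
    f ⟨dist s t, Set.right_mem_Icc.2 dist_nonneg⟩ = t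

/-- A metric space is a real tree if any two points are joined by a unique isometric arc,
and every continuous injective path has as image the corresponding arc. -/
def IsRealTree (T : Type*) [MetricSpace T] : Prop :=
  (∀ s t : T, ∃! f : Set.Icc (0 : ℝ) (dist s t) → T, arcProp s t f) ∧
  (∀ q : Set.Icc (0 : ℝ) (1 : ℝ) → T, Continuous q → Function.Injective q →
    ∀ f : Set.Icc (0 : ℝ)
        (dist (q ⟨0, Set.left_mem_Icc.2 zero_le_one⟩)
              (q ⟨1, Set.right_mem_Icc.2 zero_le_one⟩)) → T,
      arcProp (q ⟨0, Set.left_mem_Icc.2 zero_le_one⟩)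
              (q ⟨1, Set.right_mem_Icc.2 zero_le_one⟩) f →
      Set.range q = Set.range f)

noncomputable section

abbrev ellInfty : Type := lp (fun _ : ℕ => ℝ) ⊤

def pGHDist (X₁ : Type*) [MetricSpace X₁] (ρ₁ : X₁)
    (X₂ : Type*) [MetricSpace X₂] (ρ₂ : X₂) : ℝ :=
  sInf { r : ℝ | ∃ (f₁ : X₁ → ellInfty) (f₂ : X₂ → ellInfty),
    Isometry f₁ ∧ Isometry f₂ ∧
    r = max (Metric.hausdorffDist (Set.range f₁) (Set.range f₂)) (dist (f₁ ρ₁) (f₂ ρ₂)) }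

def distortion {X₁ X₂ : Type*} [MetricSpace X₁] [MetricSpace X₂] (f : X₁ → X₂) : ℝ :=
  sSup { r : ℝ | ∃ x y : X₁, r = |dist x y - dist (f x) (f y)| }

/-- The pointed Gromov–Hausdorff "distance" `δ` between two pointed metric spaces, defined as
`Σ_{k≥1} 2^{-k} δ_cpct(B̄(ρ₁,k), B̄(ρ₂,k))`. -/
def deltaGH (X₁ : Type*) [MetricSpace X₁] (ρ₁ : X₁)
    (X₂ : Type*) [MetricSpace X₂] (ρ₂ : X₂) : ℝ :=
  ∑' k : ℕ, (2 : ℝ)⁻¹ ^ (k + 1) *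
    pGHDist (↥(Metric.closedBall ρ₁ ((k : ℝ) + 1)))
      ⟨ρ₁, Metric.mem_closedBall_self (by positivity)⟩
      (↥(Metric.closedBall ρ₂ ((k : ℝ) + 1)))
      ⟨ρ₂, Metric.mem_closedBall_self (by positivity)⟩

/-- A metric space is a length space if the distance between any two points is the infimum of
the lengths (total variations) of continuous paths joining them. -/
def IsLengthSpace (X : Type*) [MetricSpace X] : Prop :=
  ∀ x y : X, ENNReal.ofReal (dist x y) =
    ⨅ (γ : ℝ → X) (_ : ContinuousOn γ (Set.Icc 0 1)) (_ : γ 0 = x) (_ : γ 1 = y),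
      eVariationOn γ (Set.Icc 0 1)

/-- Two pointed metric spaces are pointed isometric if there is a base-point preserving
bijective isometry between them. -/
def PointedIsometric (X₁ : Type*) [MetricSpace X₁] (ρ₁ : X₁)
    (X₂ : Type*) [MetricSpace X₂] (ρ₂ : X₂) : Prop :=
  ∃ f : X₁ → X₂, Isometry f ∧ Function.Bijective f ∧ f ρ₁ = ρ₂

/-- Pointed Gromov–Hausdorff convergence of a sequence of pointed metric spaces. -/
def PGHTendsto (X : ℕ → Type*) [∀ n, MetricSpace (X n)] (ρ : ∀ n, X n)
    (Y : Type*) [MetricSpace Y] (y : Y) : Prop :=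
  ∀ (r ε : ℝ) (hr : 0 < r) (_ : 0 < ε), ∃ n₀ : ℕ, ∀ n, n₀ ≤ n →
    ∃ f : ↥(Metric.closedBall (ρ n) r) → Y,
      f ⟨ρ n, Metric.mem_closedBall_self hr.le⟩ = y ∧
      distortion f < ε ∧
      ∀ z ∈ Metric.closedBall y (r - ε), ∃ x, dist z (f x) ≤ ε

def mdist {X : Type*} (m : MetricSpace X) : X → X → ℝ := letI := m; dist

def msUniform {X : Type*} (m : MetricSpace X) : UniformSpace X := letI := m; inferInstance

def msTop {X : Type*} (m : MetricSpace X) : TopologicalSpace X := letI := m; inferInstance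

def msPEMS {X : Type*} (m : MetricSpace X) : PseudoEMetricSpace X := letI := m; inferInstance

/-- A representative of a pointed isometry class of complete, locally compact rooted real
trees: a subset of `ℓ∞(ℕ)` with a base point (the root) which is complete, locally compact and
a real tree. -/
structure PointedTreeRep where
  carrier : Set ellInfty
  base : ellInfty
  base_mem : base ∈ carrier
  complete : IsComplete carrier
  locallyCompact : LocallyCompactSpace ↥carrier
  tree : IsRealTree ↥carrier

/-- The pointed-isometry equivalence relation on representatives. -/
def ptreeEquiv (A B : PointedTreeRep) : Prop :=
  PointedIsometric ↥A.carrier ⟨A.base, A.base_mem⟩ ↥B.carrier ⟨B.base, B.base_mem⟩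

section

/-- Correspondence between pointed spaces with distortion at most `e`. -/
def PCorr (X : Type*) [MetricSpace X] (ρ : X) (Y : Type*) [MetricSpace Y] (σ : Y) (e : ℝ) : Prop :=
  ∃ R : X → Y → Prop, R ρ σ ∧ (∀ x, ∃ y, R x y) ∧ (∀ y, ∃ x, R x y) ∧
    ∀ x y x' y', R x y → R x' y' → |dist x x' - dist y y'| ≤ e

theorem PCorr.symm {X Y : Type*} [MetricSpace X] [MetricSpace Y] {ρ : X} {σ : Y} {e : ℝ}
    (h : PCorr X ρ Y σ e) : PCorr Y σ X ρ e := by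
  obtain ⟨R, h0, h1, h2, h3⟩ := h
  refine ⟨fun y x => R x y, h0, h2, h1, fun y x y' x' h h' => ?_⟩
  rw [abs_sub_comm]; exact h3 _ _ _ _ h h'

theorem PCorr.trans {X Y Z : Type*} [MetricSpace X] [MetricSpace Y] [MetricSpace Z]
    {ρ : X} {σ : Y} {τ : Z} {e e' : ℝ}
    (h : PCorr X ρ Y σ e) (h' : PCorr Y σ Z τ e') : PCorr X ρ Z τ (e + e') := by
  obtain ⟨R, h0, h1, h2, h3⟩ := h
  obtain ⟨S, k0, k1, k2, k3⟩ := h'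
  refine ⟨fun x z => ∃ y, R x y ∧ S y z, ⟨σ, h0, k0⟩, fun x => ?_, fun z => ?_, ?_⟩
  · obtain ⟨y, hy⟩ := h1 x
    obtain ⟨z, hz⟩ := k1 y
    exact ⟨z, y, hy, hz⟩
  · obtain ⟨y, hy⟩ := k2 z
    obtain ⟨x, hx⟩ := h2 y
    exact ⟨x, y, hx, hy⟩
  · rintro x z x' z' ⟨y, hxy, hyz⟩ ⟨y', hxy', hyz'⟩
    have a := abs_le.1 (h3 _ _ _ _ hxy hxy')
    have b := abs_le.1 (k3 _ _ _ _ hyz hyz')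
    rw [abs_le]; constructor <;> linarith [a.1, a.2, b.1, b.2]

theorem pGHDist_nonneg (X : Type*) [MetricSpace X] (ρ : X) (Y : Type*) [MetricSpace Y] (σ : Y) :
    0 ≤ pGHDist X ρ Y σ := by
  apply Real.sInf_nonneg
  rintro r ⟨f, g, hf, hg, rfl⟩
  exact le_max_of_le_right dist_nonneg

theorem pcorr_of_pGHDist_lt {X Y : Type*} [MetricSpace X] [MetricSpace Y] [CompactSpace X]
    [CompactSpace Y] {ρ : X} {σ : Y} {r : ℝ} (h : pGHDist X ρ Y σ < r) :
    PCorr X ρ Y σ (2 * r) := by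
  have hne : { r : ℝ | ∃ (f₁ : X → ellInfty) (f₂ : Y → ellInfty),
    Isometry f₁ ∧ Isometry f₂ ∧
    r = max (Metric.hausdorffDist (Set.range f₁) (Set.range f₂)) (dist (f₁ ρ) (f₂ σ)) }.Nonempty :=
    ⟨_, kuratowskiEmbedding X, kuratowskiEmbedding Y, kuratowskiEmbedding.isometry X,
      kuratowskiEmbedding.isometry Y, rfl⟩
  obtain ⟨_, ⟨f, g, hf, hg, rfl⟩, hr⟩ := exists_lt_of_csInf_lt hne h
  have : Nonempty X := ⟨ρ⟩
  have : Nonempty Y := ⟨σ⟩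
  have hfin : Metric.hausdorffEDist (Set.range f) (Set.range g) ≠ ⊤ :=
    Metric.hausdorffEDist_ne_top_of_nonempty_of_bounded (Set.range_nonempty _) (Set.range_nonempty _)
      (isCompact_range hf.continuous).isBounded (isCompact_range hg.continuous).isBounded
  have hH := lt_of_le_of_lt (le_max_left _ _) hr
  have hd := lt_of_le_of_lt (le_max_right _ _) hr
  refine ⟨fun x y => dist (f x) (g y) < r, hd, fun x => ?_, fun y => ?_, ?_⟩
  · obtain ⟨_, ⟨y, rfl⟩, hy⟩ := Metric.exists_dist_lt_of_hausdorffDist_lt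
      (Set.mem_range_self x) hH hfin
    exact ⟨y, hy⟩
  · obtain ⟨_, ⟨x, rfl⟩, hx⟩ := Metric.exists_dist_lt_of_hausdorffDist_lt'
      (Set.mem_range_self y) hH hfin
    exact ⟨x, hx⟩
  · intro x y x' y' h1 h2
    rw [← hf.dist_eq x x', ← hg.dist_eq y y', abs_le]
    have t1 := dist_triangle4 (f x) (g y) (g y') (f x')
    have t2 := dist_triangle4 (g y) (f x) (f x') (g y')
    rw [dist_comm (g y') (f x')] at t1
    rw [dist_comm (g y) (f x)] at t2
    constructor <;> linarith

theorem pGHDist_le_of_pcorr {X Y : Type*} [MetricSpace X] [MetricSpace Y] [CompactSpace X]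
    [CompactSpace Y] {ρ : X} {σ : Y} {r : ℝ} (hr : 0 < r) (h : PCorr X ρ Y σ (2 * r)) :
    pGHDist X ρ Y σ ≤ r := by
  obtain ⟨R, h0, h1, h2, h3⟩ := h
  let Z := {p : X × Y // R p.1 p.2}
  let Φ : Z → X := fun p => p.1.1
  let Ψ : Z → Y := fun p => p.1.2
  have : Nonempty Z := ⟨⟨(ρ, σ), h0⟩⟩
  letI : MetricSpace (X ⊕ Y) := Metric.glueMetricApprox Φ Ψ r hr
    (fun p q => h3 _ _ _ _ p.2 q.2)
  have hl : Isometry (Sum.inl : X → X ⊕ Y) := Isometry.of_dist_eq fun x y => rfl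
  have hrr : Isometry (Sum.inr : Y → X ⊕ Y) := Isometry.of_dist_eq fun x y => rfl
  have hR : ∀ x y, R x y → dist (Sum.inl x : X ⊕ Y) (Sum.inr y) = r := fun x y hxy =>
    Metric.glueDist_glued_points Φ Ψ r ⟨(x, y), hxy⟩
  have hk := kuratowskiEmbedding.isometry (X ⊕ Y)
  set κ := kuratowskiEmbedding (X ⊕ Y)
  refine csInf_le_of_le ⟨0, ?_⟩ ⟨κ ∘ Sum.inl, κ ∘ Sum.inr, hk.comp hl, hk.comp hrr, rfl⟩ ?_
  · rintro r ⟨f, g, hf, hg, rfl⟩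
    exact le_max_of_le_right dist_nonneg
  · refine max_le (Metric.hausdorffDist_le_of_mem_dist hr.le ?_ ?_) ?_
    · rintro _ ⟨x, rfl⟩
      obtain ⟨y, hy⟩ := h1 x
      exact ⟨_, ⟨y, rfl⟩, by simp [hk.dist_eq, hR x y hy]⟩
    · rintro _ ⟨y, rfl⟩
      obtain ⟨x, hx⟩ := h2 y
      exact ⟨_, ⟨x, rfl⟩, by rw [dist_comm]; simp [hk.dist_eq, hR x y hx]⟩
    · simp [hk.dist_eq, hR _ _ h0]

theorem pGHDist_comm_le {X Y : Type*} [MetricSpace X] [MetricSpace Y] [CompactSpace X]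
    [CompactSpace Y] {ρ : X} {σ : Y} : pGHDist X ρ Y σ ≤ pGHDist Y σ X ρ := by
  refine le_of_forall_gt_imp_ge_of_dense fun r hr => ?_
  exact pGHDist_le_of_pcorr ((pGHDist_nonneg _ _ _ _).trans_lt hr) (pcorr_of_pGHDist_lt hr).symm

theorem pGHDist_triangle {X Y Z : Type*} [MetricSpace X] [MetricSpace Y] [MetricSpace Z]
    [CompactSpace X] [CompactSpace Y] [CompactSpace Z] {ρ : X} {σ : Y} {τ : Z} :
    pGHDist X ρ Z τ ≤ pGHDist X ρ Y σ + pGHDist Y σ Z τ := by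
  refine le_of_forall_pos_le_add fun e he => ?_
  have a : pGHDist X ρ Y σ < pGHDist X ρ Y σ + e / 2 := by linarith
  have b : pGHDist Y σ Z τ < pGHDist Y σ Z τ + e / 2 := by linarith
  have := (pcorr_of_pGHDist_lt a).trans (pcorr_of_pGHDist_lt b)
  refine pGHDist_le_of_pcorr ?_ (r := pGHDist X ρ Y σ + pGHDist Y σ Z τ + e) ?_
  · linarith [pGHDist_nonneg X ρ Y σ, pGHDist_nonneg Y σ Z τ]
  · convert this using 1; ring

/-- Approximation up to radius `K`. -/
def Apx (X : Type*) [MetricSpace X] (ρ : X) (Y : Type*) [MetricSpace Y] (σ : Y) (K e : ℝ) : Prop :=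
  ∃ R : X → Y → Prop, R ρ σ ∧ (∀ x, dist x ρ ≤ K → ∃ y, R x y) ∧
    (∀ y, dist y σ ≤ K → ∃ x, R x y) ∧
    ∀ x y x' y', R x y → R x' y' → |dist x x' - dist y y'| ≤ e

def HasBtw (X : Type*) [MetricSpace X] : Prop :=
  ∀ a b : X, ∀ u, 0 ≤ u → u ≤ dist a b → ∃ p, dist a p = u ∧ dist p b = dist a b - u

theorem HasBtw.retract {X : Type*} [MetricSpace X] (h : HasBtw X) (ρ x : X) {K e : ℝ} (hK : 0 ≤ K)
    (he : 0 ≤ e) (hx : dist x ρ ≤ K + e) : ∃ p, dist p ρ ≤ K ∧ dist x p ≤ e := by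
  rcases le_total (dist x ρ) K with hl | hl
  · exact ⟨x, hl, by simpa⟩
  · obtain ⟨p, h1, h2⟩ := h x ρ (dist x ρ - K) (by linarith) (by linarith)
    exact ⟨p, by linarith, by linarith⟩

abbrev cB {X : Type*} [MetricSpace X] (ρ : X) (k : ℕ) : Type _ :=
  ↥(Metric.closedBall ρ ((k : ℝ) + 1))

abbrev cb {X : Type*} [MetricSpace X] (ρ : X) (k : ℕ) : cB ρ k :=
  ⟨ρ, Metric.mem_closedBall_self (by positivity)⟩

instance {X : Type*} [MetricSpace X] [ProperSpace X] (ρ : X) (k : ℕ) : CompactSpace (cB ρ k) :=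
  isCompact_iff_compactSpace.mp (isCompact_closedBall _ _)

theorem pGHDist_ball_le {X Y : Type*} [MetricSpace X] [MetricSpace Y] [ProperSpace X]
    [ProperSpace Y] (ρ : X) (σ : Y) (k : ℕ) :
    pGHDist (cB ρ k) (cb ρ k) (cB σ k) (cb σ k) ≤ k + 1 := by
  refine pGHDist_le_of_pcorr (by positivity) ⟨fun _ _ => True, trivial, fun _ => ⟨cb _ _, trivial⟩,
    fun _ => ⟨cb _ _, trivial⟩, ?_⟩
  intro x y x' y' _ _
  have e1 : dist x x' ≤ (k + 1) + (k + 1) := by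
    refine (dist_triangle_right (x : X) x' ρ).trans (add_le_add x.2 x'.2)
  have e2 : dist y y' ≤ (k + 1) + (k + 1) := by
    refine (dist_triangle_right (y : Y) y' σ).trans (add_le_add y.2 y'.2)
  rw [abs_le]
  constructor <;> linarith [dist_nonneg (x := x) (y := x'), dist_nonneg (x := y) (y := y')]

theorem pGHDist_ball_le_of_apx {X Y : Type*} [MetricSpace X] [MetricSpace Y] [ProperSpace X]
    [ProperSpace Y] (hX : HasBtw X) (hY : HasBtw Y) {ρ : X} {σ : Y} {K e : ℝ} (he : 0 < e)
    (h : Apx X ρ Y σ K e) (k : ℕ) (hk : (k : ℝ) + 1 ≤ K) :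
    pGHDist (cB ρ k) (cb ρ k) (cB σ k) (cb σ k) ≤ 5 / 2 * e := by
  obtain ⟨R, h0, h1, h2, h3⟩ := h
  refine pGHDist_le_of_pcorr (by positivity) ⟨fun x y => ∃ x0 y0, R x0 y0 ∧ dist (x : X) x0 ≤ e ∧
    dist (y : Y) y0 ≤ e, ⟨ρ, σ, h0, by simpa using he.le, by simpa using he.le⟩, ?_, ?_, ?_⟩
  · rintro ⟨x, hx⟩
    rw [Metric.mem_closedBall] at hx
    obtain ⟨y, hy⟩ := h1 x (hx.trans hk)
    have := abs_le.1 (h3 _ _ _ _ hy h0)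
    obtain ⟨p, hp, hp'⟩ := hY.retract σ y (K := k + 1) (e := e) (by positivity) he.le
      (by linarith [this.1])
    exact ⟨⟨p, hp⟩, x, y, hy, by simpa using he.le, by simpa [dist_comm] using hp'⟩
  · rintro ⟨y, hy⟩
    rw [Metric.mem_closedBall] at hy
    obtain ⟨x, hx⟩ := h2 y (hy.trans hk)
    have := abs_le.1 (h3 _ _ _ _ hx h0)
    obtain ⟨p, hp, hp'⟩ := hX.retract ρ x (K := k + 1) (e := e) (by positivity) he.le
      (by linarith [this.2])
    exact ⟨⟨p, hp⟩, x, y, hx, by simpa [dist_comm] using hp', by simpa using he.le⟩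
  · rintro ⟨x, _⟩ ⟨y, _⟩ ⟨x', _⟩ ⟨y', _⟩ ⟨x0, y0, hR, hx, hy⟩ ⟨x0', y0', hR', hx', hy'⟩
    have := abs_le.1 (h3 _ _ _ _ hR hR')
    change |dist x x' - dist y y'| ≤ _
    change dist x x0 ≤ e at hx
    change dist y y0 ≤ e at hy
    change dist x' x0' ≤ e at hx'
    change dist y' y0' ≤ e at hy'
    have a1 := dist_triangle4 x x0 x0' x'
    have a2 := dist_triangle4 x0 x x' x0'
    have a3 := dist_triangle4 y y0 y0' y'
    have a4 := dist_triangle4 y0 y y' y0'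
    rw [dist_comm x0' x'] at a1
    rw [dist_comm x0 x] at a2
    rw [dist_comm y0' y'] at a3
    rw [dist_comm y0 y] at a4
    rw [abs_le]; constructor <;> linarith [this.1, this.2]

theorem apx_of_pGHDist_ball_lt {X Y : Type*} [MetricSpace X] [MetricSpace Y] [ProperSpace X]
    [ProperSpace Y] {ρ : X} {σ : Y} {e : ℝ} (k : ℕ)
    (h : pGHDist (cB ρ k) (cb ρ k) (cB σ k) (cb σ k) < e / 2) :
    Apx X ρ Y σ (k + 1) e := by
  obtain ⟨R, h0, h1, h2, h3⟩ := pcorr_of_pGHDist_lt h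
  refine ⟨fun x y => ∃ (hx : x ∈ Metric.closedBall ρ ((k : ℝ) + 1))
    (hy : y ∈ Metric.closedBall σ ((k : ℝ) + 1)), R ⟨x, hx⟩ ⟨y, hy⟩, ⟨_, _, h0⟩, ?_, ?_, ?_⟩
  · intro x hx
    obtain ⟨y, hy⟩ := h1 ⟨x, hx⟩
    exact ⟨y, hx, y.2, hy⟩
  · intro y hy
    obtain ⟨x, hx⟩ := h2 ⟨y, hy⟩
    exact ⟨x, x.2, hy, hx⟩
  · rintro x y x' y' ⟨_, _, hR⟩ ⟨_, _, hR'⟩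
    have := h3 _ _ _ _ hR hR'
    rw [show 2 * (e / 2) = e by ring] at this
    exact this

/-! ### delta -/

theorem summable_wt : Summable fun k : ℕ => (2 : ℝ)⁻¹ ^ (k + 1) * ((k : ℝ) + 1) := by
  have := summable_pow_mul_geometric_of_norm_lt_one 1 (r := (2 : ℝ)⁻¹) (by norm_num)
  have := (summable_nat_add_iff 1).2 this
  refine this.congr fun k => ?_
  push_cast; ring

section
variable {X Y Z : Type*} [MetricSpace X] [MetricSpace Y] [MetricSpace Z]
    [ProperSpace X] [ProperSpace Y] [ProperSpace Z] (ρ : X) (σ : Y) (τ : Z)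

theorem deltaGH_def : deltaGH X ρ Y σ =
    ∑' k : ℕ, (2 : ℝ)⁻¹ ^ (k + 1) * pGHDist (cB ρ k) (cb ρ k) (cB σ k) (cb σ k) := rfl

theorem term_nonneg (k : ℕ) :
    0 ≤ (2 : ℝ)⁻¹ ^ (k + 1) * pGHDist (cB ρ k) (cb ρ k) (cB σ k) (cb σ k) :=
  mul_nonneg (by positivity) (pGHDist_nonneg _ _ _ _)

theorem term_le (k : ℕ) :
    (2 : ℝ)⁻¹ ^ (k + 1) * pGHDist (cB ρ k) (cb ρ k) (cB σ k) (cb σ k) ≤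
      (2 : ℝ)⁻¹ ^ (k + 1) * ((k : ℝ) + 1) :=
  mul_le_mul_of_nonneg_left (pGHDist_ball_le _ _ _) (by positivity)

theorem summable_term : Summable fun k : ℕ =>
    (2 : ℝ)⁻¹ ^ (k + 1) * pGHDist (cB ρ k) (cb ρ k) (cB σ k) (cb σ k) :=
  summable_wt.of_nonneg_of_le (term_nonneg ρ σ) (term_le ρ σ)

theorem deltaGH_comm : deltaGH X ρ Y σ = deltaGH Y σ X ρ := by
  rw [deltaGH_def, deltaGH_def]
  congr 1; ext k
  congr 1
  exact le_antisymm pGHDist_comm_le pGHDist_comm_le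

theorem deltaGH_triangle : deltaGH X ρ Z τ ≤ deltaGH X ρ Y σ + deltaGH Y σ Z τ := by
  rw [deltaGH_def, deltaGH_def, deltaGH_def, ← (summable_term ρ σ).tsum_add (summable_term σ τ)]
  refine (summable_term ρ τ).tsum_le_tsum (fun k => ?_)
    ((summable_term ρ σ).add (summable_term σ τ))
  rw [← mul_add]
  exact mul_le_mul_of_nonneg_left pGHDist_triangle (by positivity)

theorem deltaGH_nonneg : 0 ≤ deltaGH X ρ Y σ := tsum_nonneg (term_nonneg ρ σ)

variable {ρ σ}
theorem apx_of_deltaGH_lt {e : ℝ} (k : ℕ) (h : deltaGH X ρ Y σ < (2 : ℝ)⁻¹ ^ (k + 1) * (e / 2)) :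
    Apx X ρ Y σ (k + 1) e := by
  apply apx_of_pGHDist_ball_lt
  have := (summable_term ρ σ).le_tsum k (fun j _ => term_nonneg ρ σ j)
  exact lt_of_mul_lt_mul_left (this.trans_lt h) (by positivity)
end

theorem exists_apx_bound {r : ℝ} (hr : 0 < r) : ∃ (K e : ℝ), 0 < e ∧
    ∀ (X Y : Type) [MetricSpace X] [MetricSpace Y] [ProperSpace X] [ProperSpace Y]
      (ρ : X) (σ : Y), HasBtw X → HasBtw Y → Apx X ρ Y σ K e → deltaGH X ρ Y σ ≤ r := by
  have ht := tendsto_sum_nat_add (fun k : ℕ => (2 : ℝ)⁻¹ ^ (k + 1) * ((k : ℝ) + 1))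
  obtain ⟨N, hN⟩ := ((ht.eventually (gt_mem_nhds (half_pos hr))).exists)
  refine ⟨N, r / 5, by positivity, ?_⟩
  intro X Y _ _ _ _ ρ σ hX hY h
  rw [deltaGH_def, ← (summable_term ρ σ).sum_add_tsum_nat_add N]
  have h2 : ∑' k : ℕ, (2 : ℝ)⁻¹ ^ (k + N + 1) *
      pGHDist (cB ρ (k + N)) (cb ρ (k + N)) (cB σ (k + N)) (cb σ (k + N)) ≤ r / 2 :=
    (((summable_nat_add_iff N).2 (summable_term ρ σ)).tsum_le_tsum (fun k => term_le ρ σ (k + N))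
      ((summable_nat_add_iff N).2 summable_wt)).trans hN.le
  have h1 : ∑ k ∈ Finset.range N, (2 : ℝ)⁻¹ ^ (k + 1) *
      pGHDist (cB ρ k) (cb ρ k) (cB σ k) (cb σ k) ≤ r / 2 := by
    calc _ ≤ ∑ k ∈ Finset.range N, (2 : ℝ)⁻¹ ^ (k + 1) * (r / 2) := by
          refine Finset.sum_le_sum fun k hk => mul_le_mul_of_nonneg_left ?_ (by positivity)
          have : k + 1 ≤ N := Finset.mem_range.1 hk
          refine (pGHDist_ball_le_of_apx hX hY (by positivity) h k (by exact_mod_cast this)).trans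
            (le_of_eq (by ring))
      _ ≤ 1 * (r / 2) := by
          rw [← Finset.sum_mul]
          refine mul_le_mul_of_nonneg_right ?_ (by positivity)
          have := geom_sum_eq (x := (2:ℝ)⁻¹) (by norm_num) N
          simp_rw [pow_succ]
          rw [← Finset.sum_mul, this]
          have : (0:ℝ) < 2⁻¹ ^ N := by positivity
          rw [div_mul_eq_mul_div, div_le_iff_of_neg (by norm_num)]
          linarith
      _ = r / 2 := one_mul _
  linarith

end

section

def FourPt (X : Type*) [MetricSpace X] : Prop :=
  ∀ x y z w : X, dist x y + dist z w ≤ max (dist x z + dist y w) (dist x w + dist y z)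

/-- `F` restricts to a geodesic from `a` to `b`. -/
def Geo {T : Type*} [MetricSpace T] (F : ℝ → T) (a b : T) : Prop :=
  F 0 = a ∧ F (dist a b) = b ∧ ∀ u ∈ Set.Icc 0 (dist a b), ∀ v ∈ Set.Icc 0 (dist a b),
    dist (F u) (F v) = |u - v|

theorem geo_exists {T : Type*} [MetricSpace T] (h : IsRealTree T) (a b : T) :
    ∃ F : ℝ → T, Continuous F ∧ Geo F a b := by
  obtain ⟨f, ⟨hf, f0, f1⟩, -⟩ := h.1 a b
  refine ⟨Set.IccExtend dist_nonneg f, hf.continuous.Icc_extend', ?_, ?_, ?_⟩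
  · rw [Set.IccExtend_of_mem _ _ (Set.left_mem_Icc.2 dist_nonneg)]; exact f0
  · rw [Set.IccExtend_of_mem _ _ (Set.right_mem_Icc.2 dist_nonneg)]; exact f1
  · intro u hu v hv
    rw [Set.IccExtend_of_mem _ _ hu, Set.IccExtend_of_mem _ _ hv, hf.dist_eq]; rfl

theorem geo_unique {T : Type*} [MetricSpace T] (h : IsRealTree T) {a b : T} {F G : ℝ → T}
    (hF : Geo F a b) (hG : Geo G a b) : ∀ u ∈ Set.Icc 0 (dist a b), F u = G u := by
  have key : ∀ F : ℝ → T, Geo F a b →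
      arcProp a b (fun u : Set.Icc (0 : ℝ) (dist a b) => F u) := by
    intro F hF
    exact ⟨Isometry.of_dist_eq fun u v => by rw [hF.2.2 _ u.2 _ v.2]; rfl, hF.1, hF.2.1⟩
  have := (h.1 a b).unique (key F hF) (key G hG)
  intro u hu
  exact congrFun this ⟨u, hu⟩

theorem arc_pts {T : Type*} [MetricSpace T] {a b : T}
    {f : Set.Icc (0 : ℝ) (dist a b) → T} (hf : arcProp a b f) (u : Set.Icc (0 : ℝ) (dist a b)) :
    dist a (f u) = u ∧ dist (f u) b = dist a b - u := by
  obtain ⟨h1, h2, h3⟩ := hf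
  constructor
  · have := h1.dist_eq ⟨0, Set.left_mem_Icc.2 dist_nonneg⟩ u
    rw [h2] at this
    rw [this, Subtype.dist_eq, Real.dist_eq, abs_sub_comm, abs_of_nonneg] <;>
      simp [u.2.1]
  · have := h1.dist_eq u ⟨dist a b, Set.right_mem_Icc.2 dist_nonneg⟩
    rw [h3] at this
    rw [this, Subtype.dist_eq, Real.dist_eq, abs_sub_comm, abs_of_nonneg]
    simpa using u.2.2

theorem arc_between {T : Type*} [MetricSpace T] {a b p : T}
    {f : Set.Icc (0 : ℝ) (dist a b) → T} (hf : arcProp a b f) (hp : p ∈ Set.range f) :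
    dist a p + dist p b = dist a b := by
  obtain ⟨u, rfl⟩ := hp
  have := arc_pts hf u
  linarith [this.1, this.2]

theorem branch {T : Type*} [MetricSpace T] (h : IsRealTree T) {w x y : T} {F G : ℝ → T}
    (cF : Continuous F) (cG : Continuous G) (hF : Geo F w x) (hG : Geo G w y) :
    ∃ s, 0 ≤ s ∧ s ≤ dist w x ∧ s ≤ dist w y ∧ (∀ u ∈ Set.Icc 0 s, F u = G u) ∧
      dist x y = dist w x + dist w y - 2 * s := by
  have dF : ∀ u, 0 ≤ u → u ≤ dist w x → dist w (F u) = u := by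
    intro u h0 h1
    have := hF.2.2 0 ⟨le_rfl, dist_nonneg⟩ u ⟨h0, h1⟩
    rw [hF.1] at this
    rw [this, zero_sub, abs_neg, abs_of_nonneg h0]
  have dG : ∀ u, 0 ≤ u → u ≤ dist w y → dist w (G u) = u := by
    intro u h0 h1
    have := hG.2.2 0 ⟨le_rfl, dist_nonneg⟩ u ⟨h0, h1⟩
    rw [hG.1] at this
    rw [this, zero_sub, abs_neg, abs_of_nonneg h0]
  have hcomp : IsCompact (Set.Icc 0 (min (dist w x) (dist w y)) ∩ {u | F u = G u}) :=
    isCompact_Icc.inter_right (isClosed_eq cF cG)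
  obtain ⟨s, ⟨⟨hs0, hsm⟩, hsFG⟩, hmax⟩ := hcomp.exists_isGreatest
    ⟨0, ⟨le_rfl, le_min dist_nonneg dist_nonneg⟩, by
      change F 0 = G 0; rw [hF.1, hG.1]⟩
  have hsx := hsm.trans (min_le_left _ _)
  have hsy := hsm.trans (min_le_right _ _)
  change F s = G s at hsFG
  refine ⟨s, hs0, hsx, hsy, ?_, ?_⟩
  · have dm : dist w (F s) = s := dF s hs0 hsx
    have g1 : Geo F w (F s) := ⟨hF.1, by rw [dm], fun u hu v hv => by
      rw [dm] at hu hv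
      exact hF.2.2 u ⟨hu.1, hu.2.trans hsx⟩ v ⟨hv.1, hv.2.trans hsx⟩⟩
    have g2 : Geo G w (F s) := ⟨hG.1, by rw [dm, hsFG], fun u hu v hv => by
      rw [dm] at hu hv
      exact hG.2.2 u ⟨hu.1, hu.2.trans hsy⟩ v ⟨hv.1, hv.2.trans hsy⟩⟩
    have := geo_unique h g1 g2
    rwa [dm] at this
  · set A := dist w x - s with hA
    set L := A + (dist w y - s) with hL
    have hA0 : 0 ≤ A := by linarith
    have hB0 : 0 ≤ dist w y - s := by linarith
    rcases (add_nonneg hA0 hB0).eq_or_lt with hL0 | hL0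
    · have e1 : dist w x = s := by linarith
      have e2 : dist w y = s := by linarith
      have : x = y := by rw [← hF.2.1, ← hG.2.1, e1, e2, hsFG]
      rw [e1, e2, this, dist_self]; ring
    change 0 < L at hL0
    let Q : ℝ → T := fun t => if t * L ≤ A then F (dist w x - t * L) else G (s + (t * L - A))
    have cQ : Continuous Q := by
      refine Continuous.if_le (by fun_prop) (by fun_prop) (by fun_prop) (by fun_prop) ?_
      intro t ht
      rw [ht, hA]
      simpa using hsFG
    let q : Set.Icc (0 : ℝ) 1 → T := fun t => Q t
    have mixed : ∀ t t' : ℝ, 0 ≤ t → t' ≤ 1 → t * L ≤ A → ¬ t' * L ≤ A →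
        F (dist w x - t * L) ≠ G (s + (t' * L - A)) := by
      intro t t' h0 h1 h2 h3 heq
      push Not at h3
      have n1 : 0 ≤ t * L := by positivity
      have n2 : t' * L ≤ L := by nlinarith
      have d1 := dF (dist w x - t * L) (by linarith) (by linarith)
      have d2 := dG (s + (t' * L - A)) (by linarith) (by linarith)
      rw [heq, d2] at d1
      have : s + (t' * L - A) ≤ s := hmax ⟨⟨by linarith, le_min (by linarith) (by linarith)⟩, by
        change F _ = G _
        rw [← heq, d1]⟩
      linarith
    have iq : Function.Injective q := by
      rintro ⟨t, ht⟩ ⟨t', ht'⟩ heq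
      have heq' : Q t = Q t' := heq
      have n1 : 0 ≤ t * L := by have := ht.1; positivity
      have n1' : 0 ≤ t' * L := by have := ht'.1; positivity
      have n2 : t * L ≤ L := by nlinarith [ht.2]
      have n2' : t' * L ≤ L := by nlinarith [ht'.2]
      simp only [Q] at heq'
      have : t * L = t' * L := by
        split_ifs at heq' with c c' c'
        · have := hF.2.2 (dist w x - t * L) ⟨by linarith, by linarith⟩ (dist w x - t' * L)
            ⟨by linarith, by linarith⟩
          rw [heq', dist_self] at this
          have := abs_eq_zero.1 this.symm
          linarith
        · exact absurd heq' (mixed t t' ht.1 ht'.2 c c')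
        · exact absurd heq'.symm (mixed t' t ht'.1 ht.2 c' c)
        · push Not at c c'
          have := hG.2.2 (s + (t * L - A)) ⟨by linarith, by linarith⟩ (s + (t' * L - A))
            ⟨by linarith, by linarith⟩
          rw [heq', dist_self] at this
          have := abs_eq_zero.1 this.symm
          linarith
      exact Subtype.ext (mul_right_cancel₀ hL0.ne' this)
    have q0 : q ⟨0, Set.left_mem_Icc.2 zero_le_one⟩ = x := by
      simp only [q, Q, zero_mul, if_pos hA0, sub_zero, hF.2.1]
    have q1 : q ⟨1, Set.right_mem_Icc.2 zero_le_one⟩ = y := by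
      simp only [q, Q, one_mul]
      split_ifs with c
      · have e : s = dist w y := by linarith
        rw [show dist w x - L = s by linarith, hsFG, e, hG.2.1]
      · rw [show s + (L - A) = dist w y by linarith, hG.2.1]
    obtain ⟨f, hf, -⟩ := h.1 (q ⟨0, Set.left_mem_Icc.2 zero_le_one⟩)
      (q ⟨1, Set.right_mem_Icc.2 zero_le_one⟩)
    have hr := h.2 q (cQ.comp continuous_subtype_val) iq f hf
    have hm : F s ∈ Set.range f := by
      rw [← hr]
      have e : A / L * L = A := div_mul_cancel₀ _ hL0.ne'
      refine ⟨⟨A / L, by positivity, by rw [div_le_one hL0]; linarith⟩, ?_⟩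
      change (if A / L * L ≤ A then F (dist w x - A / L * L) else _) = F s
      rw [e, if_pos le_rfl]
      congr 1; rw [hA]; ring
    have hb := arc_between hf hm
    rw [q0, q1] at hb
    have d1 := hF.2.2 (dist w x) ⟨dist_nonneg, le_rfl⟩ s ⟨hs0, hsx⟩
    rw [hF.2.1, abs_of_nonneg hA0] at d1
    have d2 := hG.2.2 (dist w y) ⟨dist_nonneg, le_rfl⟩ s ⟨hs0, hsy⟩
    rw [hG.2.1, abs_of_nonneg hB0, ← hsFG, dist_comm] at d2
    linarith

theorem IsRealTree.fourPt {T : Type*} [MetricSpace T] (h : IsRealTree T) : FourPt T := by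
  intro x y z w
  obtain ⟨F, cF, hF⟩ := geo_exists h w x
  obtain ⟨G, cG, hG⟩ := geo_exists h w y
  obtain ⟨H, cH, hH⟩ := geo_exists h w z
  obtain ⟨s, s0, s1, s2, s3, s4⟩ := branch h cF cH hF hH
  obtain ⟨t, t0, t1, t2, t3, t4⟩ := branch h cG cH hG hH
  have dF : ∀ r, 0 ≤ r → r ≤ dist w x → dist x (F r) = dist w x - r := fun r h0 h1 => by
    have := hF.2.2 (dist w x) ⟨dist_nonneg, le_rfl⟩ r ⟨h0, h1⟩
    rwa [hF.2.1, abs_of_nonneg (by linarith)] at this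
  have dG : ∀ r, 0 ≤ r → r ≤ dist w y → dist y (G r) = dist w y - r := fun r h0 h1 => by
    have := hG.2.2 (dist w y) ⟨dist_nonneg, le_rfl⟩ r ⟨h0, h1⟩
    rwa [hG.2.1, abs_of_nonneg (by linarith)] at this
  rw [dist_comm z w, dist_comm y w, dist_comm x w]
  rcases le_total s t with c | c
  · have e : F s = G s := (s3 s ⟨s0, le_rfl⟩).trans (t3 s ⟨s0, c⟩).symm
    have tr := dist_triangle_right x y (F s)
    rw [dF s s0 s1, e, dG s s0 (c.trans t1)] at tr
    exact le_max_of_le_left (by linarith)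
  · have e : F t = G t := (s3 t ⟨t0, c⟩).trans (t3 t ⟨t0, le_rfl⟩).symm
    have tr := dist_triangle_right x y (F t)
    rw [dF t t0 (c.trans s1), e, dG t t0 t1] at tr
    exact le_max_of_le_right (by linarith)

theorem IsRealTree.hasBtw {T : Type*} [MetricSpace T] (h : IsRealTree T) : HasBtw T := by
  intro a b u h0 h1
  obtain ⟨F, cF, hF⟩ := geo_exists h a b
  refine ⟨F u, ?_, ?_⟩
  · have := hF.2.2 0 ⟨le_rfl, dist_nonneg⟩ u ⟨h0, h1⟩
    rw [hF.1] at this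
    rw [this, zero_sub, abs_neg, abs_of_nonneg h0]
  · have := hF.2.2 (dist a b) ⟨dist_nonneg, le_rfl⟩ u ⟨h0, h1⟩
    rwa [hF.2.1, abs_of_nonneg (by linarith), dist_comm] at this

/-! ### Converse -/

theorem FourPt.btw_dist {T : Type*} [MetricSpace T] (h : FourPt T) {a b p p' : T} {u v : ℝ}
    (h1 : dist a p = u) (h2 : dist p b = dist a b - u) (h3 : dist a p' = v)
    (h4 : dist p' b = dist a b - v) : dist p p' = |u - v| := by
  apply le_antisymm
  · have := h p p' a b
    rw [dist_comm p a, dist_comm p' a, h1, h2, h3, h4] at this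
    rcases le_max_iff.1 this with c | c
    · exact le_trans (by linarith) (le_abs_self _)
    · exact le_trans (by linarith) (neg_le_abs _)
  · rw [← h1, ← h3, abs_le]
    constructor
    · linarith [dist_triangle a p p']
    · linarith [dist_triangle_right a p p']

theorem FourPt.path {T : Type*} [MetricSpace T] (h : FourPt T) {Q : ℝ → T} (cQ : Continuous Q)
    {s t : ℝ} (hst : s ≤ t) {p : T} (hp : dist (Q s) p + dist p (Q t) = dist (Q s) (Q t)) :
    ∃ r ∈ Set.Icc s t, Q r = p := by
  by_contra! hno
  have hpre : IsPreconnected (Q '' Set.Icc s t) := isPreconnected_Icc.image _ cQ.continuousOn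
  set a := Q s with ha
  let U : Set T := {x | dist x a < dist x p + dist a p}
  let V : Set T := {x | x ≠ p ∧ dist x p + dist a p ≤ dist x a}
  have oU : IsOpen U := isOpen_lt (by fun_prop) (by fun_prop)
  have oV : IsOpen V := by
    rw [Metric.isOpen_iff]
    rintro x ⟨hxp, hx⟩
    refine ⟨dist x p, dist_pos.2 hxp, fun y hy => ?_⟩
    rw [Metric.mem_ball, dist_comm] at hy
    refine ⟨fun e => by rw [e] at hy; exact lt_irrefl _ hy, ?_⟩
    have := h x a y p
    rcases le_max_iff.1 this with c | c
    · linarith [dist_nonneg (x := y) (y := p)]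
    · rw [dist_comm a y] at c; linarith
  have hap : a ≠ p := hno s ⟨le_rfl, hst⟩
  have c1 : Q '' Set.Icc s t ⊆ U ∪ V := by
    rintro _ ⟨r, hr, rfl⟩
    by_cases c : dist (Q r) a < dist (Q r) p + dist a p
    · exact Or.inl c
    · exact Or.inr ⟨hno r hr, not_lt.1 c⟩
  have c2 : (Q '' Set.Icc s t ∩ U).Nonempty := by
    refine ⟨a, ⟨s, ⟨le_rfl, hst⟩, rfl⟩, ?_⟩
    have := dist_pos.2 hap
    change dist a a < dist a p + dist a p
    rw [dist_self]; linarith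
  have c3 : (Q '' Set.Icc s t ∩ V).Nonempty := by
    refine ⟨Q t, ⟨t, ⟨hst, le_rfl⟩, rfl⟩, hno t ⟨hst, le_rfl⟩, ?_⟩
    rw [dist_comm (Q t) p, dist_comm (Q t) a]; linarith
  obtain ⟨z, -, hzU, hzV⟩ := hpre U V oU oV c1 c2 c3
  exact absurd hzV.2 (not_le.2 hzU)

theorem FourPt.tripod {T : Type*} [MetricSpace T] (h : FourPt T) (hb : HasBtw T) (a b x : T) :
    ∃ m, dist a m + dist m b = dist a b ∧ dist a m + dist m x = dist a x ∧
      dist x m + dist m b = dist x b := by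
  obtain ⟨m, h1, h2⟩ := hb a b ((dist a x + dist a b - dist x b) / 2)
    (by linarith [dist_triangle_left x b a, dist_triangle a x b, dist_triangle x a b, dist_comm a x])
    (by linarith [dist_triangle a b x, dist_comm b x])
  have hx : dist m x ≤ (dist a x + dist x b - dist a b) / 2 := by
    have := h x m a b
    rw [dist_comm x m, dist_comm x a, dist_comm m a] at this
    rcases le_max_iff.1 this with c | c <;> linarith
  refine ⟨m, by linarith, ?_, ?_⟩
  · apply le_antisymm
    · linarith
    · exact dist_triangle _ _ _
  · apply le_antisymm
    · rw [dist_comm x m]; linarith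
    · exact dist_triangle _ _ _

theorem isRealTree_of {T : Type*} [MetricSpace T] (h : FourPt T) (hb : HasBtw T) :
    IsRealTree T := by
  have uniq : ∀ {a b p p' : T}, dist a p + dist p b = dist a b → dist a p' + dist p' b = dist a b →
      dist a p = dist a p' → p = p' := by
    intro a b p p' h1 h2 h3
    have := h.btw_dist (a := a) (b := b) (p := p) (p' := p') rfl (by linarith) rfl (by linarith)
    rw [h3, sub_self, abs_zero] at this
    exact dist_eq_zero.1 this
  refine ⟨fun a b => ?_, ?_⟩
  · have : Nonempty T := ⟨a⟩
    choose! p hp1 hp2 using hb a b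
    refine ⟨fun u => p u, ⟨Isometry.of_dist_eq fun u v => ?_, ?_, ?_⟩, ?_⟩
    · rw [h.btw_dist (hp1 u u.2.1 u.2.2) (hp2 u u.2.1 u.2.2) (hp1 v v.2.1 v.2.2)
        (hp2 v v.2.1 v.2.2)]
      rfl
    · exact (dist_eq_zero.1 (hp1 0 le_rfl dist_nonneg)).symm
    · have := hp2 (dist a b) dist_nonneg le_rfl
      rw [sub_self] at this
      exact dist_eq_zero.1 this
    · intro g hg
      funext u
      have h1 := arc_pts hg u
      have h2 := hp1 u u.2.1 u.2.2
      have h3 := hp2 u u.2.1 u.2.2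
      exact uniq (a := a) (b := b) (by linarith [h1.1, h1.2]) (by linarith) (by linarith [h1.1])
  · intro q cq iq f hf
    set Q : ℝ → T := Set.IccExtend zero_le_one q with hQ
    have cQ : Continuous Q := cq.Icc_extend'
    have Qv : ∀ t (ht : t ∈ Set.Icc (0 : ℝ) 1), Q t = q ⟨t, ht⟩ := fun t ht =>
      Set.IccExtend_of_mem _ _ ht
    have Q0 := Qv 0 (Set.left_mem_Icc.2 zero_le_one)
    have Q1 := Qv 1 (Set.right_mem_Icc.2 zero_le_one)
    apply Set.Subset.antisymm
    · rintro _ ⟨⟨t, ht⟩, rfl⟩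
      obtain ⟨m, m1, m2, m3⟩ := h.tripod hb (Q 0) (Q 1) (Q t)
      obtain ⟨r, hr, er⟩ := h.path cQ ht.1 m2
      obtain ⟨r', hr', er'⟩ := h.path cQ ht.2 m3
      have hr01 : r ∈ Set.Icc (0 : ℝ) 1 := ⟨hr.1, hr.2.trans ht.2⟩
      have hr01' : r' ∈ Set.Icc (0 : ℝ) 1 := ⟨ht.1.trans hr'.1, hr'.2⟩
      have e : r = r' := by
        have : q ⟨r, hr01⟩ = q ⟨r', hr01'⟩ := by rw [← Qv, ← Qv, er, er']
        exact congrArg Subtype.val (iq this)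
      have e2 : r = t := le_antisymm hr.2 (e ▸ hr'.1)
      have e3 : m = q ⟨t, ht⟩ := by rw [← er, e2, Qv t ht]
      rw [e3, Q0, Q1] at m1
      have hle : dist (q ⟨0, Set.left_mem_Icc.2 zero_le_one⟩) (q ⟨t, ht⟩) ≤
        dist (q ⟨0, Set.left_mem_Icc.2 zero_le_one⟩) (q ⟨1, Set.right_mem_Icc.2 zero_le_one⟩) := by
        linarith [dist_nonneg (x := q ⟨t, ht⟩)
          (y := q ⟨1, Set.right_mem_Icc.2 zero_le_one⟩)]
      refine ⟨⟨_, dist_nonneg, hle⟩, ?_⟩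
      have h1 := arc_pts hf ⟨_, dist_nonneg, hle⟩
      exact uniq (by linarith [h1.1, h1.2]) m1 h1.1
    · rintro _ ⟨u, rfl⟩
      have h1 := arc_pts hf u
      obtain ⟨r, hr, er⟩ := h.path cQ zero_le_one (p := f u)
        (by rw [Q0, Q1]; linarith [h1.1, h1.2])
      exact ⟨⟨r, hr⟩, by rw [← Qv, er]⟩

theorem proper_of_hasBtw {X : Type*} [MetricSpace X] [CompleteSpace X] [LocallyCompactSpace X]
    (h : HasBtw X) : ProperSpace X := by
  refine ⟨fun ρ r => ?_⟩
  rcases lt_or_ge r 0 with hr | hr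
  · rw [Metric.closedBall_eq_empty.2 hr]; exact isCompact_empty
  let S : Set ℝ := {r | IsCompact (Metric.closedBall ρ r)}
  change r ∈ S
  refine IsClosed.mem_of_ge_of_forall_exists_gt (a := 0) (s := S) ?_ ?_ hr ?_
  · refine isClosed_of_closure_subset fun x hx => ?_
    have hxI : x ∈ Set.Icc 0 r := by
      have := closure_mono Set.inter_subset_right hx
      rwa [isClosed_Icc.closure_eq] at this
    refine ⟨?_, hxI⟩
    change IsCompact _
    rw [isCompact_iff_totallyBounded_isComplete]
    refine ⟨?_, Metric.isClosed_closedBall.isComplete⟩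
    rw [Metric.totallyBounded_iff]
    intro e he
    obtain ⟨y, ⟨hyS, hyI⟩, hy⟩ := Metric.mem_closure_iff.1 hx (e / 2) (by positivity)
    obtain ⟨t, tf, ht⟩ := Metric.totallyBounded_iff.1
      (isCompact_iff_totallyBounded_isComplete.1 hyS).1 (e / 2) (by positivity)
    refine ⟨t, tf, fun z hz => ?_⟩
    obtain ⟨p, hp, hp'⟩ := h.retract ρ z (K := y) (e := |x - y|) hyI.1 (abs_nonneg _)
      (by linarith [le_abs_self (x - y), Metric.mem_closedBall.1 hz])
    have := ht (Metric.mem_closedBall.2 hp)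
    simp only [Set.mem_iUnion, Metric.mem_ball] at this ⊢
    obtain ⟨w, hw, hw'⟩ := this
    refine ⟨w, hw, ?_⟩
    rw [Real.dist_eq] at hy
    linarith [dist_triangle z p w]
  · change IsCompact _
    rw [Metric.closedBall_zero]; exact isCompact_singleton
  · rintro x ⟨hxS, hx⟩
    obtain ⟨d, d0, hd⟩ := IsCompact.exists_isCompact_cthickening (s := Metric.closedBall ρ x) hxS
    refine ⟨min r (x + d), ?_, lt_min hx.2 (by linarith), min_le_left _ _⟩
    refine hd.of_isClosed_subset Metric.isClosed_closedBall fun z hz => ?_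
    obtain ⟨p, hp, hp'⟩ := h.retract ρ z (K := x) (e := d) hx.1 d0.le
      ((Metric.mem_closedBall.1 hz).trans (min_le_right _ _))
    exact Metric.mem_cthickening_of_dist_le _ p _ _ (Metric.mem_closedBall.2 hp) hp'

end

section
open Filter Topology

section transfer
variable {X : ℕ → Type} [∀ n, MetricSpace (X n)] {ρ : ∀ n, X n} {Z : Type} [MetricSpace Z] {z : Z}

theorem fourPt_of_apx (hX : ∀ n, FourPt (X n))
    (H : ∀ K e : ℝ, 0 < e → ∃ n, Apx (X n) (ρ n) Z z K e) : FourPt Z := by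
  intro a b c d
  refine le_of_forall_pos_le_add fun e he => ?_
  obtain ⟨n, R, h0, h1, h2, h3⟩ := H (dist a z + dist b z + dist c z + dist d z) (e / 4)
    (by positivity)
  have pa := dist_nonneg (x := a) (y := z)
  have pb := dist_nonneg (x := b) (y := z)
  have pc := dist_nonneg (x := c) (y := z)
  have pd := dist_nonneg (x := d) (y := z)
  obtain ⟨a', ha⟩ := h2 a (by linarith)
  obtain ⟨b', hb⟩ := h2 b (by linarith)
  obtain ⟨c', hc⟩ := h2 c (by linarith)
  obtain ⟨d', hd⟩ := h2 d (by linarith)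
  have e1 := abs_le.1 (h3 _ _ _ _ ha hb)
  have e2 := abs_le.1 (h3 _ _ _ _ hc hd)
  have e3 := abs_le.1 (h3 _ _ _ _ ha hc)
  have e4 := abs_le.1 (h3 _ _ _ _ hb hd)
  have e5 := abs_le.1 (h3 _ _ _ _ ha hd)
  have e6 := abs_le.1 (h3 _ _ _ _ hb hc)
  rw [← max_add_add_right]
  rcases le_max_iff.1 (hX n a' b' c' d') with c | c
  · exact le_max_of_le_left (by linarith [e1.1, e2.1, e3.2, e4.2])
  · exact le_max_of_le_right (by linarith [e1.1, e2.1, e5.2, e6.2])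

theorem proper_of_apx [CompleteSpace Z] [∀ n, ProperSpace (X n)]
    (H : ∀ K e : ℝ, 0 < e → ∃ n, Apx (X n) (ρ n) Z z K e) : ProperSpace Z := by
  refine ⟨fun c r => ?_⟩
  rw [isCompact_iff_totallyBounded_isComplete]
  refine ⟨?_, Metric.isClosed_closedBall.isComplete⟩
  refine Metric.totallyBounded_of_finite_discretization fun e he => ?_
  obtain ⟨n, R, h0, h1, h2, h3⟩ := H (r + dist c z) (e / 4) (by positivity)
  obtain ⟨t, tf, ht⟩ := Metric.totallyBounded_iff.1 (isCompact_iff_totallyBounded_isComplete.1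
    (isCompact_closedBall (ρ n) (r + dist c z + e / 4))).1 (e / 4) (by positivity)
  have key : ∀ y : Metric.closedBall c r, ∃ w : t, ∃ x, R x y ∧ dist x w < e / 4 := by
    rintro ⟨y, hy⟩
    have hyz : dist y z ≤ r + dist c z :=
      (dist_triangle y c z).trans (by linarith [Metric.mem_closedBall.1 hy])
    obtain ⟨x, hx⟩ := h2 y hyz
    have := abs_le.1 (h3 _ _ _ _ hx h0)
    have hxB : x ∈ Metric.closedBall (ρ n) (r + dist c z + e / 4) := by
      rw [Metric.mem_closedBall]; linarith [this.2]
    have := ht hxB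
    simp only [Set.mem_iUnion, Metric.mem_ball] at this
    obtain ⟨w, hw, hw'⟩ := this
    exact ⟨⟨w, hw⟩, x, hx, hw'⟩
  choose F x hx hxF using key
  refine ⟨t, tf.fintype, F, fun y y' hyy => ?_⟩
  have a1 := hxF y
  have a2 := hxF y'
  rw [hyy] at a1
  have := abs_le.1 (h3 _ _ _ _ (hx y) (hx y'))
  linarith [this.1, dist_triangle_right (x y) (x y') (F y' : X n)]

theorem hasBtw_of_apx [ProperSpace Z] (hX : ∀ n, HasBtw (X n))
    (H : ∀ K e : ℝ, 0 < e → ∃ n, Apx (X n) (ρ n) Z z K e) : HasBtw Z := by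
  intro a b u hu0 hu1
  obtain ⟨p, hp, hmin⟩ := (isCompact_closedBall a (u + 2)).exists_isMinOn
    ⟨a, Metric.mem_closedBall_self (by linarith)⟩
    (f := fun p => |dist a p - u| + |dist p b - (dist a b - u)|) (by fun_prop)
  have hz : |dist a p - u| + |dist p b - (dist a b - u)| ≤ 0 := by
    refine le_of_forall_pos_le_add fun e' he' => ?_
    rw [zero_add]
    obtain ⟨e, he, he1, hee⟩ : ∃ e : ℝ, 0 < e ∧ e ≤ 1 ∧ 5 * e ≤ e' :=
      ⟨min 1 (e' / 5), by positivity, min_le_left _ _, by linarith [min_le_right 1 (e' / 5)]⟩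
    obtain ⟨n, R, h0, h1, h2, h3⟩ := H (u + dist a z + dist b z + 1) e he
    have pa := dist_nonneg (x := a) (y := z)
    have pb := dist_nonneg (x := b) (y := z)
    obtain ⟨a', ha⟩ := h2 a (by linarith)
    obtain ⟨b', hb⟩ := h2 b (by linarith)
    have e1 := abs_le.1 (h3 _ _ _ _ ha hb)
    have e2 := abs_le.1 (h3 _ _ _ _ ha h0)
    obtain ⟨q', hq1, hq2⟩ := hX n a' b' (min u (dist a' b')) (le_min hu0 dist_nonneg)
      (min_le_right _ _)
    have m1 := min_le_left u (dist a' b')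
    have m2 : u - e ≤ min u (dist a' b') := le_min (by linarith) (by linarith [e1.1])
    have hq' : dist q' (ρ n) ≤ u + dist a z + dist b z + 1 := by
      have := dist_triangle_left q' (ρ n) a'
      linarith [e2.2]
    obtain ⟨q, hq⟩ := h1 q' hq'
    have e3 := abs_le.1 (h3 _ _ _ _ ha hq)
    have e4 := abs_le.1 (h3 _ _ _ _ hq hb)
    have b1 : |dist a q - u| ≤ 2 * e := by
      rw [abs_le]; constructor <;> linarith [e3.1, e3.2]
    have b2 : |dist q b - (dist a b - u)| ≤ 3 * e := by
      rw [abs_le]; constructor <;> linarith [e4.1, e4.2, e1.1, e1.2]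
    have hqB : q ∈ Metric.closedBall a (u + 2) := by
      rw [Metric.mem_closedBall, dist_comm]
      linarith [(abs_le.1 b1).2]
    have := hmin hqB
    simp only [Set.mem_ofPred_eq] at this
    linarith
  have n1 := abs_nonneg (dist a p - u)
  have n2 := abs_nonneg (dist p b - (dist a b - u))
  exact ⟨p, sub_eq_zero.1 (abs_eq_zero.1 (by linarith)), sub_eq_zero.1 (abs_eq_zero.1 (by linarith))⟩

end transfer

/-! ### Distance zero -/

theorem Apx.symm {X Y : Type*} [MetricSpace X] [MetricSpace Y] {ρ : X} {σ : Y} {K e : ℝ}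
    (h : Apx X ρ Y σ K e) : Apx Y σ X ρ K e := by
  obtain ⟨R, h0, h1, h2, h3⟩ := h
  refine ⟨fun y x => R x y, h0, h2, h1, fun y x y' x' h h' => ?_⟩
  rw [abs_sub_comm]; exact h3 _ _ _ _ h h'

theorem apx_of_isometry {X Y : Type*} [MetricSpace X] [MetricSpace Y] {ρ : X} {σ : Y}
    (h : PointedIsometric X ρ Y σ) (K : ℝ) {e : ℝ} (he : 0 < e) : Apx X ρ Y σ K e := by
  obtain ⟨f, hf, hb, h0⟩ := h
  refine ⟨fun x y => f x = y, h0, fun x _ => ⟨_, rfl⟩, fun y _ => hb.2 y, ?_⟩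
  rintro x _ x' _ rfl rfl
  rw [hf.dist_eq, sub_self, abs_zero]; exact he.le

theorem exists_ulim {Y : Type*} [MetricSpace Y] [ProperSpace Y] {σ : Y} {u : ℕ → Y} {C : ℝ}
    (h : ∀ᶠ n in atTop, dist (u n) σ ≤ C) :
    ∃ l, Tendsto u (hyperfilter ℕ) (𝓝 l) := by
  have h' : Metric.closedBall σ C ∈ (hyperfilter ℕ).map u := by
    have := Nat.hyperfilter_le_atTop h
    exact this
  obtain ⟨l, -, hl⟩ := (isCompact_closedBall σ C).ultrafilter_le_nhds' _ h'
  exact ⟨l, hl⟩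

theorem half_fun {X Y : Type*} [MetricSpace X] [MetricSpace Y]
    {ρ : X} {σ : Y} [ProperSpace Y] {R : ℕ → X → Y → Prop} (h0 : ∀ n, R n ρ σ)
    (h1 : ∀ (n : ℕ) x, dist x ρ ≤ n → ∃ y, R n x y)
    (h3 : ∀ (n : ℕ) x y x' y', R n x y → R n x' y' → |dist x x' - dist y y'| ≤ 1 / ((n : ℝ) + 1)) :
    ∃ (y : X → ℕ → Y) (f : X → Y), (∀ x, ∀ᶠ n in atTop, R n x (y x n)) ∧
      ∀ x, Tendsto (y x) (hyperfilter ℕ) (𝓝 (f x)) := by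
  have : Nonempty Y := ⟨σ⟩
  have : ∀ x, ∃ y : ℕ → Y, ∀ n : ℕ, dist x ρ ≤ n → R n x (y n) := by
    intro x
    choose! y hy using fun n => h1 n x
    exact ⟨y, hy⟩
  choose y hy using this
  have ev : ∀ x, ∀ᶠ n in atTop, R n x (y x n) := by
    intro x
    obtain ⟨N, hN⟩ := exists_nat_ge (dist x ρ)
    filter_upwards [eventually_ge_atTop N] with n hn
    exact hy x n (hN.trans (by exact_mod_cast hn))
  have : ∀ x, ∃ l, Tendsto (y x) (hyperfilter ℕ) (𝓝 l) := by
    intro x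
    refine exists_ulim (σ := σ) (C := dist x ρ + 1) ?_
    filter_upwards [ev x] with n hn
    have := abs_le.1 (h3 n _ _ _ _ hn (h0 n))
    have h1 : 1 / ((n : ℝ) + 1) ≤ 1 := by
      rw [div_le_one (by positivity)]; linarith [(Nat.cast_nonneg n : (0 : ℝ) ≤ n)]
    linarith [this.1]
  choose f hf using this
  exact ⟨y, f, ev, hf⟩

theorem isometric_of_apx {X Y : Type*} [MetricSpace X] [MetricSpace Y] [ProperSpace X]
    [ProperSpace Y] {ρ : X} {σ : Y} (H : ∀ K e : ℝ, 0 < e → Apx X ρ Y σ K e) :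
    PointedIsometric X ρ Y σ := by
  have H' : ∀ n : ℕ, Apx X ρ Y σ n (1 / ((n : ℝ) + 1)) := fun n => H _ _ (by positivity)
  choose R h0 h1 h2 h3 using H'
  obtain ⟨y, f, ey, hf⟩ := half_fun h0 h1 h3
  obtain ⟨x, g, ex, hg⟩ := half_fun (R := fun n y x => R n x y) h0 h2
    (fun n y x y' x' h h' => by rw [abs_sub_comm]; exact h3 n _ _ _ _ h h')
  have U : (hyperfilter ℕ : Filter ℕ) ≤ atTop := Nat.hyperfilter_le_atTop
  have lim0 : Tendsto (fun n : ℕ => 1 / ((n : ℝ) + 1)) (hyperfilter ℕ) (𝓝 0) :=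
    tendsto_one_div_add_atTop_nhds_zero_nat.mono_left U
  refine ⟨f, Isometry.of_dist_eq fun a b => ?_, ⟨?_, ?_⟩, ?_⟩
  · have t1 := (hf a).dist (hf b)
    have t2 : Tendsto (fun n => dist (y a n) (y b n)) (hyperfilter ℕ) (𝓝 (dist a b)) := by
      rw [tendsto_iff_dist_tendsto_zero]
      refine squeeze_zero' (Eventually.of_forall fun _ => dist_nonneg) ?_ lim0
      filter_upwards [U (ey a), U (ey b)] with n ha hb
      rw [Real.dist_eq, abs_sub_comm]
      exact h3 n _ _ _ _ ha hb
    exact tendsto_nhds_unique t1 t2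
  · intro a b hab
    have t1 := (hf a).dist (hf b)
    rw [hab, dist_self] at t1
    have t2 : Tendsto (fun n => dist (y a n) (y b n)) (hyperfilter ℕ) (𝓝 (dist a b)) := by
      rw [tendsto_iff_dist_tendsto_zero]
      refine squeeze_zero' (Eventually.of_forall fun _ => dist_nonneg) ?_ lim0
      filter_upwards [U (ey a), U (ey b)] with n ha hb
      rw [Real.dist_eq, abs_sub_comm]
      exact h3 n _ _ _ _ ha hb
    exact dist_eq_zero.1 (tendsto_nhds_unique t2 t1)
  · intro b
    refine ⟨g b, ?_⟩
    have t2 : Tendsto (y (g b)) (hyperfilter ℕ) (𝓝 b) := by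
      rw [tendsto_iff_dist_tendsto_zero]
      have := (tendsto_iff_dist_tendsto_zero.1 (hg b)).add lim0
      rw [zero_add] at this
      refine squeeze_zero' (Eventually.of_forall fun _ => dist_nonneg) ?_ this
      filter_upwards [U (ey (g b)), U (ex b)] with n h4 h5
      have := abs_le.1 (h3 n _ _ _ _ h4 h5)
      rw [dist_comm (x b n)]
      linarith [this.1]
    exact tendsto_nhds_unique (hf _) t2
  · have t2 : Tendsto (y ρ) (hyperfilter ℕ) (𝓝 σ) := by
      rw [tendsto_iff_dist_tendsto_zero]
      refine squeeze_zero' (Eventually.of_forall fun _ => dist_nonneg) ?_ lim0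
      filter_upwards [U (ey ρ)] with n h4
      have := abs_le.1 (h3 n _ _ _ _ h4 (h0 n))
      rw [dist_self] at this
      linarith [this.1]
    exact tendsto_nhds_unique (hf _) t2

/-! ### Limits -/

section limit
variable {X : ℕ → Type} [∀ n, MetricSpace (X n)] (R : ∀ n, X n → X (n + 1) → Prop)

def IsTh (t : ∀ n, X n) (N : ℕ) : Prop := ∀ m, N ≤ m → R m (t m) (t (m + 1))

variable {R}
theorem IsTh.mono {t : ∀ n, X n} {N M : ℕ} (h : IsTh R t N) (hNM : N ≤ M) : IsTh R t M :=
  fun m hm => h m (hNM.trans hm)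

theorem IsTh.est (h3 : ∀ n x y x' y', R n x y → R n x' y' →
    |dist x x' - dist y y'| ≤ (1 / 2 : ℝ) ^ n) {s t : ∀ n, X n} {n : ℕ} (hs : IsTh R s n)
    (ht : IsTh R t n) (m : ℕ) (hm : n ≤ m) :
    |dist (s m) (t m) - dist (s n) (t n)| ≤ 2 * (1 / 2 : ℝ) ^ n - 2 * (1 / 2 : ℝ) ^ m := by
  induction m, hm using Nat.le_induction with
  | base => simp
  | succ m hm ih =>
    have a := abs_le.1 (h3 m _ _ _ _ (hs m hm) (ht m hm))
    have b := abs_le.1 ih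
    rw [pow_succ, abs_le]
    constructor <;> linarith [a.1, a.2, b.1, b.2]

theorem IsTh.lim (h3 : ∀ n x y x' y', R n x y → R n x' y' →
    |dist x x' - dist y y'| ≤ (1 / 2 : ℝ) ^ n) {s t : ∀ n, X n} {n : ℕ} (hs : IsTh R s n)
    (ht : IsTh R t n) : ∃ l, Tendsto (fun m => dist (s m) (t m)) atTop (𝓝 l) := by
  apply cauchySeq_tendsto_of_complete
  rw [Metric.cauchySeq_iff']
  intro e he
  obtain ⟨N, hN⟩ := exists_pow_lt_of_lt_one (show 0 < e / 2 by positivity)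
    (show (1 / 2 : ℝ) < 1 by norm_num)
  refine ⟨max n N, fun m hm => ?_⟩
  have := (hs.mono (le_max_left n N)).est h3 (ht.mono (le_max_left n N)) m hm
  rw [Real.dist_eq]
  have p : (0 : ℝ) < (1 / 2) ^ m := by positivity
  have q : (1 / 2 : ℝ) ^ (max n N) ≤ (1 / 2) ^ N :=
    pow_le_pow_of_le_one (by norm_num) (by norm_num) (le_max_right _ _)
  linarith

theorem IsTh.lim_est (h3 : ∀ n x y x' y', R n x y → R n x' y' →
    |dist x x' - dist y y'| ≤ (1 / 2 : ℝ) ^ n) {s t : ∀ n, X n} {n : ℕ} (hs : IsTh R s n)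
    (ht : IsTh R t n) {l : ℝ} (hl : Tendsto (fun m => dist (s m) (t m)) atTop (𝓝 l)) :
    |l - dist (s n) (t n)| ≤ 2 * (1 / 2 : ℝ) ^ n := by
  refine le_of_tendsto ((hl.sub_const _).abs) ?_
  filter_upwards [eventually_ge_atTop n] with m hm
  refine (hs.est h3 ht m hm).trans ?_
  have p : (0 : ℝ) < (1 / 2) ^ m := by positivity
  linarith

theorem IsTh.forward {ρ : ∀ n, X n} (h0 : ∀ n, R n (ρ n) (ρ (n + 1)))
    (h1 : ∀ (n : ℕ) x, dist x (ρ n) ≤ n → ∃ y, R n x y)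
    (h3 : ∀ n x y x' y', R n x y → R n x' y' →
    |dist x x' - dist y y'| ≤ (1 / 2 : ℝ) ^ n) {n : ℕ} {K : ℝ} (hn : K + 2 ≤ n) (x : X n)
    (hx : dist x (ρ n) ≤ K) : ∃ t, IsTh R t n ∧ t n = x := by
  have : ∀ m, Nonempty (X m) := fun m => ⟨ρ m⟩
  choose! F hF using h1
  let t : ∀ m, X m := fun m => if h : n ≤ m then
    Nat.leRec (motive := fun m _ => X m) x (fun m _ y => F m y) h else ρ m
  have tn : t n = x := by simp [t]
  have ts : ∀ m, n ≤ m → t (m + 1) = F m (t m) := by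
    intro m hm
    simp only [t, dif_pos hm, dif_pos (Nat.le_succ_of_le hm)]
    rw [Nat.leRec_succ]
  have bd : ∀ m, n ≤ m → dist (t m) (ρ m) ≤ K + 2 * (1 / 2 : ℝ) ^ n - 2 * (1 / 2 : ℝ) ^ m := by
    intro m hm
    induction m, hm using Nat.le_induction with
    | base => rw [tn]; linarith
    | succ m hm ih =>
      have p : (0 : ℝ) < (1 / 2) ^ m := by positivity
      have q : (1 / 2 : ℝ) ^ n ≤ 1 := pow_le_one₀ (by norm_num) (by norm_num)
      have r : (n : ℝ) ≤ m := by exact_mod_cast hm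
      have hR := hF m (t m) (by linarith)
      have := abs_le.1 (h3 m _ _ _ _ hR (h0 m))
      rw [ts m hm, pow_succ]
      linarith [this.1]
  refine ⟨t, fun m hm => ?_, tn⟩
  rw [ts m hm]
  have p : (0 : ℝ) < (1 / 2) ^ m := by positivity
  have q : (1 / 2 : ℝ) ^ n ≤ 1 := pow_le_one₀ (by norm_num) (by norm_num)
  have r : (n : ℝ) ≤ m := by exact_mod_cast hm
  exact hF m (t m) (by linarith [bd m hm])

theorem IsTh.backward {ρ : ∀ n, X n} (h0 : ∀ n, R n (ρ n) (ρ (n + 1)))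
    (h2 : ∀ (n : ℕ) y, dist y (ρ (n + 1)) ≤ n → ∃ x, R n x y)
    (h3 : ∀ n x y x' y', R n x y → R n x' y' →
    |dist x x' - dist y y'| ≤ (1 / 2 : ℝ) ^ n) {n : ℕ} {l : ℝ} (hn : l + 2 ≤ n) (k : ℕ) :
    ∀ s : ∀ n, X n, IsTh R s (n + k) → Tendsto (fun m => dist (s m) (ρ m)) atTop (𝓝 l) →
    ∃ t, IsTh R t n ∧ ∀ i, n + k ≤ i → t i = s i := by
  induction k with
  | zero => intro s hs _; exact ⟨s, hs, fun _ _ => rfl⟩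
  | succ k ih =>
    intro s hs hl
    have := abs_le.1 (hs.lim_est h3 (t := ρ) (fun m _ => h0 m) hl)
    have q : (1 / 2 : ℝ) ^ (n + (k + 1)) ≤ 1 := pow_le_one₀ (by norm_num) (by norm_num)
    have r : (n : ℝ) ≤ (n + k : ℕ) := by exact_mod_cast Nat.le_add_right n k
    obtain ⟨x, hx⟩ := h2 (n + k) (s (n + k + 1)) (by
      have := this.1
      change _ ≤ l - dist (s (n + k + 1)) (ρ (n + k + 1)) at this
      linarith)
    have ag : ∀ i, n + k + 1 ≤ i → Function.update s (n + k) x i = s i := by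
      intro i hi
      rw [Function.update_of_ne (by omega)]
    obtain ⟨t, ht, hts⟩ := ih (Function.update s (n + k) x) (by
      intro m hm
      rcases hm.eq_or_lt with rfl | hm
      · rw [Function.update_self, ag _ le_rfl]; exact hx
      · rw [ag m hm, ag (m + 1) (by omega)]; exact hs m hm) (by
      refine hl.congr' ?_
      filter_upwards [eventually_ge_atTop (n + k + 1)] with i hi
      rw [ag i hi])
    exact ⟨t, ht, fun i hi => by rw [hts i (by omega), ag i hi]⟩

variable (R) in
/-- Eventual threads through the correspondences. -/
structure Thread where
  val : ∀ n, X n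
  prop : ∃ N, IsTh R val N

theorem exists_limit {ρ : ∀ n, X n}
    (H : ∀ n : ℕ, Apx (X n) (ρ n) (X (n + 1)) (ρ (n + 1)) n ((1 / 2 : ℝ) ^ n)) :
    ∃ (Z : Type) (_ : MetricSpace Z) (_ : CompleteSpace Z) (z : Z),
      ∀ K e : ℝ, 0 < e → ∃ N, ∀ n, N ≤ n → Apx (X n) (ρ n) Z z K e := by
  choose R h0 h1 h2 h3 using H
  let Th : Type := Thread R
  have lim : ∀ s t : Th, ∃ l, Tendsto (fun m => dist (s.1 m) (t.1 m)) atTop (𝓝 l) := by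
    rintro ⟨s, N, hs⟩ ⟨t, M, ht⟩
    exact (hs.mono (le_max_left N M)).lim h3 (ht.mono (le_max_right N M))
  choose D hD using lim
  let _ : PseudoMetricSpace Th :=
    { dist := D
      dist_self := fun s => tendsto_nhds_unique (hD s s) (by simp)
      dist_comm := fun s t => tendsto_nhds_unique (hD s t) (by
        simp_rw [dist_comm (s.1 _)]; exact hD t s)
      dist_triangle := fun s t u => le_of_tendsto_of_tendsto' (hD s u) ((hD s t).add (hD t u))
        (fun m => dist_triangle _ _ _) }
  have dD : ∀ s t : Th, dist s t = D s t := fun _ _ => rfl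
  let b : Th := ⟨ρ, ⟨0, fun m _ => h0 m⟩⟩
  refine ⟨UniformSpace.Completion Th, inferInstance, inferInstance, (b : UniformSpace.Completion Th),
    fun K e he => ?_⟩
  obtain ⟨N1, hN1⟩ := exists_nat_ge (K + 3)
  obtain ⟨N2, hN2⟩ := exists_pow_lt_of_lt_one (show 0 < e / 4 by positivity)
    (show (1 / 2 : ℝ) < 1 by norm_num)
  refine ⟨max N1 N2, fun n hn => ?_⟩
  have hnK : K + 3 ≤ n := hN1.trans (by exact_mod_cast (le_max_left _ _).trans hn)
  have hne : 2 * (1 / 2 : ℝ) ^ n ≤ e / 2 := by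
    have : (1 / 2 : ℝ) ^ n ≤ (1 / 2) ^ N2 :=
      pow_le_pow_of_le_one (by norm_num) (by norm_num) ((le_max_right _ _).trans hn)
    linarith
  refine ⟨fun x w => ∃ t : Th, IsTh R t.1 n ∧ t.1 n = x ∧
    dist (t : UniformSpace.Completion Th) w ≤ e / 4, ?_, ?_, ?_, ?_⟩
  · exact ⟨b, fun m _ => h0 m, rfl, by rw [dist_self]; positivity⟩
  · intro x hx
    obtain ⟨t, ht, htx⟩ := IsTh.forward h0 h1 h3 (by linarith) x hx
    exact ⟨((⟨t, ⟨n, ht⟩⟩ : Th) : UniformSpace.Completion Th), ⟨t, ⟨n, ht⟩⟩, ht, htx,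
      by rw [dist_self]; positivity⟩
  · intro w hw
    obtain ⟨s, hs⟩ : ∃ s : Th, dist w (s : UniformSpace.Completion Th) < min (e / 4) 1 :=
      UniformSpace.Completion.denseRange_coe.exists_dist_lt w (by positivity)
    have hs1 := hs.trans_le (min_le_left _ _)
    have hs2 := hs.trans_le (min_le_right _ _)
    have hsb : D s b ≤ K + 1 := by
      rw [← dD, ← UniformSpace.Completion.dist_eq]
      linarith [dist_triangle_left (s : UniformSpace.Completion Th) b w]
    obtain ⟨M, hM⟩ := s.2
    obtain ⟨t, ht, hts⟩ := IsTh.backward h0 h2 h3 (n := n) (l := D s b) (by linarith) M s.1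
      (hM.mono (by omega)) (hD s b)
    let t' : Th := ⟨t, ⟨n, ht⟩⟩
    have hts' : dist t' s = 0 := by
      refine tendsto_nhds_unique (hD t' s) (tendsto_const_nhds.congr' ?_)
      filter_upwards [eventually_ge_atTop (n + M)] with i hi
      rw [show t'.1 i = s.1 i from hts i hi, dist_self]
    refine ⟨t n, t', ht, rfl, ?_⟩
    have := dist_triangle (t' : UniformSpace.Completion Th) s w
    rw [UniformSpace.Completion.dist_eq, hts'] at this
    linarith [dist_comm (s : UniformSpace.Completion Th) w]
  · rintro x w x' w' ⟨t, ht, rfl, htw⟩ ⟨t', ht', rfl, htw'⟩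
    have a := abs_le.1 (ht.lim_est h3 ht' (hD t t'))
    rw [← dD, ← UniformSpace.Completion.dist_eq] at a
    have b1 := dist_triangle4 w (t : UniformSpace.Completion Th) t' w'
    have b2 := dist_triangle4 (t : UniformSpace.Completion Th) w w' t'
    rw [dist_comm w (t : UniformSpace.Completion Th)] at b1
    rw [dist_comm w' (t' : UniformSpace.Completion Th)] at b2
    rw [abs_le]
    constructor <;> linarith [a.1, a.2]

end limit
end

section
open Filter Topology

namespace PointedTreeRep

/-- The root as a point of the tree. -/
def pt (A : PointedTreeRep) : ↥A.carrier := ⟨A.base, A.base_mem⟩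

instance instProper (A : PointedTreeRep) : ProperSpace ↥A.carrier :=
  haveI := A.complete.completeSpace_coe
  haveI := A.locallyCompact
  proper_of_hasBtw A.tree.hasBtw

/-- The distance on representatives. -/
def dl (A B : PointedTreeRep) : ℝ := deltaGH ↥A.carrier A.pt ↥B.carrier B.pt

theorem dl_le {r : ℝ} (hr : 0 < r) : ∃ K e : ℝ, 0 < e ∧ ∀ A B : PointedTreeRep,
    Apx ↥A.carrier A.pt ↥B.carrier B.pt K e → dl A B ≤ r := by
  obtain ⟨K, e, he, h⟩ := exists_apx_bound hr
  exact ⟨K, e, he, fun A B hAB => h _ _ _ _ A.tree.hasBtw B.tree.hasBtw hAB⟩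

theorem dl_nonneg (A B : PointedTreeRep) : 0 ≤ dl A B := deltaGH_nonneg _ _
theorem dl_comm (A B : PointedTreeRep) : dl A B = dl B A := deltaGH_comm _ _
theorem dl_triangle (A B C : PointedTreeRep) : dl A C ≤ dl A B + dl B C := deltaGH_triangle _ _ _

theorem dl_eq_zero {A B : PointedTreeRep} (h : ptreeEquiv A B) : dl A B = 0 := by
  refine le_antisymm (le_of_forall_pos_le_add fun r hr => ?_) (dl_nonneg A B)
  obtain ⟨K, e, he, H⟩ := dl_le hr
  rw [zero_add]
  exact H A B (apx_of_isometry h K he)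

theorem equiv_refl (A : PointedTreeRep) : ptreeEquiv A A :=
  ⟨id, isometry_id, Function.bijective_id, rfl⟩

theorem _root_.Apx.mono {X Y : Type*} [MetricSpace X] [MetricSpace Y] {ρ : X} {σ : Y} {K L e : ℝ}
    (h : Apx X ρ Y σ L e) (hKL : K ≤ L) : Apx X ρ Y σ K e := by
  obtain ⟨R, h0, h1, h2, h3⟩ := h
  exact ⟨R, h0, fun x hx => h1 x (hx.trans hKL), fun y hy => h2 y (hy.trans hKL), h3⟩

theorem equiv_of_dl {A B : PointedTreeRep} (h : dl A B = 0) : ptreeEquiv A B := by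
  refine isometric_of_apx (ρ := A.pt) (σ := B.pt) fun K e he => ?_
  obtain ⟨k, hk⟩ := exists_nat_ge K
  refine (apx_of_deltaGH_lt k (e := e) ?_).mono (hk.trans (by linarith))
  change dl A B < _
  rw [h]; positivity

theorem dl_congr_left {A B : PointedTreeRep} (C : PointedTreeRep) (h : ptreeEquiv A B) :
    dl A C = dl B C := by
  have h0 := dl_eq_zero h
  have h1 := dl_triangle A B C
  have h2 := dl_triangle B A C
  have h3 := dl_comm A B
  linarith

/-- The metric on the space of trees. -/
def metric : MetricSpace (Quot ptreeEquiv) where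
  dist := Quot.lift₂ dl
    (fun C A B h => by rw [dl_comm C, dl_comm C, dl_congr_left C h])
    (fun A B C h => dl_congr_left C h)
  dist_self := by rintro ⟨A⟩; exact dl_eq_zero (equiv_refl A)
  dist_comm := by rintro ⟨A⟩ ⟨B⟩; exact dl_comm A B
  dist_triangle := by rintro ⟨A⟩ ⟨B⟩ ⟨C⟩; exact dl_triangle A B C
  eq_of_dist_eq_zero := by rintro ⟨A⟩ ⟨B⟩ h; exact Quot.sound (equiv_of_dl h)

theorem exists_rep {Z : Type} [MetricSpace Z] [ProperSpace Z] (z : Z) (h4 : FourPt Z)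
    (hb : HasBtw Z) : ∃ A : PointedTreeRep, PointedIsometric Z z ↥A.carrier A.pt := by
  have hi := kuratowskiEmbedding.isometry Z
  let f : Z → ellInfty := kuratowskiEmbedding Z
  have hiso : PointedIsometric Z z ↥(Set.range f) ⟨f z, z, rfl⟩ := by
    refine ⟨Set.rangeFactorization f, Isometry.of_dist_eq fun a b => hi.dist_eq a b,
      ⟨fun a b h => hi.injective (congrArg Subtype.val h), Set.rangeFactorization_surjective⟩, rfl⟩
  have hcomp : IsComplete (Set.range f) := hi.isUniformInducing.isComplete_range
  haveI := hcomp.completeSpace_coe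
  have H : ∀ K e : ℝ, 0 < e → ∃ n : ℕ, Apx ((fun _ : ℕ => Z) n) ((fun _ : ℕ => z) n)
    ↥(Set.range f) ⟨f z, z, rfl⟩ K e := fun K e he => ⟨0, apx_of_isometry hiso K he⟩
  haveI : ProperSpace ↥(Set.range f) := proper_of_apx H
  exact ⟨⟨Set.range f, f z, ⟨z, rfl⟩, hcomp, inferInstance,
    isRealTree_of (fourPt_of_apx (fun _ => h4) H) (hasBtw_of_apx (fun _ => hb) H)⟩, hiso⟩

theorem complete_metric : @CompleteSpace _ (msUniform metric) := by
  letI := metric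
  change CompleteSpace (Quot ptreeEquiv)
  refine Metric.complete_of_convergent_controlled_sequences
    (fun N => (2 : ℝ)⁻¹ ^ (N + 1) * ((1 / 2 : ℝ) ^ N / 2)) (fun N => by positivity) fun u hu => ?_
  choose A hA using fun n => Quot.exists_rep (u n)
  have H : ∀ n : ℕ, Apx ↥(A n).carrier (A n).pt ↥(A (n + 1)).carrier (A (n + 1)).pt n
      ((1 / 2 : ℝ) ^ n) := by
    intro n
    refine (apx_of_deltaGH_lt n ?_).mono (by linarith)
    have := hu n n (n + 1) le_rfl (by omega)
    rw [← hA n, ← hA (n + 1)] at this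
    exact this
  obtain ⟨Z, _, _, z, hZ⟩ := exists_limit H
  have H' : ∀ K e : ℝ, 0 < e → ∃ n, Apx ↥(A n).carrier (A n).pt Z z K e := fun K e he => by
    obtain ⟨N, hN⟩ := hZ K e he
    exact ⟨N, hN N le_rfl⟩
  haveI : ProperSpace Z := proper_of_apx H'
  have hb : HasBtw Z := hasBtw_of_apx (fun n => (A n).tree.hasBtw) H'
  have h4 : FourPt Z := fourPt_of_apx (fun n => (A n).tree.fourPt) H'
  obtain ⟨B, hB⟩ := exists_rep z h4 hb
  refine ⟨Quot.mk _ B, Metric.tendsto_atTop.2 fun r hr => ?_⟩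
  obtain ⟨K, e, he, hKe⟩ := exists_apx_bound (half_pos (half_pos hr))
  obtain ⟨N, hN⟩ := hZ K e he
  refine ⟨N, fun n hn => ?_⟩
  rw [← hA n]
  change dl (A n) B < r
  have h1 := hKe _ _ _ _ (A n).tree.hasBtw hb (hN n hn)
  have h2 := hKe _ _ _ _ hb B.tree.hasBtw (apx_of_isometry hB K he)
  have h3 : dl (A n) B ≤ _ := deltaGH_triangle (A n).pt z B.pt
  linarith

theorem exists_net (A : PointedTreeRep) (K : ℝ) {e : ℝ} (he : 0 < e) :
    ∃ (N : ℕ) (p : Fin (N + 1) → ↥A.carrier), p 0 = A.pt ∧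
      ∀ x, dist x A.pt ≤ K → ∃ i, dist x (p i) ≤ e := by
  obtain ⟨t, tf, ht⟩ := Metric.totallyBounded_iff.1 (isCompact_iff_totallyBounded_isComplete.1
    (isCompact_closedBall A.pt K)).1 e he
  obtain ⟨n, f, hf⟩ := tf.fin_param
  refine ⟨n, Fin.cons A.pt f, rfl, fun x hx => ?_⟩
  have := ht (Metric.mem_closedBall.2 hx)
  simp only [Set.mem_iUnion, Metric.mem_ball] at this
  obtain ⟨w, hw, hw'⟩ := this
  rw [← hf.2] at hw
  obtain ⟨i, rfl⟩ := hw
  exact ⟨i.succ, hw'.le⟩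

theorem separable_metric : @TopologicalSpace.SeparableSpace _ (msTop metric) := by
  letI := metric
  change TopologicalSpace.SeparableSpace (Quot ptreeEquiv)
  haveI : SecondCountableTopology (Quot ptreeEquiv) := by
    refine Metric.secondCountable_of_countable_discretization fun r hr => ?_
    obtain ⟨K, e, he, hKe⟩ := dl_le hr
    have he5 : 0 < e / 5 := by positivity
    choose N p hp0 hp using fun A : PointedTreeRep => exists_net A K he5
    choose A hA using fun q : Quot ptreeEquiv => Quot.exists_rep q
    let β := Σ N : ℕ, (Fin (N + 1) → Fin (N + 1) → ℤ)
    refine ⟨β, Encodable.ofCountable β,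
      fun q => ⟨N (A q), fun i j => ⌊dist (p (A q) i) (p (A q) j) / (e / 5)⌋⟩, fun q q' hq => ?_⟩
    obtain ⟨hN, h⟩ := Sigma.mk.inj_iff.1 hq
    clear hq
    rw [← hA q, ← hA q']
    refine hKe (A q) (A q') ?_
    generalize A q = A₁ at *
    generalize A q' = A₂ at *
    have a1 := hp0 A₁
    have a2 := hp0 A₂
    have b1 := hp A₁
    have b2 := hp A₂
    generalize p A₁ = p₁ at *
    generalize p A₂ = p₂ at *
    generalize N A₁ = N₁ at *
    generalize N A₂ = N₂ at *
    subst hN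
    have h := eq_of_heq h
    have key : ∀ i j, |dist (p₁ i) (p₁ j) - dist (p₂ i) (p₂ j)| ≤ e / 5 := by
      intro i j
      have := Int.abs_sub_lt_one_of_floor_eq_floor (congrFun (congrFun h i) j)
      rw [← sub_div, abs_div, abs_of_pos he5, div_lt_one he5] at this
      exact this.le
    refine ⟨fun x y => ∃ i, dist x (p₁ i) ≤ e / 5 ∧ dist y (p₂ i) ≤ e / 5, ?_, ?_, ?_, ?_⟩
    · exact ⟨0, by rw [a1, dist_self]; exact he5.le, by rw [a2, dist_self]; exact he5.le⟩
    · intro x hx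
      obtain ⟨i, hi⟩ := b1 x hx
      exact ⟨p₂ i, i, hi, by rw [dist_self]; exact he5.le⟩
    · intro y hy
      obtain ⟨i, hi⟩ := b2 y hy
      exact ⟨p₁ i, i, by rw [dist_self]; exact he5.le, hi⟩
    · rintro x y x' y' ⟨i, hx, hy⟩ ⟨j, hx', hy'⟩
      have k := abs_le.1 (key i j)
      have t1 := dist_triangle4 x (p₁ i) (p₁ j) x'
      have t2 := dist_triangle4 (p₁ i) x x' (p₁ j)
      have t3 := dist_triangle4 y (p₂ i) (p₂ j) y'
      have t4 := dist_triangle4 (p₂ i) y y' (p₂ j)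
      rw [dist_comm (p₁ j) x'] at t1
      rw [dist_comm (p₁ i) x] at t2
      rw [dist_comm (p₂ j) y'] at t3
      rw [dist_comm (p₂ i) y] at t4
      rw [abs_le]
      constructor <;> linarith [k.1, k.2]
  infer_instance

end PointedTreeRep
end

/-- The set `𝕋` of pointed isometry classes of complete, locally compact rooted real trees,
equipped with the pointed Gromov–Hausdorff metric `δ`, is a complete and separable metric
space. -/
theorem treeSpace_polish :
    ∃ m : MetricSpace (Quot ptreeEquiv),
      (∀ A B : PointedTreeRep,
        mdist m (Quot.mk ptreeEquiv A) (Quot.mk ptreeEquiv B)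
          = deltaGH ↥A.carrier ⟨A.base, A.base_mem⟩ ↥B.carrier ⟨B.base, B.base_mem⟩) ∧
      @CompleteSpace _ (msUniform m) ∧
      @TopologicalSpace.SeparableSpace _ (msTop m) := by
  exact ⟨PointedTreeRep.metric, fun _ _ => rfl, PointedTreeRep.complete_metric,
    PointedTreeRep.separable_metric⟩

end
end

section
/- Let (T_n, d_n, ρ), n ≥ 1, be complete, locally compact rooted real trees with a common root ρ, such that T_n ⊆ T_{n+1} and d_{n+1} restricted to T_n × T_n equals d_n for every n, and suppose the sequence is Cauchy for the pointed Gromov–Hausdorff metric δ. Then setting d(a,b) = d_n(a,b) for a,b ∈ T_n defines a metric d on T_∞ = ⋃_{n≥1} T_n; any two metric completions of (T_∞, d, ρ) are pointed isometric; and the completion (T̄, d̄, ρ) is a complete, locally compact rooted real tree satisfying δ(T_n, T̄) → 0 as n → ∞. -/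
noncomputable section

/-- `f` is an isometry with respect to an explicitly given metric structure on its domain. -/
def IsometryFrom {X Y : Type*} (mX : MetricSpace X) [PseudoEMetricSpace Y] (f : X → Y) : Prop :=
  @Isometry X Y (msPEMS mX) _ f

/-- `δ` with an explicitly given metric structure on the first space. -/
def deltaGHFrom {X : Type*} (mX : MetricSpace X) (x : X)
    (Y : Type*) [MetricSpace Y] (y : Y) : ℝ :=
  @deltaGH X mX x Y _ y

/-- `δ` with explicitly given metric structures on both spaces. -/
def deltaGHBoth {X Y : Type*} (mX : MetricSpace X) (x : X) (mY : MetricSpace Y) (y : Y) : ℝ :=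
  @deltaGH X mX x Y mY y

/-! ### Real trees and the four point condition -/

def RTFour (X : Type*) [MetricSpace X] : Prop := ∀ x y z w : X,
  dist x y + dist z w ≤ max (dist x z + dist y w) (dist x w + dist y z)

def RTBtw (X : Type*) [MetricSpace X] : Prop := ∀ x y : X, ∀ r : ℝ, 0 ≤ r → r ≤ dist x y →
  ∃ p : X, dist x p = r ∧ dist p y = dist x y - r

def RTGeo {X : Type*} [MetricSpace X] (f : ℝ → X) (x y : X) : Prop :=
  f 0 = x ∧ f (dist x y) = y ∧
    ∀ s ∈ Set.Icc 0 (dist x y), ∀ t ∈ Set.Icc 0 (dist x y), dist (f s) (f t) = |s - t|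

theorem rt_geo_of_arc {X : Type*} [MetricSpace X] {x y : X}
    {f : Set.Icc (0 : ℝ) (dist x y) → X} (hf : arcProp x y f) :
    RTGeo (fun s => f (Set.projIcc 0 (dist x y) dist_nonneg s)) x y := by
  obtain ⟨hi, h0, h1⟩ := hf
  refine ⟨?_, ?_, ?_⟩
  · simp only [Set.projIcc_left]; exact h0
  · simp only [Set.projIcc_right]; exact h1
  · intro s hs t ht
    simp only [Set.projIcc_of_mem _ hs, Set.projIcc_of_mem _ ht, hi.dist_eq]
    rfl

theorem rt_arc_of_geo {X : Type*} [MetricSpace X] {x y : X} {f : ℝ → X} (hf : RTGeo f x y) :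
    arcProp x y (fun s => f s) := by
  obtain ⟨h0, h1, hi⟩ := hf
  refine ⟨Isometry.of_dist_eq fun s t => ?_, h0, h1⟩
  rw [hi s s.2 t t.2]; rfl

theorem rt_exists_geo {X : Type*} [MetricSpace X] (h : IsRealTree X) (x y : X) :
    ∃ f : ℝ → X, RTGeo f x y := by
  obtain ⟨f, hf, -⟩ := h.1 x y
  exact ⟨_, rt_geo_of_arc hf⟩

theorem rt_geo_unique {X : Type*} [MetricSpace X] (h : IsRealTree X) {x y : X} {f g : ℝ → X}
    (hf : RTGeo f x y) (hg : RTGeo g x y) (s : ℝ) (hs : s ∈ Set.Icc 0 (dist x y)) :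
    f s = g s := by
  have := (h.1 x y).unique (rt_arc_of_geo hf) (rt_arc_of_geo hg)
  exact congrFun this ⟨s, hs⟩

theorem rt_btw {X : Type*} [MetricSpace X] (h : IsRealTree X) : RTBtw X := by
  intro x y r h0 h1
  obtain ⟨f, f0, f1, hf⟩ := rt_exists_geo h x y
  refine ⟨f r, ?_, ?_⟩
  · conv_lhs => rw [← f0]
    rw [hf 0 ⟨le_rfl, dist_nonneg⟩ r ⟨h0, h1⟩, zero_sub, abs_neg, abs_of_nonneg h0]
  · conv_lhs => rw [← f1]
    rw [hf r ⟨h0, h1⟩ _ ⟨dist_nonneg, le_rfl⟩, abs_sub_comm, abs_of_nonneg (by linarith)]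

/-- geodesic through a given intermediate point -/
theorem rt_geo_through {X : Type*} [MetricSpace X] (h : IsRealTree X) {x y p : X}
    (hp : dist x p + dist p y = dist x y) : ∃ f : ℝ → X, RTGeo f x y ∧ f (dist x p) = p := by
  obtain ⟨f, f0, f1, hf⟩ := rt_exists_geo h x p
  obtain ⟨g, g0, g1, hg⟩ := rt_exists_geo h p y
  have hxp : 0 ≤ dist x p := dist_nonneg
  have hpy : 0 ≤ dist p y := dist_nonneg
  set F : ℝ → X := fun s => if s ≤ dist x p then f s else g (s - dist x p) with hF
  have F0 : F 0 = x := by simp [hF, f0]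
  have Fp : F (dist x p) = p := by simp [hF, f1]
  have Fy : F (dist x y) = y := by
    simp only [hF]
    split_ifs with hc
    · have h2 : dist p y = 0 := by linarith
      have h3 : dist x y = dist x p := by linarith
      rw [h3, f1]; exact dist_eq_zero.1 h2
    · rw [← hp, add_sub_cancel_left, g1]
  have key : ∀ s ∈ Set.Icc 0 (dist x y), ∀ t ∈ Set.Icc 0 (dist x y), s ≤ t →
      dist (F s) (F t) = t - s := by
    intro s hs t ht hst
    obtain ⟨hs0, hs1⟩ := hs
    obtain ⟨ht0, ht1⟩ := ht
    simp only [hF]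
    split_ifs with h1 h2 h3
    · rw [hf s ⟨hs0, h1⟩ t ⟨ht0, h2⟩, abs_sub_comm, abs_of_nonneg (by linarith)]
    · have e1 := hf s ⟨hs0, h1⟩ _ ⟨hxp, le_rfl⟩
      have e2 := hg 0 ⟨le_rfl, hpy⟩ (t - dist x p) ⟨by linarith, by linarith⟩
      have e3 := hf 0 ⟨le_rfl, hxp⟩ s ⟨hs0, h1⟩
      have e4 := hg (t - dist x p) ⟨by linarith, by linarith⟩ _ ⟨hpy, le_rfl⟩
      rw [f1, abs_sub_comm, abs_of_nonneg (by linarith)] at e1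
      rw [g0, abs_sub_comm, abs_of_nonneg (by linarith)] at e2
      rw [f0, abs_sub_comm, abs_of_nonneg (by linarith)] at e3
      rw [g1, abs_sub_comm, abs_of_nonneg (by linarith)] at e4
      have t1 := dist_triangle (f s) p (g (t - dist x p))
      have t2 := dist_triangle4 x (f s) (g (t - dist x p)) y
      linarith
    · linarith
    · rw [hg _ ⟨by linarith, by linarith⟩ _ ⟨by linarith, by linarith⟩, abs_sub_comm,
        abs_of_nonneg (by linarith)]
      ring
  refine ⟨F, ⟨F0, Fy, ?_⟩, Fp⟩
  intro s hs t ht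
  rcases le_total s t with hst | hst
  · rw [key s hs t ht hst, abs_sub_comm, abs_of_nonneg (by linarith)]
  · rw [dist_comm, key t ht s hs hst, abs_of_nonneg (by linarith)]

theorem rt_point_unique {X : Type*} [MetricSpace X] (h : IsRealTree X) {x y p p' : X}
    (hp : dist x p + dist p y = dist x y) (hp' : dist x p' + dist p' y = dist x y)
    (he : dist x p = dist x p') : p = p' := by
  obtain ⟨f, hf, fp⟩ := rt_geo_through h hp
  obtain ⟨g, hg, gp⟩ := rt_geo_through h hp'
  rw [← fp, ← gp, ← he]
  exact rt_geo_unique h hf hg _ ⟨dist_nonneg, by have := dist_nonneg (x := p) (y := y); linarith⟩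

theorem rt_median {X : Type*} [MetricSpace X] (h : IsRealTree X) (x y z : X) :
    ∃ m : X, dist x m + dist m y = dist x y ∧ dist x m + dist m z = dist x z ∧
      dist y m + dist m z = dist y z := by
  obtain ⟨f, f0, f1, hf⟩ := rt_exists_geo h x y
  obtain ⟨g, g0, g1, hg⟩ := rt_exists_geo h x z
  set D := dist x y with hD
  set E := dist x z with hE
  have D0 : 0 ≤ D := dist_nonneg
  have E0 : 0 ≤ E := dist_nonneg
  have fc : ContinuousOn f (Set.Icc 0 D) := by
    refine LipschitzOnWith.continuousOn (K := 1) (LipschitzOnWith.of_dist_le_mul ?_)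
    intro s hs t ht
    rw [hf s hs t ht]; simp [Real.dist_eq]
  have gc : ContinuousOn g (Set.Icc 0 E) := by
    refine LipschitzOnWith.continuousOn (K := 1) (LipschitzOnWith.of_dist_le_mul ?_)
    intro s hs t ht
    rw [hg s hs t ht]; simp [Real.dist_eq]
  set A : Set ℝ := {r | r ∈ Set.Icc 0 (min D E) ∧ dist (f r) (g r) = 0} with hA
  have hAc : IsCompact A := by
    refine isCompact_Icc.of_isClosed_subset ?_ (fun r hr => hr.1)
    have : ContinuousOn (fun r => dist (f r) (g r)) (Set.Icc 0 (min D E)) :=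
      continuous_dist.comp_continuousOn
        ((fc.mono (Set.Icc_subset_Icc_right (min_le_left _ _))).prodMk
        (gc.mono (Set.Icc_subset_Icc_right (min_le_right _ _))))
    exact this.preimage_isClosed_of_isClosed isClosed_Icc (isClosed_singleton (x := (0 : ℝ)))
  have hAn : A.Nonempty := ⟨0, ⟨le_rfl, le_min D0 E0⟩, by rw [f0, g0, dist_self]⟩
  set a := sSup A with ha
  have haA : a ∈ A := hAc.sSup_mem hAn
  have hamax : ∀ r ∈ A, r ≤ a := fun r hr => le_csSup hAc.bddAbove hr
  obtain ⟨⟨a0, aDE⟩, hfg⟩ := haA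
  have aD : a ≤ D := aDE.trans (min_le_left _ _)
  have aE : a ≤ E := aDE.trans (min_le_right _ _)
  have hfg := dist_eq_zero.1 hfg
  have dxf : ∀ s ∈ Set.Icc 0 D, dist x (f s) = s := by
    intro s hs
    have := hf 0 ⟨le_rfl, D0⟩ s hs
    rw [f0, zero_sub, abs_neg, abs_of_nonneg hs.1] at this
    exact this
  have dxg : ∀ s ∈ Set.Icc 0 E, dist x (g s) = s := by
    intro s hs
    have := hg 0 ⟨le_rfl, E0⟩ s hs
    rw [g0, zero_sub, abs_neg, abs_of_nonneg hs.1] at this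
    exact this
  have hinj : ∀ s ∈ Set.Icc 0 D, ∀ t ∈ Set.Icc 0 E, a < t → f s ≠ g t := by
    intro s hs t ht hat he
    have h1 := dxf s hs
    rw [he, dxg t ht] at h1
    subst h1
    have := hamax t ⟨⟨ht.1, le_min hs.2 ht.2⟩, by rw [he, dist_self]⟩
    linarith
  have m1 : dist x (f a) + dist (f a) y = D := by
    rw [dxf a ⟨a0, aD⟩]
    conv_lhs => rw [← f1]
    rw [hf a ⟨a0, aD⟩ D ⟨D0, le_rfl⟩, abs_sub_comm, abs_of_nonneg (by linarith)]
    ring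
  have m2 : dist x (f a) + dist (f a) z = E := by
    rw [hfg, dxg a ⟨a0, aE⟩]
    conv_lhs => rw [← g1]
    rw [hg a ⟨a0, aE⟩ E ⟨E0, le_rfl⟩, abs_sub_comm, abs_of_nonneg (by linarith)]
    ring
  refine ⟨f a, m1, m2, ?_⟩
  set L := (D - a) + (E - a) with hL
  rcases eq_or_lt_of_le (show 0 ≤ L by linarith) with hL0 | hL0
  · have h1 : a = D := by linarith
    have : f a = y := by rw [h1, f1]
    rw [this]; simp
  set P : ℝ → X := fun u => if u ≤ D - a then f (D - u) else g (u - (D - a) + a) with hP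
  have P0 : P 0 = y := by
    simp only [hP]; rw [if_pos (by linarith), sub_zero, f1]
  have PL : P L = z := by
    simp only [hP]
    split_ifs with hc
    · have h1 : a = E := by linarith
      rw [show D - L = a by linarith, hfg, h1, g1]
    · rw [show L - (D - a) + a = E by linarith, g1]
  have Pm : P (D - a) = f a := by
    simp only [hP]; rw [if_pos le_rfl]; congr 1; ring
  have Pl : ∀ u v, 0 ≤ u → u ≤ v → v ≤ L → dist (P u) (P v) ≤ v - u := by
    intro u v hu huv hv
    simp only [hP]
    split_ifs with h1 h2 h3
    · rw [hf _ ⟨by linarith, by linarith⟩ _ ⟨by linarith, by linarith⟩,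
        abs_of_nonneg (by linarith)]
      linarith
    · have e1 := hf (D - u) ⟨by linarith, by linarith⟩ a ⟨a0, aD⟩
      have e2 := hg a ⟨a0, aE⟩ (v - (D - a) + a) ⟨by linarith, by linarith⟩
      rw [abs_of_nonneg (by linarith)] at e1
      rw [abs_sub_comm, abs_of_nonneg (by linarith), ← hfg] at e2
      have := dist_triangle (f (D - u)) (f a) (g (v - (D - a) + a))
      linarith
    · linarith
    · rw [hg _ ⟨by linarith, by linarith⟩ _ ⟨by linarith, by linarith⟩, abs_sub_comm,
        abs_of_nonneg (by linarith)]
      linarith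
  have Pinj : ∀ u v, 0 ≤ u → u < v → v ≤ L → P u ≠ P v := by
    intro u v hu huv hv
    simp only [hP]
    split_ifs with h1 h2 h3
    · intro he
      have := hf (D - u) ⟨by linarith, by linarith⟩ (D - v) ⟨by linarith, by linarith⟩
      rw [he, dist_self, abs_of_nonneg (by linarith)] at this
      linarith
    · exact hinj _ ⟨by linarith, by linarith⟩ _ ⟨by linarith, by linarith⟩ (by linarith)
    · linarith
    · intro he
      have := hg (u - (D - a) + a) ⟨by linarith, by linarith⟩
        (v - (D - a) + a) ⟨by linarith, by linarith⟩
      rw [he, dist_self, abs_sub_comm, abs_of_nonneg (by linarith)] at this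
      linarith
  set q : Set.Icc (0 : ℝ) 1 → X := fun t => P (L * t) with hq
  have qb : ∀ t : Set.Icc (0 : ℝ) 1, 0 ≤ L * t ∧ L * t ≤ L := fun t =>
    ⟨mul_nonneg hL0.le t.2.1, by have := mul_le_mul_of_nonneg_left t.2.2 hL0.le; linarith⟩
  have qc : Continuous q := by
    refine LipschitzWith.continuous (K := L.toNNReal) (LipschitzWith.of_dist_le_mul ?_)
    intro s t
    rw [Real.coe_toNNReal _ hL0.le, Subtype.dist_eq, Real.dist_eq]
    rcases le_total (s : ℝ) t with hst | hst
    · have := Pl (L * s) (L * t) (qb s).1 (mul_le_mul_of_nonneg_left hst hL0.le) (qb t).2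
      rw [abs_sub_comm, abs_of_nonneg (by linarith), mul_sub]
      exact this
    · have := Pl (L * t) (L * s) (qb t).1 (mul_le_mul_of_nonneg_left hst hL0.le) (qb s).2
      rw [abs_of_nonneg (by linarith), mul_sub, dist_comm]
      exact this
  have qi : Function.Injective q := by
    intro s t hst
    by_contra hne
    have hne' : (s : ℝ) ≠ t := fun h => hne (Subtype.ext h)
    rcases lt_or_gt_of_ne hne' with hlt | hlt
    · exact Pinj (L * s) (L * t) (qb s).1 (mul_lt_mul_of_pos_left hlt hL0) (qb t).2 hst
    · exact Pinj (L * t) (L * s) (qb t).1 (mul_lt_mul_of_pos_left hlt hL0) (qb s).2 hst.symm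
  have q0 : q ⟨0, Set.left_mem_Icc.2 zero_le_one⟩ = y := by simp [hq, P0]
  have q1 : q ⟨1, Set.right_mem_Icc.2 zero_le_one⟩ = z := by simp [hq, PL]
  have hr := h.2 q qc qi
  rw [q0, q1] at hr
  obtain ⟨k, hk, -⟩ := h.1 y z
  have hr := hr k hk
  have hmem : f a ∈ Set.range q := by
    refine ⟨⟨(D - a) / L, div_nonneg (by linarith) hL0.le, (div_le_one hL0).2 (by linarith)⟩, ?_⟩
    simp only [hq]
    rw [mul_div_cancel₀ _ hL0.ne', Pm]
  rw [hr] at hmem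
  obtain ⟨s, hs⟩ := hmem
  obtain ⟨ki, k0, k1⟩ := hk
  have e1 := ki.dist_eq ⟨0, Set.left_mem_Icc.2 dist_nonneg⟩ s
  have e2 := ki.dist_eq s ⟨dist y z, Set.right_mem_Icc.2 dist_nonneg⟩
  rw [k0, hs, Subtype.dist_eq, Real.dist_eq, abs_sub_comm, abs_of_nonneg (by simpa using s.2.1)] at e1
  rw [k1, hs, Subtype.dist_eq, Real.dist_eq, abs_sub_comm,
    abs_of_nonneg (by simpa using s.2.2)] at e2
  simp only at e1 e2
  linarith

theorem rt_dist_on_seg {X : Type*} [MetricSpace X] (h : IsRealTree X) {x z m n : X}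
    (hm : dist x m + dist m z = dist x z) (hn : dist x n + dist n z = dist x z)
    (hle : dist x m ≤ dist x n) : dist m n = dist x n - dist x m := by
  obtain ⟨p, hp1, hp2⟩ := rt_btw h x n (dist x m) dist_nonneg hle
  have : dist x p + dist p z = dist x z := by
    have t1 := dist_triangle x p z
    have t2 := dist_triangle p n z
    linarith
  have hpm : p = m := rt_point_unique h this hm hp1
  rw [← hpm, hp2, hpm]

theorem rt_four {X : Type*} [MetricSpace X] (h : IsRealTree X) : RTFour X := by
  intro y w x z
  obtain ⟨m, hm1, hm2, hm3⟩ := rt_median h x y z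
  obtain ⟨n, hn1, hn2, hn3⟩ := rt_median h x w z
  have t := dist_triangle4 y m n w
  have c1 := dist_comm y m
  have c2 := dist_comm w n
  have c3 := dist_comm y x
  have c4 := dist_comm w x
  rcases le_total (dist x m) (dist x n) with hle | hle
  · refine le_max_of_le_right ?_
    have := rt_dist_on_seg h hm2 hn2 hle
    linarith
  · refine le_max_of_le_left ?_
    have := rt_dist_on_seg h hn2 hm2 hle
    have c5 := dist_comm m n
    linarith

/-! ### The converse -/

theorem rt4_unique {X : Type*} [MetricSpace X] (h4 : RTFour X) {x y p p' : X}
    (hp : dist x p + dist p y = dist x y) (hp' : dist x p' + dist p' y = dist x y)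
    (he : dist x p = dist x p') : p = p' := by
  have h := h4 p p' x y
  have c1 := dist_comm p x
  have c2 := dist_comm p' x
  have : dist p p' ≤ 0 := by
    rcases le_max_iff.1 h with h | h <;> linarith
  exact dist_le_zero.1 this

theorem rt4_path {X : Type*} [MetricSpace X] (h4 : RTFour X) {q : ℝ → X} {a b : ℝ} (hab : a ≤ b)
    (hq : ContinuousOn q (Set.Icc a b)) {p : X}
    (hp : dist (q a) p + dist p (q b) = dist (q a) (q b)) : p ∈ q '' Set.Icc a b := by
  by_contra hne
  set x := q a with hx
  set y := q b with hy
  have hxp : 0 < dist x p := by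
    rw [dist_pos]; intro he
    exact hne ⟨a, Set.left_mem_Icc.2 hab, he⟩
  -- 2 * Gromov product - 2 r
  set G : X → ℝ := fun z => dist x y + dist x z - dist y z - 2 * dist x p with hG
  have Gc : Continuous G := by fun_prop
  have key : ∀ z w, G z < 0 → 0 ≤ G w → dist p w ≤ dist z w := by
    intro z w hz hw
    simp only [hG] at hz hw
    have e1 := h4 z p x y
    have e2 := h4 w p x y
    have e3 := h4 z y w x
    have c1 := dist_comm z x
    have c2 := dist_comm z y
    have c3 := dist_comm w x
    have c4 := dist_comm w y
    have c5 := dist_comm p x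
    have c6 := dist_comm p y
    have c7 := dist_comm p z
    have c8 := dist_comm p w
    have c9 := dist_comm y x
    have n1 : 0 ≤ dist p z := dist_nonneg
    rcases le_max_iff.1 e1 with e1 | e1 <;> rcases le_max_iff.1 e2 with e2 | e2 <;>
    rcases le_max_iff.1 e3 with e3 | e3 <;>
      linarith [dist_triangle z p y, dist_triangle w p x, dist_triangle z p x,
        dist_triangle w p y]
  have hcont : ContinuousOn (fun s => G (q s)) (Set.Icc a b) := Gc.comp_continuousOn hq
  -- V is clopen
  have hpre : IsPreconnected (Set.Icc a b) := isPreconnected_Icc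
  have : PreconnectedSpace (Set.Icc a b) := Subtype.preconnectedSpace hpre
  set Q : Set.Icc a b → X := fun s => q s with hQ
  have Qc : Continuous Q := continuousOn_iff_continuous_domRestrict.1 hq
  set V : Set (Set.Icc a b) := {s | 0 ≤ G (Q s)} with hV
  have Vcl : IsClosed V := isClosed_le continuous_const (Gc.comp Qc)
  have Vop : IsOpen V := by
    rw [isOpen_iff_mem_nhds]
    intro s hs
    have hd : 0 < dist p (Q s) := by
      rw [dist_pos]; intro he
      exact hne ⟨s, s.2, he.symm⟩
    have : ∀ᶠ t in nhds s, dist (Q t) (Q s) < dist p (Q s) := by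
      have := Qc.tendsto s
      exact this.eventually (Metric.ball_mem_nhds _ hd)
    filter_upwards [this] with t ht
    by_contra hc
    have := key (Q t) (Q s) (not_le.1 hc) hs
    linarith
  have hcl : IsClopen V := ⟨Vcl, Vop⟩
  rcases isClopen_iff.1 hcl with hV' | hV'
  · have : (⟨b, Set.right_mem_Icc.2 hab⟩ : Set.Icc a b) ∈ V := by
      simp only [hV, hG, hQ, Set.mem_ofPred_eq]
      rw [← hy, dist_self]
      have : 0 ≤ dist p y := dist_nonneg
      linarith
    rw [hV'] at this
    exact this
  · have : (⟨a, Set.left_mem_Icc.2 hab⟩ : Set.Icc a b) ∈ V := by rw [hV']; trivial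
    simp only [hV, hG, hQ, Set.mem_ofPred_eq] at this
    rw [← hx, dist_self, dist_comm y x] at this
    linarith

theorem rt4_median {X : Type*} [MetricSpace X] (h4 : RTFour X) (hb : RTBtw X) (x y z : X) :
    ∃ m : X, dist x m + dist m y = dist x y ∧ dist x m + dist m z = dist x z ∧
      dist z m + dist m y = dist z y := by
  have t1 := dist_triangle x y z
  have t2 := dist_triangle y x z
  have t3 := dist_triangle x z y
  have c1 := dist_comm x y
  have c2 := dist_comm z y
  obtain ⟨m, hm1, hm2⟩ := hb x y ((dist x y + dist x z - dist y z) / 2)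
    (by linarith) (by linarith)
  have e := h4 z m x y
  have c3 := dist_comm z x
  have c4 := dist_comm m x
  have c5 := dist_comm z m
  have hz : dist z m ≤ (dist x z + dist y z - dist x y) / 2 := by
    rcases le_max_iff.1 e with e | e <;> linarith
  have u1 := dist_triangle x m z
  have u2 := dist_triangle z m y
  refine ⟨m, by linarith, by linarith, by linarith⟩

theorem rt4_realTree {X : Type*} [MetricSpace X] (h4 : RTFour X) (hb : RTBtw X) :
    IsRealTree X := by
  refine ⟨?_, ?_⟩
  · intro s t
    choose p hp1 hp2 using fun r : Set.Icc (0 : ℝ) (dist s t) => hb s t r r.2.1 r.2.2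
    have key : ∀ u v : Set.Icc (0 : ℝ) (dist s t), (u : ℝ) ≤ v → dist (p u) (p v) = v - u := by
      intro u v huv
      obtain ⟨w, hw1, hw2⟩ := hb s (p v) u u.2.1 (by rw [hp1]; exact huv)
      have : w = p u := by
        refine rt4_unique h4 (x := s) (y := t) ?_ ?_ ?_
        · have := dist_triangle s w t
          have := dist_triangle w (p v) t
          have := hp1 v
          have := hp2 v
          linarith
        · rw [hp1, hp2]; ring
        · rw [hw1, hp1]
      rw [← this, hw2, hp1]
    refine ⟨p, ⟨Isometry.of_dist_eq ?_, ?_, ?_⟩, ?_⟩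
    · intro u v
      rw [Subtype.dist_eq, Real.dist_eq]
      rcases le_total (u : ℝ) v with h | h
      · rw [key u v h, abs_sub_comm, abs_of_nonneg (by linarith)]
      · rw [dist_comm, key v u h, abs_of_nonneg (by linarith)]
    · have := hp1 ⟨0, Set.left_mem_Icc.2 dist_nonneg⟩
      exact (dist_eq_zero.1 this).symm
    · have := hp2 ⟨dist s t, Set.right_mem_Icc.2 dist_nonneg⟩
      simp only [sub_self] at this
      exact dist_eq_zero.1 this
    · rintro f ⟨fi, f0, f1⟩
      funext u
      have e1 := fi.dist_eq ⟨0, Set.left_mem_Icc.2 dist_nonneg⟩ u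
      have e2 := fi.dist_eq u ⟨dist s t, Set.right_mem_Icc.2 dist_nonneg⟩
      rw [f0, Subtype.dist_eq, Real.dist_eq, abs_sub_comm,
        abs_of_nonneg (by simpa using u.2.1)] at e1
      rw [f1, Subtype.dist_eq, Real.dist_eq, abs_sub_comm,
        abs_of_nonneg (by simpa using u.2.2)] at e2
      simp only at e1 e2
      refine rt4_unique h4 (x := s) (y := t) ?_ ?_ ?_
      · linarith
      · rw [hp1, hp2]; ring
      · rw [hp1, e1]; ring
  · intro q qc qi
    suffices hmain : ∀ x y : X, q ⟨0, Set.left_mem_Icc.2 zero_le_one⟩ = x →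
        q ⟨1, Set.right_mem_Icc.2 zero_le_one⟩ = y → ∀ f : Set.Icc (0 : ℝ) (dist x y) → X,
        arcProp x y f → Set.range q = Set.range f from hmain _ _ rfl rfl
    intro x y hx hy f hf
    set Q : ℝ → X := fun s => q (Set.projIcc 0 1 zero_le_one s) with hQ
    have Qc : Continuous Q := qc.comp continuous_projIcc
    have Qv : ∀ s (hs : s ∈ Set.Icc (0 : ℝ) 1), Q s = q ⟨s, hs⟩ := fun s hs => by
      simp only [hQ]; rw [Set.projIcc_of_mem _ hs]
    have Q0 : Q 0 = x := (Qv 0 _).trans hx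
    have Q1 : Q 1 = y := (Qv 1 _).trans hy
    obtain ⟨fi, f0, f1⟩ := hf
    have e1 := fun u => fi.dist_eq ⟨0, Set.left_mem_Icc.2 dist_nonneg⟩ u
    have e2 := fun u => fi.dist_eq u ⟨dist x y, Set.right_mem_Icc.2 dist_nonneg⟩
    have e1' : ∀ u, dist x (f u) = u := by
      intro u
      have e1 := e1 u
      rw [f0, Subtype.dist_eq, Real.dist_eq, abs_sub_comm,
        abs_of_nonneg (by simpa using u.2.1)] at e1
      simpa using e1
    have e2' : ∀ u, dist (f u) y = dist x y - u := by
      intro u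
      have e2 := e2 u
      rw [f1, Subtype.dist_eq, Real.dist_eq, abs_sub_comm,
        abs_of_nonneg (by simpa using u.2.2)] at e2
      simpa using e2
    apply Set.Subset.antisymm
    · rintro _ ⟨s, rfl⟩
      obtain ⟨m, hm1, hm2, hm3⟩ := rt4_median h4 hb x y (q s)
      have hs : Q s = q s := Qv s s.2
      obtain ⟨u, hu, hu'⟩ := rt4_path h4 (q := Q) (a := 0) (b := s) s.2.1 Qc.continuousOn (p := m)
        (by rw [Q0, hs]; exact hm2)
      obtain ⟨v, hv, hv'⟩ := rt4_path h4 (q := Q) (a := s) (b := 1) s.2.2 Qc.continuousOn (p := m)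
        (by rw [Q1, hs]; exact hm3)
      have hu1 : u ∈ Set.Icc (0 : ℝ) 1 := ⟨hu.1, hu.2.trans s.2.2⟩
      have hv1 : v ∈ Set.Icc (0 : ℝ) 1 := ⟨s.2.1.trans hv.1, hv.2⟩
      have huv : u = v := by
        have : q ⟨u, hu1⟩ = q ⟨v, hv1⟩ := by rw [← Qv, ← Qv, hu', hv']
        exact congrArg Subtype.val (qi this)
      have hus : u = s := le_antisymm hu.2 (huv ▸ hv.1)
      have hmq : m = q s := by rw [← hu', hus, hs]
      have hle : dist x m ≤ dist x y := by
        have := dist_nonneg (x := m) (y := y); linarith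
      refine ⟨⟨dist x m, dist_nonneg, hle⟩, ?_⟩
      rw [← hmq]
      refine rt4_unique h4 (x := x) (y := y) ?_ hm1 ?_
      · rw [e1', e2']; ring
      · rw [e1']
    · rintro _ ⟨u, rfl⟩
      obtain ⟨s, hs, hs'⟩ := rt4_path h4 (q := Q) (a := 0) (b := 1) zero_le_one Qc.continuousOn
        (p := f u) (by rw [Q0, Q1, e1', e2']; ring)
      exact ⟨⟨s, hs⟩, by rw [← Qv, hs']⟩

/-! ### Hopf-Rinow -/

theorem rt_proper {X : Type*} [MetricSpace X] [CompleteSpace X] [LocallyCompactSpace X]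
    (hb : RTBtw X) : ProperSpace X := by
  have main : ∀ x : X, ∀ R : ℝ, 0 ≤ R → IsCompact (Metric.closedBall x R) := by
    intro x R hR
    set s : Set ℝ := {r | IsCompact (Metric.closedBall x r)} with hs
    have hdown : ∀ r ∈ s, ∀ r' ≤ r, r' ∈ s := fun r hr r' h =>
      IsCompact.of_isClosed_subset hr Metric.isClosed_closedBall (Metric.closedBall_subset_closedBall h)
    have h0 : (0 : ℝ) ∈ s := by simp [hs]
    have hcl : IsClosed s := by
      rw [← isSeqClosed_iff_isClosed]
      intro u r hu hur
      rcases lt_or_ge r 0 with hr0 | hr0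
      · exact hdown 0 h0 r hr0.le
      refine isCompact_iff_totallyBounded_isComplete.2 ⟨?_, Metric.isClosed_closedBall.isComplete⟩
      rw [Metric.totallyBounded_iff]
      intro ε hε
      obtain ⟨n, hn⟩ := (hur.eventually (Metric.ball_mem_nhds r (half_pos hε))).exists
      have hn' : r - ε / 2 < u n := by
        rw [Real.dist_eq] at hn
        linarith [(abs_lt.1 hn).1]
      have hc : IsCompact (Metric.closedBall x (max 0 (r - ε / 2))) := by
        refine hdown (max 0 (u n)) ?_ _ (max_le_max le_rfl hn'.le)
        rcases max_choice 0 (u n) with h | h <;> rw [h]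
        · exact h0
        · exact hu n
      obtain ⟨t, ht, hcov⟩ := Metric.totallyBounded_iff.1 hc.totallyBounded (ε / 2) (half_pos hε)
      refine ⟨t, ht, ?_⟩
      intro y hy
      rw [Metric.mem_closedBall, dist_comm] at hy
      obtain ⟨p, hp1, hp2⟩ := hb x y (max 0 (dist x y - ε / 2)) (le_max_left _ _)
        (max_le dist_nonneg (by linarith))
      have hpm : p ∈ Metric.closedBall x (max 0 (r - ε / 2)) := by
        rw [Metric.mem_closedBall, dist_comm, hp1]
        exact max_le_max le_rfl (by linarith)
      obtain ⟨c, hc, hpc⟩ := Set.mem_iUnion₂.1 (hcov hpm)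
      refine Set.mem_iUnion₂.2 ⟨c, hc, ?_⟩
      rw [Metric.mem_ball] at hpc ⊢
      have := dist_triangle_left y c p
      have := le_max_right 0 (dist x y - ε / 2)
      linarith
    have := IsClosed.Icc_subset_of_forall_exists_gt (a := 0) (b := R) (s := s)
      (hcl.inter isClosed_Icc) h0 ?_
    · exact this ⟨hR, le_rfl⟩
    rintro r ⟨hr, hr0, -⟩ r' hr'
    obtain ⟨δ, hδ, hδc⟩ := IsCompact.exists_isCompact_cthickening hr
    refine ⟨min r' (r + δ), ?_, lt_min hr' (by linarith), min_le_left _ _⟩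
    refine hdown (r + δ) ?_ _ (min_le_right _ _)
    refine IsCompact.of_isClosed_subset hδc Metric.isClosed_closedBall ?_
    intro y hy
    rw [Metric.mem_closedBall, dist_comm] at hy
    obtain ⟨p, hp1, hp2⟩ := hb x y (min r (dist x y)) (le_min hr0 dist_nonneg) (min_le_right _ _)
    refine Metric.mem_cthickening_of_dist_le y p δ _ ?_ ?_
    · rw [Metric.mem_closedBall, dist_comm, hp1]; exact min_le_left _ _
    · rw [dist_comm, hp2]
      rcases min_choice r (dist x y) with h | h <;> rw [h] <;> linarith
  exact ProperSpace.of_isCompact_closedBall_of_le 0 main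

/-! ### Gromov-Hausdorff estimates -/

theorem pgh_nonneg (X₁ : Type*) [MetricSpace X₁] (ρ₁ : X₁)
    (X₂ : Type*) [MetricSpace X₂] (ρ₂ : X₂) : 0 ≤ pGHDist X₁ ρ₁ X₂ ρ₂ := by
  apply Real.sInf_nonneg
  rintro r ⟨f, g, -, -, rfl⟩
  exact le_max_of_le_right dist_nonneg

theorem pgh_le_of {X₁ : Type*} [MetricSpace X₁] {ρ₁ : X₁}
    {X₂ : Type*} [MetricSpace X₂] {ρ₂ : X₂} (f₁ : X₁ → ellInfty) (f₂ : X₂ → ellInfty)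
    (h₁ : Isometry f₁) (h₂ : Isometry f₂) (h : f₁ ρ₁ = f₂ ρ₂) {r : ℝ} (hr : 0 ≤ r)
    (H₁ : ∀ x, ∃ y, dist (f₁ x) (f₂ y) ≤ r) (H₂ : ∀ y, ∃ x, dist (f₁ x) (f₂ y) ≤ r) :
    pGHDist X₁ ρ₁ X₂ ρ₂ ≤ r := by
  have hle : max (Metric.hausdorffDist (Set.range f₁) (Set.range f₂)) (dist (f₁ ρ₁) (f₂ ρ₂)) ≤ r := by
    refine max_le (Metric.hausdorffDist_le_of_mem_dist hr ?_ ?_) (by rw [h, dist_self]; exact hr)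
    · rintro _ ⟨x, rfl⟩
      obtain ⟨y, hy⟩ := H₁ x
      exact ⟨_, ⟨y, rfl⟩, hy⟩
    · rintro _ ⟨y, rfl⟩
      obtain ⟨x, hx⟩ := H₂ y
      exact ⟨_, ⟨x, rfl⟩, by rw [dist_comm]; exact hx⟩
  refine le_trans (csInf_le ⟨0, ?_⟩ ⟨f₁, f₂, h₁, h₂, rfl⟩) hle
  rintro r ⟨f, g, -, -, rfl⟩
  exact le_max_of_le_right dist_nonneg

theorem pgh_base (X : Type*) [MetricSpace X] [TopologicalSpace.SeparableSpace X] (ρ : X) :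
    ∃ f : X → ellInfty, Isometry f ∧ f ρ = 0 := by
  refine ⟨fun x => kuratowskiEmbedding X x - kuratowskiEmbedding X ρ, ?_, sub_self _⟩
  refine Isometry.of_dist_eq fun x y => ?_
  rw [dist_sub_right]
  exact (kuratowskiEmbedding.isometry X).dist_eq x y

theorem pgh_le_radius {X₁ : Type*} [MetricSpace X₁] [TopologicalSpace.SeparableSpace X₁] {ρ₁ : X₁}
    {X₂ : Type*} [MetricSpace X₂] [TopologicalSpace.SeparableSpace X₂] {ρ₂ : X₂} {r : ℝ}
    (hr : 0 ≤ r) (H₁ : ∀ x, dist x ρ₁ ≤ r) (H₂ : ∀ x, dist x ρ₂ ≤ r) :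
    pGHDist X₁ ρ₁ X₂ ρ₂ ≤ r := by
  obtain ⟨f, hf, f0⟩ := pgh_base X₁ ρ₁
  obtain ⟨g, hg, g0⟩ := pgh_base X₂ ρ₂
  refine pgh_le_of f g hf hg (f0.trans g0.symm) hr (fun x => ⟨ρ₂, ?_⟩) (fun y => ⟨ρ₁, ?_⟩)
  · rw [g0, ← f0, hf.dist_eq]; exact H₁ x
  · rw [f0, ← g0, hg.dist_eq, dist_comm]; exact H₂ y

theorem pgh_lt {X₁ : Type*} [MetricSpace X₁] [CompactSpace X₁] {ρ₁ : X₁}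
    {X₂ : Type*} [MetricSpace X₂] [CompactSpace X₂] {ρ₂ : X₂} {r : ℝ}
    (h : pGHDist X₁ ρ₁ X₂ ρ₂ < r) : ∃ (f₁ : X₁ → ellInfty) (f₂ : X₂ → ellInfty),
      Isometry f₁ ∧ Isometry f₂ ∧ ∀ y, ∃ x, dist (f₁ x) (f₂ y) < r := by
  obtain ⟨f, hf, f0⟩ := pgh_base X₁ ρ₁
  obtain ⟨g, hg, g0⟩ := pgh_base X₂ ρ₂
  obtain ⟨_, ⟨f₁, f₂, h₁, h₂, rfl⟩, hlt⟩ := exists_lt_of_csInf_lt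
    (s := { r : ℝ | ∃ (f₁ : X₁ → ellInfty) (f₂ : X₂ → ellInfty),
    Isometry f₁ ∧ Isometry f₂ ∧
    r = max (Metric.hausdorffDist (Set.range f₁) (Set.range f₂)) (dist (f₁ ρ₁) (f₂ ρ₂)) })
    ⟨_, f, g, hf, hg, rfl⟩ h
  refine ⟨f₁, f₂, h₁, h₂, fun y => ?_⟩
  have fin : Metric.hausdorffEDist (Set.range f₁) (Set.range f₂) ≠ ⊤ :=
    Metric.hausdorffEDist_ne_top_of_nonempty_of_bounded ⟨_, ρ₁, rfl⟩ ⟨_, ρ₂, rfl⟩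
      (isCompact_range h₁.continuous).isBounded (isCompact_range h₂.continuous).isBounded
  obtain ⟨_, ⟨x, rfl⟩, hx⟩ := Metric.exists_dist_lt_of_hausdorffDist_lt' (Set.mem_range_self y)
    (lt_of_le_of_lt (le_max_left _ _) hlt) fin
  exact ⟨x, hx⟩

theorem pgh_ball_le {X₁ : Type*} [MetricSpace X₁] [ProperSpace X₁] (ρ₁ : X₁)
    {X₂ : Type*} [MetricSpace X₂] [ProperSpace X₂] (ρ₂ : X₂) (k : ℕ) :
    pGHDist (↥(Metric.closedBall ρ₁ ((k : ℝ) + 1)))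
      ⟨ρ₁, Metric.mem_closedBall_self (by positivity)⟩
      (↥(Metric.closedBall ρ₂ ((k : ℝ) + 1)))
      ⟨ρ₂, Metric.mem_closedBall_self (by positivity)⟩ ≤ (k : ℝ) + 1 :=
  pgh_le_radius (by positivity) (fun x => x.2) (fun x => x.2)

theorem pgh_summable_bound : Summable (fun k : ℕ => (2 : ℝ)⁻¹ ^ (k + 1) * ((k : ℝ) + 1)) := by
  have h := summable_pow_mul_geometric_of_norm_lt_one 1 (r := (2 : ℝ)⁻¹) (by norm_num)
  have h2 := (summable_nat_add_iff 1).2 h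
  refine h2.congr fun k => ?_
  push_cast
  ring

theorem pgh_le_delta {X₁ : Type*} [MetricSpace X₁] [ProperSpace X₁] (ρ₁ : X₁)
    {X₂ : Type*} [MetricSpace X₂] [ProperSpace X₂] (ρ₂ : X₂) (k : ℕ) :
    (2 : ℝ)⁻¹ ^ (k + 1) * pGHDist (↥(Metric.closedBall ρ₁ ((k : ℝ) + 1)))
      ⟨ρ₁, Metric.mem_closedBall_self (by positivity)⟩
      (↥(Metric.closedBall ρ₂ ((k : ℝ) + 1)))
      ⟨ρ₂, Metric.mem_closedBall_self (by positivity)⟩ ≤ deltaGH X₁ ρ₁ X₂ ρ₂ := by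
  have hs : Summable (fun k : ℕ => (2 : ℝ)⁻¹ ^ (k + 1) *
      pGHDist (↥(Metric.closedBall ρ₁ ((k : ℝ) + 1)))
      ⟨ρ₁, Metric.mem_closedBall_self (by positivity)⟩
      (↥(Metric.closedBall ρ₂ ((k : ℝ) + 1)))
      ⟨ρ₂, Metric.mem_closedBall_self (by positivity)⟩) :=
    Summable.of_nonneg_of_le (fun k => mul_nonneg (by positivity) (pgh_nonneg _ _ _ _))
      (fun k => mul_le_mul_of_nonneg_left (pgh_ball_le ρ₁ ρ₂ k) (by positivity)) pgh_summable_bound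
  exact hs.le_tsum k (fun k _ => mul_nonneg (by positivity) (pgh_nonneg _ _ _ _))

/-! ### The limit space -/

theorem lim_totallyBounded {X : ℕ → Type*} [∀ n, MetricSpace (X n)] [∀ n, ProperSpace (X n)]
    (ρ : ∀ n, X n) {C : Type*} [MetricSpace C] (ι : ∀ n, X n → C)
    (hι : ∀ n, Isometry (ι n)) (c : C) (hc : ∀ n, ι n (ρ n) = c)
    (hmono : ∀ n p, n ≤ p → ∀ x : X n, ∃ y : X p, ι p y = ι n x)
    (hcauchy : ∀ ε : ℝ, 0 < ε → ∃ N : ℕ, ∀ p, N ≤ p → ∀ q, N ≤ q →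
      deltaGH (X p) (ρ p) (X q) (ρ q) < ε) (k : ℕ) :
    TotallyBounded {z : C | dist z c ≤ (k : ℝ) + 1 ∧ ∃ n x, ι n x = z} := by
  rw [Metric.totallyBounded_iff]
  by_contra! hcon
  obtain ⟨ε, hε, hcon⟩ := hcon
  obtain ⟨u, hu1, hu2⟩ := exists_seq_of_forall_finset_exists
    (P := fun z : C => dist z c ≤ (k : ℝ) + 1 ∧ ∃ n x, ι n x = z)
    (r := fun z w => ε ≤ dist w z) (by
      intro s _
      have h := hcon s s.finite_toSet
      obtain ⟨y, hy, hy'⟩ := Set.not_subset.1 h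
      refine ⟨y, hy, fun x hx => ?_⟩
      by_contra hlt
      exact hy' (Set.mem_iUnion₂.2 ⟨x, hx, not_le.1 hlt⟩))
  obtain ⟨N, hN⟩ := hcauchy ((2 : ℝ)⁻¹ ^ (k + 1) * (ε / 4)) (by positivity)
  have hK : IsCompact (Metric.closedBall (ρ N) ((k : ℝ) + 1)) := isCompact_closedBall _ _
  have : CompactSpace (Metric.closedBall (ρ N) ((k : ℝ) + 1)) := isCompact_iff_compactSpace.1 hK
  obtain ⟨F, hF, hFcov⟩ := Metric.totallyBounded_iff.1
    (isCompact_univ (X := Metric.closedBall (ρ N) ((k : ℝ) + 1))).totallyBounded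
    (ε / 4) (by positivity)
  choose nn xx hnx using fun i => (hu1 i).2
  set M := hF.toFinset.card with hM
  set q := max N ((Finset.range (M + 1)).sup nn) with hq
  have hex : ∀ i : Fin (M + 1), ∃ y : X q, ι q y = u i := by
    intro i
    have : nn i ≤ q := le_max_of_le_right (Finset.le_sup (Finset.mem_range.2 i.2))
    obtain ⟨y, hy⟩ := hmono _ _ this (xx i)
    exact ⟨y, hy.trans (hnx i)⟩
  choose y hy using hex
  have hyb : ∀ i, y i ∈ Metric.closedBall (ρ q) ((k : ℝ) + 1) := by
    intro i
    rw [Metric.mem_closedBall, ← (hι q).dist_eq, hy, hc]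
    exact (hu1 i).1
  have hlt := lt_of_le_of_lt (pgh_le_delta (ρ N) (ρ q) k) (hN N le_rfl q (le_max_left _ _))
  have hlt := lt_of_mul_lt_mul_left hlt (by positivity)
  have : CompactSpace (Metric.closedBall (ρ q) ((k : ℝ) + 1)) :=
    isCompact_iff_compactSpace.1 (isCompact_closedBall _ _)
  obtain ⟨f₁, f₂, h₁, h₂, hf⟩ := pgh_lt hlt
  choose a ha using fun i => hf ⟨y i, hyb i⟩
  have hb : ∀ i, ∃ b ∈ F, dist (a i) b < ε / 4 := by
    intro i
    obtain ⟨b, hb, hab⟩ := Set.mem_iUnion₂.1 (hFcov (Set.mem_univ (a i)))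
    exact ⟨b, hb, hab⟩
  choose b hbF hab using hb
  obtain ⟨i, -, j, -, hij, hbij⟩ := Finset.exists_ne_map_eq_of_card_lt_of_maps_to
    (s := (Finset.univ : Finset (Fin (M + 1)))) (t := hF.toFinset) (f := b) (by simp [hM])
    (fun i _ => hF.mem_toFinset.2 (hbF i))
  have hd : dist (u i) (u j) < ε := by
    rw [← hy, ← hy, (hι q).dist_eq]
    have e : dist (y i) (y j) = dist (f₂ ⟨y i, hyb i⟩) (f₂ ⟨y j, hyb j⟩) := by
      rw [h₂.dist_eq]; rfl
    rw [e]
    have e1 := ha i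
    have e2 := ha j
    have e3 := hab i
    have e4 := hab j
    rw [← h₁.dist_eq] at e3 e4
    rw [hbij] at e3
    have t1 := dist_triangle4 (f₂ ⟨y i, hyb i⟩) (f₁ (a i)) (f₁ (b j)) (f₂ ⟨y j, hyb j⟩)
    have t2 := dist_triangle (f₁ (b j)) (f₁ (a j)) (f₂ ⟨y j, hyb j⟩)
    rw [dist_comm (f₁ (b j)) (f₁ (a j))] at t2
    rw [dist_comm (f₂ ⟨y i, hyb i⟩) (f₁ (a i))] at t1
    linarith
  have hij' : (i : ℕ) ≠ j := fun h => hij (Fin.ext h)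
  rcases lt_or_gt_of_ne hij' with h | h
  · have := hu2 _ _ h
    rw [dist_comm] at this
    linarith
  · have := hu2 _ _ h
    linarith

theorem lim_proper {X : ℕ → Type*} [∀ n, MetricSpace (X n)] [∀ n, ProperSpace (X n)]
    (ρ : ∀ n, X n) {C : Type*} [MetricSpace C] [CompleteSpace C] (ι : ∀ n, X n → C)
    (hι : ∀ n, Isometry (ι n)) (c : C) (hc : ∀ n, ι n (ρ n) = c)
    (hmono : ∀ n p, n ≤ p → ∀ x : X n, ∃ y : X p, ι p y = ι n x)
    (hdense : ∀ z : C, ∀ ε > 0, ∃ n x, dist z (ι n x) < ε)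
    (hcauchy : ∀ ε : ℝ, 0 < ε → ∃ N : ℕ, ∀ p, N ≤ p → ∀ q, N ≤ q →
      deltaGH (X p) (ρ p) (X q) (ρ q) < ε) : ProperSpace C := by
  have main : ∀ k : ℕ, IsCompact (Metric.closedBall c k) := by
    intro k
    refine isCompact_iff_totallyBounded_isComplete.2 ⟨?_, Metric.isClosed_closedBall.isComplete⟩
    refine (lim_totallyBounded ρ ι hι c hc hmono hcauchy k).closure.subset ?_
    intro z hz
    rw [Metric.mem_closure_iff]
    intro ε hε
    obtain ⟨n, x, hx⟩ := hdense z (min ε 1) (lt_min hε one_pos)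
    refine ⟨ι n x, ⟨?_, n, x, rfl⟩, lt_of_lt_of_le hx (min_le_left _ _)⟩
    have := lt_of_lt_of_le hx (min_le_right _ _)
    have := dist_triangle_left (ι n x) c z
    rw [Metric.mem_closedBall] at hz
    linarith
  refine ⟨fun x r => ?_⟩
  obtain ⟨k, hk⟩ := exists_nat_ge (r + dist x c)
  exact (main k).of_isClosed_subset Metric.isClosed_closedBall
    (Metric.closedBall_subset_closedBall' hk)

theorem lim_realTree {X : ℕ → Type*} [∀ n, MetricSpace (X n)]
    {C : Type*} [MetricSpace C] [ProperSpace C] (ι : ∀ n, X n → C)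
    (hι : ∀ n, Isometry (ι n))
    (hmono : ∀ n p, n ≤ p → ∀ x : X n, ∃ y : X p, ι p y = ι n x)
    (hdense : ∀ z : C, ∀ ε > 0, ∃ n x, dist z (ι n x) < ε)
    (htree : ∀ n, IsRealTree (X n)) : IsRealTree C := by
  -- approximating sequences in the union
  have happ : ∀ z : C, ∃ u : ℕ → C, (∀ i, ∃ n x, ι n x = u i) ∧
      Filter.Tendsto u Filter.atTop (nhds z) := by
    intro z
    have : z ∈ closure {w : C | ∃ n x, ι n x = w} := by
      rw [Metric.mem_closure_iff]
      intro ε hε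
      obtain ⟨n, x, h⟩ := hdense z ε hε
      exact ⟨_, ⟨n, x, rfl⟩, h⟩
    exact mem_closure_iff_seq_limit.1 this
  apply rt4_realTree
  · intro x y z w
    obtain ⟨x', hx', hx⟩ := happ x
    obtain ⟨y', hy', hy⟩ := happ y
    obtain ⟨z', hz', hz⟩ := happ z
    obtain ⟨w', hw', hw⟩ := happ w
    refine le_of_tendsto_of_tendsto' ((hx.dist hy).add (hz.dist hw))
      (((hx.dist hz).add (hy.dist hw)).max ((hx.dist hw).add (hy.dist hz))) ?_
    intro i
    obtain ⟨n1, a1, h1⟩ := hx' i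
    obtain ⟨n2, a2, h2⟩ := hy' i
    obtain ⟨n3, a3, h3⟩ := hz' i
    obtain ⟨n4, a4, h4⟩ := hw' i
    set N := max (max n1 n2) (max n3 n4) with hN
    obtain ⟨b1, e1⟩ := hmono n1 N (by omega) a1
    obtain ⟨b2, e2⟩ := hmono n2 N (by omega) a2
    obtain ⟨b3, e3⟩ := hmono n3 N (by omega) a3
    obtain ⟨b4, e4⟩ := hmono n4 N (by omega) a4
    rw [← h1, ← h2, ← h3, ← h4, ← e1, ← e2, ← e3, ← e4]
    simp only [(hι N).dist_eq]
    exact rt_four (htree N) b1 b2 b3 b4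
  · intro x y r hr0 hr
    obtain ⟨x', hx', hx⟩ := happ x
    obtain ⟨y', hy', hy⟩ := happ y
    have hp : ∀ i, ∃ p, dist (x' i) p = min r (dist (x' i) (y' i)) ∧
        dist p (y' i) = dist (x' i) (y' i) - min r (dist (x' i) (y' i)) := by
      intro i
      obtain ⟨n1, a1, h1⟩ := hx' i
      obtain ⟨n2, a2, h2⟩ := hy' i
      obtain ⟨b1, e1⟩ := hmono n1 (max n1 n2) (le_max_left _ _) a1
      obtain ⟨b2, e2⟩ := hmono n2 (max n1 n2) (le_max_right _ _) a2
      obtain ⟨p, hp1, hp2⟩ := rt_btw (htree (max n1 n2)) b1 b2 (min r (dist b1 b2))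
        (le_min hr0 dist_nonneg) (min_le_right _ _)
      refine ⟨ι _ p, ?_⟩
      rw [← h1, ← h2, ← e1, ← e2]
      simp only [(hι _).dist_eq]
      exact ⟨hp1, hp2⟩
    choose p hp1 hp2 using hp
    have hbd : Bornology.IsBounded (Set.range x') := Metric.isBounded_range_of_tendsto _ hx
    obtain ⟨R, hR⟩ := hbd.subset_closedBall x
    obtain ⟨a, -, φ, hφ, ha⟩ := tendsto_subseq_of_bounded
      (s := Metric.closedBall x (R + r)) Metric.isBounded_closedBall (x := p) (by
        intro i
        have h1 : dist (x' i) x ≤ R := hR ⟨i, rfl⟩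
        have h2 := hp1 i
        have h3 := min_le_left r (dist (x' i) (y' i))
        have h4 := dist_triangle_left (p i) x (x' i)
        rw [Metric.mem_closedBall]
        linarith)
    have hx2 := hx.comp hφ.tendsto_atTop
    have hy2 := hy.comp hφ.tendsto_atTop
    have hd := hx2.dist hy2
    have hm := (tendsto_const_nhds (x := r)).min hd
    rw [min_eq_left hr] at hm
    refine ⟨a, ?_, ?_⟩
    · refine tendsto_nhds_unique (hx2.dist ha) (hm.congr fun i => ?_)
      exact (hp1 _).symm
    · refine tendsto_nhds_unique (ha.dist hy2) ((hd.sub hm).congr fun i => ?_)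
      exact (hp2 _).symm

theorem lim_tendsto {X : ℕ → Type*} [∀ n, MetricSpace (X n)] [∀ n, ProperSpace (X n)]
    (ρ : ∀ n, X n) {C : Type*} [MetricSpace C] [ProperSpace C] (ι : ∀ n, X n → C)
    (hι : ∀ n, Isometry (ι n)) (c : C) (hc : ∀ n, ι n (ρ n) = c)
    (hmono : ∀ n p, n ≤ p → ∀ x : X n, ∃ y : X p, ι p y = ι n x)
    (hdense : ∀ z : C, ∀ ε > 0, ∃ n x, dist z (ι n x) < ε)
    (htree : ∀ n, IsRealTree (X n)) :
    Filter.Tendsto (fun n => deltaGH (X n) (ρ n) C c) Filter.atTop (nhds 0) := by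
  have hz : (0 : ℝ) = ∑' _ : ℕ, (0 : ℝ) := by simp
  rw [hz]
  unfold deltaGH
  refine tendsto_tsum_of_dominated_convergence pgh_summable_bound ?_ ?_
  · intro k
    rw [show (0 : ℝ) = (2 : ℝ)⁻¹ ^ (k + 1) * 0 by simp]
    refine Filter.Tendsto.const_mul _ ?_
    rw [Metric.tendsto_atTop]
    intro ε' hε'
    set ε := ε' / 2 with hεd
    have hε : 0 < ε := half_pos hε'
    set R : ℝ := (k : ℝ) + 1 with hR
    have hR0 : 0 ≤ R := by positivity
    set V : ℕ → Set C := fun n => ⋃ y ∈ Metric.closedBall (ρ n) R, Metric.ball (ι n y) ε with hV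
    have hVm : ∀ n p, n ≤ p → V n ⊆ V p := by
      intro n p hnp z hz
      obtain ⟨y, hy, hzy⟩ := Set.mem_iUnion₂.1 hz
      obtain ⟨y', hy'⟩ := hmono n p hnp y
      refine Set.mem_iUnion₂.2 ⟨y', ?_, by rw [hy']; exact hzy⟩
      rw [Metric.mem_closedBall, ← (hι p).dist_eq, hc, hy', ← hc n, (hι n).dist_eq]
      exact hy
    obtain ⟨N, hN⟩ := (isCompact_closedBall c R).elim_directed_cover V
      (fun n => isOpen_biUnion fun _ _ => Metric.isOpen_ball) (by
        intro z hz
        rw [Metric.mem_closedBall] at hz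
        obtain ⟨n, x, hx⟩ := hdense z (ε / 2) (half_pos hε)
        obtain ⟨y, hy1, hy2⟩ := rt_btw (htree n) (ρ n) x (min R (dist (ρ n) x))
          (le_min hR0 dist_nonneg) (min_le_right _ _)
        refine Set.mem_iUnion.2 ⟨n, Set.mem_iUnion₂.2 ⟨y, ?_, ?_⟩⟩
        · rw [Metric.mem_closedBall, dist_comm, hy1]; exact min_le_left _ _
        · rw [Metric.mem_ball]
          have h1 : dist (ρ n) x ≤ R + ε / 2 := by
            rw [← (hι n).dist_eq, hc]
            have := dist_triangle_left c (ι n x) z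
            linarith
          have h2 : dist y x ≤ ε / 2 := by
            rw [hy2]
            rcases min_choice R (dist (ρ n) x) with h | h <;> rw [h] <;> linarith
          rw [← (hι n).dist_eq] at h2
          have := dist_triangle_right z (ι n y) (ι n x)
          linarith)
      (directed_of_isDirected_le hVm)
    refine ⟨N, fun n hn => ?_⟩
    rw [Real.dist_eq, sub_zero, abs_of_nonneg (pgh_nonneg _ _ _ _)]
    refine lt_of_le_of_lt ?_ (half_lt_self hε')
    set f₂ : Metric.closedBall c R → ellInfty := fun z => kuratowskiEmbedding C z with hf₂
    set f₁ : Metric.closedBall (ρ n) R → ellInfty := fun z => kuratowskiEmbedding C (ι n z) with hf₁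
    have kur : ∀ a b : C, dist (kuratowskiEmbedding C a) (kuratowskiEmbedding C b) = dist a b :=
      (kuratowskiEmbedding.isometry C).dist_eq
    refine pgh_le_of f₁ f₂ (Isometry.of_dist_eq fun a b => ?_)
      (Isometry.of_dist_eq fun a b => ?_) ?_ hε.le ?_ ?_
    · simp only [hf₁]
      rw [kur, (hι n).dist_eq]; rfl
    · simp only [hf₂]
      rw [kur]; rfl
    · simp only [hf₁, hf₂, hc]
    · intro x
      refine ⟨⟨ι n x, ?_⟩, ?_⟩
      · rw [Metric.mem_closedBall, ← hc n, (hι n).dist_eq]; exact x.2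
      · simp only [hf₁, hf₂]; rw [dist_self]; exact hε.le
    · intro z
      obtain ⟨y, hy, hzy⟩ := Set.mem_iUnion₂.1 (hVm N n hn (hN z.2))
      refine ⟨⟨y, hy⟩, ?_⟩
      simp only [hf₁, hf₂]
      rw [kur, dist_comm]
      exact (Metric.mem_ball.1 hzy).le
  · refine Filter.Eventually.of_forall fun n k => ?_
    rw [Real.norm_eq_abs, abs_of_nonneg (mul_nonneg (by positivity) (pgh_nonneg _ _ _ _))]
    exact mul_le_mul_of_nonneg_left (pgh_ball_le (ρ n) c k) (by positivity)

theorem completion_unique {Y : Type*} [MetricSpace Y] (y : Y)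
    {C₁ : Type*} [MetricSpace C₁] [CompleteSpace C₁] (j₁ : Y → C₁)
    (h₁ : Isometry j₁) (d₁ : DenseRange j₁)
    {C₂ : Type*} [MetricSpace C₂] [CompleteSpace C₂] (j₂ : Y → C₂)
    (h₂ : Isometry j₂) (d₂ : DenseRange j₂) : PointedIsometric C₁ (j₁ y) C₂ (j₂ y) := by
  let P₁ : AbstractCompletion Y := ⟨C₁, j₁, inferInstance, inferInstance, inferInstance,
    h₁.isUniformInducing, d₁⟩
  let P₂ : AbstractCompletion Y := ⟨C₂, j₂, inferInstance, inferInstance, inferInstance,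
    h₂.isUniformInducing, d₂⟩
  let f : C₁ → C₂ := P₁.compare P₂
  have fc : Continuous f := (P₁.uniformContinuous_compare P₂).continuous
  have fj : ∀ a, f (j₁ a) = j₂ a := P₁.compare_coe P₂
  have hf : Isometry f := by
    refine Isometry.of_dist_eq fun a b => ?_
    refine d₁.induction_on₂ (p := fun a b => dist (f a) (f b) = dist a b) ?_ ?_ a b
    · exact isClosed_eq (by fun_prop) (by fun_prop)
    · intro a b
      rw [fj, fj, h₁.dist_eq, h₂.dist_eq]
  exact ⟨f, hf, (P₁.compareEquiv P₂).bijective, fj y⟩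

theorem glue_metric {Ω : Type*} (S : ℕ → Set Ω) (hle : ∀ n p, n ≤ p → S n ⊆ S p)
    (m : ∀ n, MetricSpace ↥(S n))
    (hcompat : ∀ (n p : ℕ) (hnp : n ≤ p) (a b : Ω) (ha : a ∈ S n) (hb : b ∈ S n),
      mdist (m p) ⟨a, hle n p hnp ha⟩ ⟨b, hle n p hnp hb⟩ = mdist (m n) ⟨a, ha⟩ ⟨b, hb⟩) :
    ∃ M : MetricSpace ↥(⋃ n, S n), ∀ (n : ℕ) (a b : Ω) (ha : a ∈ S n)
      (hb : b ∈ S n), mdist M ⟨a, Set.mem_iUnion.2 ⟨n, ha⟩⟩ ⟨b, Set.mem_iUnion.2 ⟨n, hb⟩⟩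
          = mdist (m n) ⟨a, ha⟩ ⟨b, hb⟩ := by
  choose ix hix using fun a : ↥(⋃ n, S n) => Set.mem_iUnion.1 a.2
  let d : ↥(⋃ n, S n) → ↥(⋃ n, S n) → ℝ := fun a b =>
    mdist (m (max (ix a) (ix b))) ⟨a, hle _ _ (le_max_left _ _) (hix a)⟩
      ⟨b, hle _ _ (le_max_right _ _) (hix b)⟩
  have hd : ∀ (n : ℕ) (a b : ↥(⋃ n, S n)) (ha : (a : Ω) ∈ S n) (hb : (b : Ω) ∈ S n),
      d a b = mdist (m n) ⟨a, ha⟩ ⟨b, hb⟩ := by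
    intro n a b ha hb
    rw [← hcompat n (max n (max (ix a) (ix b))) (le_max_left _ _) a b ha hb]
    exact (hcompat (max (ix a) (ix b)) (max n (max (ix a) (ix b))) (le_max_right _ _) a b _ _).symm
  have hcom : ∀ a b c : ↥(⋃ n, S n), ∃ n, (a : Ω) ∈ S n ∧ (b : Ω) ∈ S n ∧ (c : Ω) ∈ S n := by
    intro a b c
    refine ⟨max (ix a) (max (ix b) (ix c)), hle _ _ ?_ (hix a), hle _ _ ?_ (hix b),
      hle _ _ ?_ (hix c)⟩ <;> omega
  refine ⟨{ dist := d, dist_self := ?_, dist_comm := ?_, dist_triangle := ?_,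
            eq_of_dist_eq_zero := ?_ }, ?_⟩
  · intro a
    obtain ⟨n, ha, -, -⟩ := hcom a a a
    exact (hd n a a ha ha).trans (@dist_self _ (m n).toPseudoMetricSpace _)
  · intro a b
    obtain ⟨n, ha, hb, -⟩ := hcom a b b
    exact (hd n a b ha hb).trans
      ((@dist_comm _ (m n).toPseudoMetricSpace _ _).trans (hd n b a hb ha).symm)
  · intro a b c
    obtain ⟨n, ha, hb, hc⟩ := hcom a b c
    change d a c ≤ d a b + d b c
    rw [hd n a b ha hb, hd n b c hb hc, hd n a c ha hc]
    exact @dist_triangle _ (m n).toPseudoMetricSpace _ _ _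
  · intro a b h
    obtain ⟨n, ha, hb, -⟩ := hcom a b b
    have h : d a b = 0 := h
    rw [hd n a b ha hb] at h
    have h2 := @eq_of_dist_eq_zero _ (m n) _ _ h
    exact Subtype.ext (Subtype.mk.inj h2)
  · intro n a b ha hb
    exact hd n ⟨a, _⟩ ⟨b, _⟩ ha hb

/-- Let `(T_n, d_n, ρ)` be a nested sequence of complete, locally compact rooted real trees
with compatible metrics, Cauchy for the pointed Gromov–Hausdorff metric `δ`. Then the `d_n`
glue to a metric on the union `T_∞`; any two metric completions of `(T_∞, d, ρ)` are pointed
isometric; and every completion is a complete, locally compact rooted real tree to which the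
`T_n` converge in `δ`. -/
theorem nested_trees_completion (Ω : Type) (S : ℕ → Set Ω) (hmono : ∀ n, S n ⊆ S (n + 1))
    (ρ : Ω) (hρ : ∀ n, ρ ∈ S n) (m : ∀ n, MetricSpace ↥(S n))
    (hcompat : ∀ (n : ℕ) (a b : Ω) (ha : a ∈ S n) (hb : b ∈ S n),
      mdist (m (n + 1)) ⟨a, hmono n ha⟩ ⟨b, hmono n hb⟩ = mdist (m n) ⟨a, ha⟩ ⟨b, hb⟩)
    (htree : ∀ n, @IsRealTree _ (m n))
    (hcompl : ∀ n, @CompleteSpace _ (msUniform (m n)))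
    (hlc : ∀ n, @LocallyCompactSpace _ (msTop (m n)))
    (hcauchy : ∀ ε : ℝ, 0 < ε → ∃ N : ℕ, ∀ p, N ≤ p → ∀ q, N ≤ q →
      deltaGHBoth (m p) ⟨ρ, hρ p⟩ (m q) ⟨ρ, hρ q⟩ < ε) :
    ∃ M : MetricSpace ↥(⋃ n, S n),
      (∀ (n : ℕ) (a b : Ω) (ha : a ∈ S n) (hb : b ∈ S n),
        mdist M ⟨a, Set.mem_iUnion.2 ⟨n, ha⟩⟩ ⟨b, Set.mem_iUnion.2 ⟨n, hb⟩⟩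
          = mdist (m n) ⟨a, ha⟩ ⟨b, hb⟩) ∧
      (∀ (C₁ : Type) [MetricSpace C₁] [CompleteSpace C₁] (j₁ : ↥(⋃ n, S n) → C₁),
        IsometryFrom M j₁ → DenseRange j₁ →
        ∀ (C₂ : Type) [MetricSpace C₂] [CompleteSpace C₂] (j₂ : ↥(⋃ n, S n) → C₂),
        IsometryFrom M j₂ → DenseRange j₂ →
        PointedIsometric C₁ (j₁ ⟨ρ, Set.mem_iUnion.2 ⟨0, hρ 0⟩⟩)
          C₂ (j₂ ⟨ρ, Set.mem_iUnion.2 ⟨0, hρ 0⟩⟩)) ∧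
      (∀ (C : Type) [MetricSpace C] [CompleteSpace C] (j : ↥(⋃ n, S n) → C),
        IsometryFrom M j → DenseRange j →
        IsRealTree C ∧ LocallyCompactSpace C ∧
        Filter.Tendsto
          (fun n => deltaGHFrom (m n) ⟨ρ, hρ n⟩ C (j ⟨ρ, Set.mem_iUnion.2 ⟨0, hρ 0⟩⟩))
          Filter.atTop (nhds 0)) := by
  have hle : ∀ n p, n ≤ p → S n ⊆ S p := fun n p h => monotone_nat_of_le_succ hmono h
  have hcompat' : ∀ (n p : ℕ) (hnp : n ≤ p) (a b : Ω) (ha : a ∈ S n) (hb : b ∈ S n),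
      mdist (m p) ⟨a, hle n p hnp ha⟩ ⟨b, hle n p hnp hb⟩ = mdist (m n) ⟨a, ha⟩ ⟨b, hb⟩ := by
    intro n p hnp a b ha hb
    induction p, hnp using Nat.le_induction with
    | base => rfl
    | succ p hp ih => rw [← ih]; exact hcompat p a b _ _
  obtain ⟨M, hM⟩ : ∃ M : MetricSpace ↥(⋃ n, S n), ∀ (n : ℕ) (a b : Ω) (ha : a ∈ S n)
      (hb : b ∈ S n), mdist M ⟨a, Set.mem_iUnion.2 ⟨n, ha⟩⟩ ⟨b, Set.mem_iUnion.2 ⟨n, hb⟩⟩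
          = mdist (m n) ⟨a, ha⟩ ⟨b, hb⟩ :=
    glue_metric S hle m hcompat'
  let : ∀ n, MetricSpace ↥(S n) := m
  let : MetricSpace ↥(⋃ n, S n) := M
  let e : ∀ n, S n → ↥(⋃ n, S n) := fun n x => ⟨x, Set.mem_iUnion.2 ⟨n, x.2⟩⟩
  have he : ∀ n, Isometry (e n) := fun n =>
    Isometry.of_dist_eq fun a b => hM n a b a.2 b.2
  have hcompl' : ∀ n, CompleteSpace (S n) := hcompl
  have hlc' : ∀ n, LocallyCompactSpace (S n) := hlc
  have hprop : ∀ n, ProperSpace (S n) := fun n => rt_proper (rt_btw (htree n))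
  refine ⟨M, hM, ?_, ?_⟩
  · intro C₁ _ _ j₁ h₁ d₁ C₂ _ _ j₂ h₂ d₂
    exact completion_unique _ j₁ h₁ d₁ j₂ h₂ d₂
  · intro C _ _ j hj dj
    have hj' : Isometry j := hj
    have hι : ∀ n, Isometry (fun x => j (e n x)) := fun n => hj'.comp (he n)
    have hmono' : ∀ n p, n ≤ p → ∀ x : S n, ∃ y : S p, j (e p y) = j (e n x) :=
      fun n p hnp x => ⟨⟨x, hle n p hnp x.2⟩, rfl⟩
    have hdense : ∀ z : C, ∀ ε > 0, ∃ n, ∃ x : S n, dist z (j (e n x)) < ε := by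
      intro z ε hε
      obtain ⟨⟨a, ha⟩, h⟩ := dj.exists_dist_lt z hε
      obtain ⟨n, hn⟩ := Set.mem_iUnion.1 ha
      exact ⟨n, ⟨a, hn⟩, h⟩
    have hC : ProperSpace C := lim_proper (fun n => (⟨ρ, hρ n⟩ : S n)) (fun n x => j (e n x)) hι
      (j ⟨ρ, Set.mem_iUnion.2 ⟨0, hρ 0⟩⟩) (fun n => rfl) hmono' hdense hcauchy
    refine ⟨lim_realTree (fun n x => j (e n x)) hι hmono' hdense htree, inferInstance, ?_⟩
    exact lim_tendsto (fun n => (⟨ρ, hρ n⟩ : S n)) (fun n x => j (e n x)) hι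
      (j ⟨ρ, Set.mem_iUnion.2 ⟨0, hρ 0⟩⟩) (fun n => rfl) hmono' hdense htree

end
end

section
/- (𝕋_{ℓ¹}, d) is a complete and separable metric space; that is, the function d(T,T') = Σ_{k≥0} 2^{-k} d_Haus(B̄_T(0,k), B̄_{T'}(0,k)) is a metric on 𝕋_{ℓ¹}, and the resulting metric space is complete and separable. -/
noncomputable section

/-- The space `ℓ¹(ℕ)` of summable real sequences. -/
abbrev ellOne : Type := lp (fun _ : ℕ => ℝ) 1

/-- The space `𝕋_{ℓ¹}` of subsets of `ℓ¹(ℕ)` which, rooted at `0`, are complete locally compact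
rooted real trees. -/
def TreeL1 : Type :=
  {T : Set ellOne // (0 : ellOne) ∈ T ∧ IsComplete T ∧ LocallyCompactSpace ↥T ∧ IsRealTree ↥T}

/-- The distance `d(T,T') = Σ_k 2^{-k} d_Haus(B̄_T(0,k), B̄_{T'}(0,k))` on `𝕋_{ℓ¹}`. -/
def dL1 (T T' : TreeL1) : ℝ :=
  ∑' k : ℕ, (2 : ℝ)⁻¹ ^ k *
    Metric.hausdorffDist {x ∈ T.1 | ‖x‖ ≤ (k : ℝ)} {x ∈ T'.1 | ‖x‖ ≤ (k : ℝ)}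

/-! ### Real trees and the four point condition -/

/-- Interpolation: intermediate points exist. -/
def Interp (X : Type*) [MetricSpace X] : Prop :=
  ∀ s t : X, ∀ r : ℝ, 0 ≤ r → r ≤ dist s t → ∃ x, dist s x = r ∧ dist x t = dist s t - r

section Trees
variable {X : Type*} [MetricSpace X]

lemma arc_extend {s t : X} {f : Set.Icc (0 : ℝ) (dist s t) → X} (hf : arcProp s t f) :
    ∃ γ : ℝ → X, Continuous γ ∧ γ 0 = s ∧ γ (dist s t) = t ∧
      (∀ u ∈ Set.Icc (0 : ℝ) (dist s t), ∀ v ∈ Set.Icc (0 : ℝ) (dist s t),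
        dist (γ u) (γ v) = |u - v|) ∧ (∀ u (hu : u ∈ Set.Icc (0 : ℝ) (dist s t)), γ u = f ⟨u, hu⟩) := by
  have e : ∀ u (hu : u ∈ Set.Icc (0 : ℝ) (dist s t)),
      Set.IccExtend (dist_nonneg (x := s) (y := t)) f u = f ⟨u, hu⟩ :=
    fun u hu => Set.IccExtend_of_mem _ f hu
  refine ⟨Set.IccExtend (dist_nonneg (x := s) (y := t)) f, hf.1.continuous.Icc_extend', ?_, ?_, ?_, e⟩
  · rw [e 0 (Set.left_mem_Icc.2 dist_nonneg)]; exact hf.2.1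
  · rw [e _ (Set.right_mem_Icc.2 dist_nonneg)]; exact hf.2.2
  · intro u hu v hv
    rw [e u hu, e v hv, hf.1.dist_eq]; rfl

lemma arc_of_fun {s t : X} (γ : ℝ → X) (h0 : γ 0 = s) (h1 : γ (dist s t) = t)
    (h : ∀ u ∈ Set.Icc (0 : ℝ) (dist s t), ∀ v ∈ Set.Icc (0 : ℝ) (dist s t),
        dist (γ u) (γ v) = |u - v|) : arcProp s t (fun u => γ u.1) :=
  ⟨Isometry.of_dist_eq fun u v => by rw [h u u.2 v v.2]; rfl, h0, h1⟩

/-- Lipschitz maps with the right end points are isometric. -/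
lemma iso_of_lip {D : ℝ} (γ : ℝ → X) (hd : dist (γ 0) (γ D) = D)
    (h : ∀ u v, 0 ≤ u → u ≤ v → v ≤ D → dist (γ u) (γ v) ≤ v - u) :
    ∀ u ∈ Set.Icc (0 : ℝ) D, ∀ v ∈ Set.Icc (0 : ℝ) D, dist (γ u) (γ v) = |u - v| := by
  have key : ∀ u v, 0 ≤ u → u ≤ v → v ≤ D → dist (γ u) (γ v) = v - u := by
    intro u v hu huv hv
    have h1 := h 0 u le_rfl hu (huv.trans hv)
    have h2 := h u v hu huv hv
    have h3 := h v D (hu.trans huv) hv le_rfl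
    have h4 := dist_triangle4 (γ 0) (γ u) (γ v) (γ D)
    linarith
  intro u hu v hv
  rcases le_total u v with huv | huv
  · rw [key u v hu.1 huv hv.2, abs_of_nonpos (by linarith)]; ring
  · rw [dist_comm, key v u hv.1 huv hu.2, abs_of_nonneg (by linarith)]

/-- Uniqueness of intermediate points in a real tree. -/
lemma tree_unique (hX : IsRealTree X) {s t p p' : X} (hp : dist s p + dist p t = dist s t)
    (hp' : dist s p' + dist p' t = dist s t) (h : dist s p = dist s p') : p = p' := by
  have conc : ∀ p : X, dist s p + dist p t = dist s t →
      ∃ f : Set.Icc (0 : ℝ) (dist s t) → X, arcProp s t f ∧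
        ∀ hu : dist s p ∈ Set.Icc (0 : ℝ) (dist s t), f ⟨dist s p, hu⟩ = p := by
    intro p hp
    obtain ⟨f1, hf1, -⟩ := hX.1 s p
    obtain ⟨f2, hf2, -⟩ := hX.1 p t
    obtain ⟨a, -, a0, a1, ha, -⟩ := arc_extend hf1
    obtain ⟨b, -, b0, b1, hb, -⟩ := arc_extend hf2
    have nn1 := dist_nonneg (x := s) (y := p)
    have nn2 := dist_nonneg (x := p) (y := t)
    let γ : ℝ → X := fun u => if u ≤ dist s p then a u else b (u - dist s p)
    have g0 : γ 0 = s := by simp [γ, a0]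
    have gp : γ (dist s p) = p := by simp [γ, a1]
    have g1 : γ (dist s t) = t := by
      by_cases hc : dist s t ≤ dist s p
      · have : dist p t = 0 := by linarith
        have e : dist s t = dist s p := by linarith
        rw [e, gp]; exact dist_eq_zero.1 this
      · simp only [γ, if_neg hc]
        rw [show dist s t - dist s p = dist p t by linarith, b1]
    have ga : ∀ u v, 0 ≤ u → u ≤ v → v ≤ dist s p → dist (γ u) (γ v) = v - u := by
      intro u v hu huv hv
      simp only [γ, if_pos hv, if_pos (huv.trans hv)]
      rw [ha u ⟨hu, huv.trans hv⟩ v ⟨hu.trans huv, hv⟩, abs_of_nonpos (by linarith)]; ring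
    have gb : ∀ u, dist s p ≤ u → γ u = b (u - dist s p) := by
      intro u hu
      rcases hu.eq_or_lt with e | e
      · rw [← e, gp, sub_self, b0]
      · simp [γ, not_le.2 e]
    have gb' : ∀ u v, dist s p ≤ u → u ≤ v → v ≤ dist s t → dist (γ u) (γ v) = v - u := by
      intro u v hu huv hv
      rw [gb u hu, gb v (hu.trans huv), hb _ ⟨by linarith, by linarith⟩ _ ⟨by linarith, by linarith⟩,
        abs_of_nonpos (by linarith)]; ring
    refine ⟨_, arc_of_fun γ g0 g1 (iso_of_lip γ (by rw [g0, g1]) ?_), fun _ => gp⟩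
    intro u v hu huv hv
    rcases le_total v (dist s p) with h1 | h1
    · exact (ga u v hu huv h1).le
    rcases le_total (dist s p) u with h2 | h2
    · exact (gb' u v h2 huv hv).le
    have := dist_triangle (γ u) (γ (dist s p)) (γ v)
    rw [ga u _ hu h2 le_rfl, gb' _ v le_rfl h1 hv] at this
    linarith
  obtain ⟨f, hf, hfp⟩ := conc p hp
  obtain ⟨f', hf', hfp'⟩ := conc p' hp'
  have e := (hX.1 s t).unique hf hf'
  have m : dist s p ∈ Set.Icc (0 : ℝ) (dist s t) := ⟨dist_nonneg, by linarith [dist_nonneg (x := p) (y := t)]⟩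
  have m' : dist s p' ∈ Set.Icc (0 : ℝ) (dist s t) := h ▸ m
  rw [← hfp m, ← hfp' m', e]
  congr 2

lemma tree_interp (hX : IsRealTree X) : Interp X := by
  intro s t r h0 h1
  obtain ⟨f, hf, -⟩ := hX.1 s t
  obtain ⟨a, -, a0, a1, ha, -⟩ := arc_extend hf
  refine ⟨a r, ?_, ?_⟩
  · have := ha 0 ⟨le_rfl, dist_nonneg⟩ r ⟨h0, h1⟩
    rw [a0] at this
    rw [this, abs_of_nonpos (by linarith)]; ring
  · have := ha r ⟨h0, h1⟩ (dist s t) ⟨dist_nonneg, le_rfl⟩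
    rw [a1] at this
    rw [this, abs_of_nonpos (by linarith)]; ring

lemma tree_median (hX : IsRealTree X) (w x y : X) : ∃ m, dist w m + dist m x = dist w x ∧
    dist w m + dist m y = dist w y ∧ dist x m + dist m y = dist x y := by
  obtain ⟨fa, hfa, -⟩ := hX.1 w x
  obtain ⟨a, ca, a0, a1, ha, -⟩ := arc_extend hfa
  obtain ⟨fb, hfb, -⟩ := hX.1 w y
  obtain ⟨b, cb, b0, b1, hb, -⟩ := arc_extend hfb
  have nx := dist_nonneg (x := w) (y := x)
  have ny := dist_nonneg (x := w) (y := y)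
  have wa : ∀ u ∈ Set.Icc 0 (dist w x), dist w (a u) = u := by
    intro u hu
    have := ha 0 ⟨le_rfl, nx⟩ u hu
    rw [a0] at this
    rw [this, abs_of_nonpos (by linarith [hu.1])]; ring
  have wb : ∀ u ∈ Set.Icc 0 (dist w y), dist w (b u) = u := by
    intro u hu
    have := hb 0 ⟨le_rfl, ny⟩ u hu
    rw [b0] at this
    rw [this, abs_of_nonpos (by linarith [hu.1])]; ring
  let S : Set ℝ := Set.Icc 0 (min (dist w x) (dist w y)) ∩ {r | a r = b r}
  have hS : IsCompact S := isCompact_Icc.inter_right (isClosed_eq ca cb)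
  have hSn : S.Nonempty := ⟨0, ⟨le_rfl, le_min nx ny⟩, by simp [a0, b0]⟩
  obtain ⟨r, ⟨⟨r0, hr⟩, hrab⟩, hmax⟩ := hS.exists_isGreatest hSn
  have hrx : r ≤ dist w x := hr.trans (min_le_left _ _)
  have hry : r ≤ dist w y := hr.trans (min_le_right _ _)
  have hrab : a r = b r := hrab
  have d1 : dist w (a r) = r := wa r ⟨r0, hrx⟩
  have d2 : dist (a r) x = dist w x - r := by
    have := ha r ⟨r0, hrx⟩ _ ⟨nx, le_rfl⟩
    rw [a1] at this
    rw [this, abs_of_nonpos (by linarith)]; ring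
  have d3 : dist (a r) y = dist w y - r := by
    have := hb r ⟨r0, hry⟩ _ ⟨ny, le_rfl⟩
    rw [b1, ← hrab] at this
    rw [this, abs_of_nonpos (by linarith)]; ring
  refine ⟨a r, by linarith, by linarith, ?_⟩
  set l1 := dist w x - r with hl1
  set l2 := dist w y - r with hl2
  have l1n : 0 ≤ l1 := by linarith
  have l2n : 0 ≤ l2 := by linarith
  rcases (add_nonneg l1n l2n).eq_or_lt with hL | hL
  · have z1 : dist (a r) x = 0 := by linarith
    have z1' := dist_eq_zero.1 z1
    rw [z1']; simp
  let P : ℝ → X := fun t => if t ≤ l1 then a (dist w x - t) else b (r + (t - l1))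
  have cP : Continuous P := by
    refine Continuous.if_le (by fun_prop) (by fun_prop) continuous_id continuous_const ?_
    rintro t rfl
    simp only [hl1]
    ring_nf
    exact hrab
  have Pinj : ∀ u v, 0 ≤ u → u ≤ l1 + l2 → 0 ≤ v → v ≤ l1 + l2 → P u = P v → u = v := by
    have cross : ∀ u v, 0 ≤ u → u ≤ l1 → l1 < v → v ≤ l1 + l2 →
        a (dist w x - u) = b (r + (v - l1)) → False := by
      intro u v hu hu1 hv hv1 h
      have e1 := wa (dist w x - u) ⟨by linarith, by linarith⟩
      have e2 := wb (r + (v - l1)) ⟨by linarith, by linarith⟩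
      rw [h, e2] at e1
      have : r + (v - l1) ∈ S := by
        refine ⟨⟨by linarith, le_min (by linarith) (by linarith)⟩, ?_⟩
        change a _ = b _
        rw [← h, e1]
      have := hmax this
      linarith
    intro u v hu hu1 hv hv1 h
    by_cases c1 : u ≤ l1 <;> by_cases c2 : v ≤ l1
    · simp only [P, if_pos c1, if_pos c2] at h
      have e1 := wa (dist w x - u) ⟨by linarith, by linarith⟩
      have e2 := wa (dist w x - v) ⟨by linarith, by linarith⟩
      rw [h] at e1; linarith
    · simp only [P, if_pos c1, if_neg c2] at h
      exact (cross u v hu c1 (not_le.1 c2) hv1 h).elim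
    · simp only [P, if_neg c1, if_pos c2] at h
      exact (cross v u hv c2 (not_le.1 c1) hu1 h.symm).elim
    · simp only [P, if_neg c1, if_neg c2] at h
      rw [not_le] at c1 c2
      have e1 := wb (r + (u - l1)) ⟨by linarith, by linarith⟩
      have e2 := wb (r + (v - l1)) ⟨by linarith, by linarith⟩
      rw [h] at e1; linarith
  have P0 : P 0 = x := by simp [P, l1n, a1]
  have Pm : P l1 = a r := by simp [P, hl1]
  have PL : P (l1 + l2) = y := by
    by_cases c : l1 + l2 ≤ l1
    · have : l2 = 0 := by linarith
      have z := dist_eq_zero.1 (d3.trans this)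
      rw [this, add_zero, Pm]; exact z
    · simp only [P, if_neg c]
      rw [show r + (l1 + l2 - l1) = dist w y by rw [hl2]; ring, b1]
  let q : Set.Icc (0 : ℝ) 1 → X := fun t => P ((l1 + l2) * t.1)
  have q0 : q ⟨0, Set.left_mem_Icc.2 zero_le_one⟩ = x := by simp [q, P0]
  have q1 : q ⟨1, Set.right_mem_Icc.2 zero_le_one⟩ = y := by simp [q, PL]
  have qinj : Function.Injective q := by
    intro u v h
    have := Pinj _ _ (mul_nonneg hL.le u.2.1) (mul_le_of_le_one_right hL.le u.2.2)
      (mul_nonneg hL.le v.2.1) (mul_le_of_le_one_right hL.le v.2.2) h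
    exact Subtype.ext (mul_left_cancel₀ hL.ne' this)
  have qc : Continuous q := cP.comp (by fun_prop)
  obtain ⟨f, hf, -⟩ := hX.1 (q ⟨0, Set.left_mem_Icc.2 zero_le_one⟩)
    (q ⟨1, Set.right_mem_Icc.2 zero_le_one⟩)
  have hr := hX.2 q qc qinj f hf
  have hm : a r ∈ Set.range q := by
    refine ⟨⟨l1 / (l1 + l2), by positivity, div_le_one_of_le₀ (by linarith) hL.le⟩, ?_⟩
    simp only [q]
    rw [mul_div_cancel₀ _ hL.ne', Pm]
  rw [hr] at hm
  obtain ⟨u, hu⟩ := hm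
  have i1 := hf.1.dist_eq ⟨0, Set.left_mem_Icc.2 dist_nonneg⟩ u
  have i2 := hf.1.dist_eq u ⟨_, Set.right_mem_Icc.2 dist_nonneg⟩
  rw [hf.2.1, hu] at i1
  rw [hf.2.2, hu] at i2
  have i3 := u.2.1
  have i4 := u.2.2
  rw [Subtype.dist_eq, Real.dist_eq, abs_of_nonpos (by linarith)] at i1 i2
  simp only [q0, q1] at i1 i2
  linarith

lemma tree_fourPt (hX : IsRealTree X) : FourPt X := by
  have key : ∀ x y z w : X, ∀ m n : X, dist w m + dist m x = dist w x →
      dist w m + dist m y = dist w y → dist w n + dist n y = dist w y →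
      dist w n + dist n z = dist w z → dist w m ≤ dist w n →
      dist x z ≤ dist w x + dist w z - 2 * dist w m := by
    intro x y z w m n h1 h2 h3 h4 h
    obtain ⟨p, hp1, hp2⟩ := tree_interp hX w n (dist w m) dist_nonneg h
    have t1 := dist_triangle p n y
    have t2 := dist_triangle w p y
    have e : m = p := tree_unique hX h2 (by linarith) hp1.symm
    have t3 := dist_triangle m n z
    have t4 := dist_triangle x m z
    rw [← e] at hp2
    rw [dist_comm x m] at t4
    linarith
  intro x z y w
  obtain ⟨m, m1, m2, m3⟩ := tree_median hX w x y
  obtain ⟨n, n1, n2, n3⟩ := tree_median hX w y z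
  rw [dist_comm x m] at m3
  rw [dist_comm y n] at n3
  rw [dist_comm x w, dist_comm z w, dist_comm y w, dist_comm z y]
  rcases le_total (dist w m) (dist w n) with h | h
  · have := key x y z w m n m1 m2 n1 n2 h
    apply le_max_of_le_left
    linarith
  · have := key z y x w n m n2 n1 m2 m1 h
    apply le_max_of_le_right
    rw [dist_comm x z]
    linarith

lemma path_through (h4 : FourPt X) {q : ℝ → X} (hq : Continuous q) {a b : ℝ} (hab : a ≤ b) {m : X}
    (hm : dist (q a) m + dist m (q b) = dist (q a) (q b)) : ∃ u ∈ Set.Icc a b, q u = m := by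
  by_contra hne
  push Not at hne
  let U : Set ℝ := {u | dist (q a) (q u) < dist (q a) m + dist m (q u)}
  let V : Set ℝ := {u | ∃ v, dist (q a) (q v) = dist (q a) m + dist m (q v) ∧
    dist (q u) (q v) < dist m (q v) + dist (q u) m}
  have hU : IsOpen U := isOpen_lt (by fun_prop) (by fun_prop)
  have hV : IsOpen V := by
    have : V = ⋃ v, ⋃ (_ : dist (q a) (q v) = dist (q a) m + dist m (q v)),
        {u | dist (q u) (q v) < dist m (q v) + dist (q u) m} := by
      ext u; simp [V]
    rw [this]
    exact isOpen_iUnion fun v => isOpen_iUnion fun _ => isOpen_lt (by fun_prop) (by fun_prop)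
  have pos : ∀ u ∈ Set.Icc a b, 0 < dist m (q u) := fun u hu =>
    dist_pos.2 (hne u hu).symm
  have hpre : IsPreconnected (Set.Icc a b) := isPreconnected_Icc
  obtain ⟨u, -, hu, v, hv, hv2⟩ := hpre U V hU hV (by
      intro u hu
      rcases (dist_triangle (q a) m (q u)).lt_or_eq with h | h
      · exact Or.inl h
      · refine Or.inr ⟨u, h, ?_⟩
        rw [dist_self, dist_comm (q u) m]; linarith [pos u hu])
    ⟨a, ⟨le_rfl, hab⟩, by
      change dist _ _ < _
      rw [dist_self, dist_comm (q a) m]; linarith [pos a ⟨le_rfl, hab⟩]⟩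
    ⟨b, ⟨hab, le_rfl⟩, b, hm.symm, by
      rw [dist_self, dist_comm (q b) m]; linarith [pos b ⟨hab, le_rfl⟩]⟩
  have hu : dist (q a) (q u) < dist (q a) m + dist m (q u) := hu
  have := h4 (q a) (q v) (q u) m
  rw [dist_comm (q v) m, dist_comm (q v) (q u), dist_comm (q u) m] at this
  rw [dist_comm (q u) m] at hv2
  rcases le_max_iff.1 this with h | h <;> linarith

lemma isRealTree_of_s9 (hI : Interp X) (h4 : FourPt X) : IsRealTree X := by
  have uniq : ∀ s t p p' : X, ∀ r r' : ℝ, r ≤ r' → dist s p = r → dist p t = dist s t - r →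
      dist s p' = r' → dist p' t = dist s t - r' → dist p p' ≤ r' - r := by
    intro s t p p' r r' hr h1 h2 h3 h4'
    have := h4 s t p p'
    rw [dist_comm t p', dist_comm t p] at this
    rcases le_max_iff.1 this with h | h <;> linarith
  have hproj : ∀ s t x : X, ∃ m, dist s m + dist m t = dist s t ∧ dist s m + dist m x = dist s x ∧
      dist x m + dist m t = dist x t := by
    intro s t x
    have t1 := dist_triangle s x t
    have t2 := dist_triangle s t x
    have t3 := dist_triangle x s t
    rw [dist_comm t x] at t2
    rw [dist_comm x s] at t3
    obtain ⟨m, hm1, hm2⟩ := hI s t ((dist s x + dist s t - dist x t) / 2) (by linarith) (by linarith)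
    have := h4 x m s t
    rw [dist_comm x s, dist_comm m s] at this
    have u1 := dist_triangle s m x
    have u2 := dist_triangle x m t
    rw [dist_comm m x] at u1
    have : dist x m ≤ (dist s x + dist x t - dist s t) / 2 := by
      rcases le_max_iff.1 this with h | h <;> linarith
    refine ⟨m, by linarith, ?_, ?_⟩
    · rw [dist_comm m x]; linarith
    · linarith
  have mem_range : ∀ (s t : X) (f : Set.Icc (0 : ℝ) (dist s t) → X), arcProp s t f → ∀ p,
      p ∈ Set.range f ↔ dist s p + dist p t = dist s t := by
    intro s t f hf p
    have B : ∀ u, dist s (f u) = u.1 ∧ dist (f u) t = dist s t - u.1 := by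
      intro u
      have i1 := hf.1.dist_eq ⟨0, Set.left_mem_Icc.2 dist_nonneg⟩ u
      have i2 := hf.1.dist_eq u ⟨_, Set.right_mem_Icc.2 dist_nonneg⟩
      have i3 := u.2.1
      have i4 := u.2.2
      rw [hf.2.1] at i1
      rw [hf.2.2] at i2
      rw [Subtype.dist_eq, Real.dist_eq, abs_of_nonpos (by linarith)] at i1 i2
      constructor <;> linarith
    constructor
    · rintro ⟨u, rfl⟩
      have := B u
      linarith
    · intro h
      have hm : dist s p ∈ Set.Icc 0 (dist s t) :=
        ⟨dist_nonneg, by linarith [dist_nonneg (x := p) (y := t)]⟩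
      refine ⟨⟨_, hm⟩, ?_⟩
      have := uniq s t _ p _ _ le_rfl (B ⟨_, hm⟩).1 (B ⟨_, hm⟩).2 rfl (by linarith)
      simpa using this
  refine ⟨?_, ?_⟩
  · intro s t
    have ex : ∀ u : Set.Icc (0 : ℝ) (dist s t), ∃ x, dist s x = u.1 ∧ dist x t = dist s t - u.1 :=
      fun u => hI s t u.1 u.2.1 u.2.2
    choose f hf using ex
    refine ⟨f, ⟨?_, ?_, ?_⟩, ?_⟩
    · have key : ∀ u v : Set.Icc (0 : ℝ) (dist s t), u ≤ v → dist (f u) (f v) = dist u v := by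
        intro u v huv
        have huv' : u.1 ≤ v.1 := huv
        rw [Subtype.dist_eq, Real.dist_eq, abs_of_nonpos (by linarith)]
        apply le_antisymm
        · have := uniq s t _ _ _ _ huv' (hf u).1 (hf u).2 (hf v).1 (hf v).2
          linarith
        · have := dist_triangle s (f u) (f v)
          rw [(hf u).1, (hf v).1] at this
          linarith
      refine Isometry.of_dist_eq fun u v => ?_
      rcases le_total u v with h | h
      · exact key u v h
      · rw [dist_comm, key v u h, dist_comm]
    · have := (hf ⟨0, Set.left_mem_Icc.2 dist_nonneg⟩).1
      exact (dist_eq_zero.1 this).symm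
    · have := (hf ⟨dist s t, Set.right_mem_Icc.2 dist_nonneg⟩).2
      simp only [sub_self] at this
      exact dist_eq_zero.1 this
    · intro g hg
      funext u
      have i1 := hg.1.dist_eq ⟨0, Set.left_mem_Icc.2 dist_nonneg⟩ u
      have i2 := hg.1.dist_eq u ⟨_, Set.right_mem_Icc.2 dist_nonneg⟩
      have i3 := u.2.1
      have i4 := u.2.2
      rw [hg.2.1] at i1
      rw [hg.2.2] at i2
      rw [Subtype.dist_eq, Real.dist_eq, abs_of_nonpos (by linarith)] at i1 i2
      have := uniq s t (g u) (f u) u.1 u.1 le_rfl (by linarith) (by linarith) (hf u).1 (hf u).2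
      simpa using this
  · intro q hq hinj f hf
    let Q : ℝ → X := Set.IccExtend zero_le_one q
    have hQ : Continuous Q := hq.Icc_extend'
    have eQ : ∀ u (hu : u ∈ Set.Icc (0 : ℝ) 1), Q u = q ⟨u, hu⟩ := fun u hu =>
      Set.IccExtend_of_mem _ q hu
    have i0 : (0 : ℝ) ∈ Set.Icc (0 : ℝ) 1 := Set.left_mem_Icc.2 zero_le_one
    have i1 : (1 : ℝ) ∈ Set.Icc (0 : ℝ) 1 := Set.right_mem_Icc.2 zero_le_one
    ext p
    rw [mem_range _ _ f hf p, ← eQ 0 i0, ← eQ 1 i1]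
    constructor
    · rintro ⟨⟨u, hu⟩, rfl⟩
      rw [← eQ u hu]
      obtain ⟨m, m1, m2, m3⟩ := hproj (Q 0) (Q 1) (Q u)
      obtain ⟨a, ha, ea⟩ := path_through h4 hQ hu.1 m2
      obtain ⟨b, hb, eb⟩ := path_through h4 hQ hu.2 m3
      have ha' : a ∈ Set.Icc (0 : ℝ) 1 := ⟨ha.1, ha.2.trans hu.2⟩
      have hb' : b ∈ Set.Icc (0 : ℝ) 1 := ⟨hu.1.trans hb.1, hb.2⟩
      have hab : a = b := by
        have : q ⟨a, ha'⟩ = q ⟨b, hb'⟩ := by rw [← eQ a, ← eQ b, ea, eb]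
        exact congrArg Subtype.val (hinj this)
      have : a = u := le_antisymm ha.2 (hab ▸ hb.1)
      rw [this] at ea
      rw [ea]; exact m1
    · intro h
      obtain ⟨u, hu, e⟩ := path_through h4 hQ zero_le_one h
      exact ⟨⟨u, hu⟩, by rw [← eQ u hu, e]⟩
end Trees
/-! ### Properness -/

lemma proper_of_interp {X : Type*} [MetricSpace X] [CompleteSpace X] [LocallyCompactSpace X]
    (hI : Interp X) (o : X) : ∀ r : ℝ, IsCompact (Metric.closedBall o r) := by
  have mono : ∀ r r' : ℝ, r ≤ r' → IsCompact (Metric.closedBall o r') →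
      IsCompact (Metric.closedBall o r) := fun r r' h hc =>
    hc.of_isClosed_subset Metric.isClosed_closedBall (Metric.closedBall_subset_closedBall h)
  -- points of a large ball are close to a smaller ball
  have close : ∀ R ε : ℝ, 0 ≤ ε → 0 ≤ R - ε → ∀ x ∈ Metric.closedBall o R,
      ∃ y ∈ Metric.closedBall o (R - ε), dist x y ≤ ε := by
    intro R ε hε hR x hx
    rw [Metric.mem_closedBall, dist_comm] at hx
    obtain ⟨y, h1, h2⟩ := hI o x (min (dist o x) (R - ε)) (le_min dist_nonneg hR) (min_le_left _ _)
    refine ⟨y, ?_, ?_⟩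
    · rw [Metric.mem_closedBall, dist_comm, h1]; exact min_le_right _ _
    · rw [dist_comm, h2]
      rcases min_cases (dist o x) (R - ε) with h | h <;> linarith
  have step1 : ∀ R : ℝ, 0 < R → (∀ r, r < R → IsCompact (Metric.closedBall o r)) →
      IsCompact (Metric.closedBall o R) := by
    intro R hR h
    refine TotallyBounded.isCompact_of_isClosed ?_ Metric.isClosed_closedBall
    rw [Metric.totallyBounded_iff]
    intro ε hε
    set δ := min (ε / 2) R with hδ
    have δp : 0 < δ := lt_min (by linarith) hR
    have tb := (h (R - δ) (by linarith)).totallyBounded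
    rw [Metric.totallyBounded_iff] at tb
    obtain ⟨t, tf, ht⟩ := tb (ε / 2) (by linarith)
    refine ⟨t, tf, fun x hx => ?_⟩
    obtain ⟨y, hy, hxy⟩ := close R δ δp.le (by linarith [min_le_right (ε / 2) R]) x hx
    obtain ⟨z, hz, hyz⟩ := Set.mem_iUnion₂.1 (ht hy)
    refine Set.mem_iUnion₂.2 ⟨z, hz, ?_⟩
    rw [Metric.mem_ball] at hyz ⊢
    linarith [dist_triangle x y z, min_le_left (ε / 2) R]
  have step2 : ∀ R : ℝ, 0 ≤ R → IsCompact (Metric.closedBall o R) →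
      ∃ δ > 0, IsCompact (Metric.closedBall o (R + δ)) := by
    intro R hR h
    obtain ⟨K, hK, hsub⟩ := exists_compact_superset h
    obtain ⟨δ, δp, hδ⟩ := h.exists_cthickening_subset_open isOpen_interior hsub
    refine ⟨δ, δp, hK.of_isClosed_subset Metric.isClosed_closedBall ?_⟩
    intro x hx
    obtain ⟨y, hy, hxy⟩ := close (R + δ) δ δp.le (by linarith) x hx
    rw [add_sub_cancel_right] at hy
    exact interior_subset (hδ (Metric.mem_cthickening_of_dist_le x y δ _ hy hxy))
  by_contra hcon
  push Not at hcon
  obtain ⟨b, hb⟩ := hcon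
  let S : Set ℝ := {r | IsCompact (Metric.closedBall o r)}
  have hS0 : (0 : ℝ) ∈ S := by
    change IsCompact _
    rw [Metric.closedBall_zero]; exact isCompact_singleton
  have hbd : BddAbove S := ⟨b, fun r hr => by
    by_contra hlt
    exact hb (mono b r (not_le.1 hlt).le hr)⟩
  have lt_mem : ∀ r, r < sSup S → IsCompact (Metric.closedBall o r) := by
    intro r hr
    obtain ⟨r', hr', h⟩ := exists_lt_of_lt_csSup ⟨0, hS0⟩ hr
    exact mono r r' h.le hr'
  have h0 : 0 ≤ sSup S := le_csSup hbd hS0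
  have hm : IsCompact (Metric.closedBall o (sSup S)) := by
    rcases h0.eq_or_lt with h | h
    · rw [← h]; exact hS0
    · exact step1 _ h lt_mem
  obtain ⟨δ, δp, hδ⟩ := step2 _ h0 hm
  linarith [le_csSup hbd (show sSup S + δ ∈ S from hδ)]

/-! ### Balls of trees -/

instance ellOne_separable : TopologicalSpace.SeparableSpace ellOne := by
  rw [← TopologicalSpace.isSeparable_univ_iff]
  let G : Set ellOne := Set.range (fun n : ℕ => (lp.single 1 n (1 : ℝ) : ellOne))
  have hG : TopologicalSpace.IsSeparable G := (Set.countable_range _).isSeparable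
  refine (TopologicalSpace.IsSeparable.span (R := ℝ) hG).closure.mono fun x _ => ?_
  have h := lp.hasSum_single (p := 1) (by simp) x
  refine mem_closure_of_tendsto h (Filter.Eventually.of_forall fun s => ?_)
  refine Submodule.sum_mem _ fun i _ => ?_
  have : (lp.single 1 i (x i) : ellOne) = x i • (lp.single 1 i (1 : ℝ) : ellOne) := by
    rw [← lp.single_smul]; simp
  rw [this]
  exact Submodule.smul_mem _ _ (Submodule.subset_span ⟨i, rfl⟩)

/-- The closed ball of radius `k` in a set. -/
def tball (T : Set ellOne) (k : ℕ) : Set ellOne := {x ∈ T | ‖x‖ ≤ (k : ℝ)}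

/-- The tree properties expressed with points of the ambient space. -/
lemma tree_interp' (T : TreeL1) {s t : ellOne} (hs : s ∈ T.1) (ht : t ∈ T.1) {r : ℝ} (h0 : 0 ≤ r)
    (h1 : r ≤ dist s t) : ∃ x ∈ T.1, dist s x = r ∧ dist x t = dist s t - r := by
  obtain ⟨x, hx⟩ := tree_interp T.2.2.2.2 ⟨s, hs⟩ ⟨t, ht⟩ r h0 h1
  exact ⟨x.1, x.2, hx⟩

lemma tball_compact (T : TreeL1) (k : ℕ) : IsCompact (tball T.1 k) := by
  have := T.2.2.2.1
  have : CompleteSpace T.1 := completeSpace_coe_iff_isComplete.2 T.2.2.1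
  have h := proper_of_interp (tree_interp T.2.2.2.2) ⟨0, T.2.1⟩ k
  have h2 := h.image continuous_subtype_val
  convert h2 using 1
  ext x
  simp [tball]
  tauto

lemma zero_mem_tball (T : TreeL1) (k : ℕ) : (0 : ellOne) ∈ tball T.1 k := ⟨T.2.1, by simp⟩

/-- The ball as a nonempty compact set. -/
def cball (T : TreeL1) (k : ℕ) : TopologicalSpace.NonemptyCompacts ellOne :=
  ⟨⟨tball T.1 k, tball_compact T k⟩, ⟨0, zero_mem_tball T k⟩⟩

lemma dL1_eq (T T' : TreeL1) : dL1 T T' = ∑' k : ℕ, (2 : ℝ)⁻¹ ^ k * dist (cball T k) (cball T' k) :=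
  rfl

lemma dist_cball_le (T T' : TreeL1) (k : ℕ) : dist (cball T k) (cball T' k) ≤ k := by
  rw [Metric.NonemptyCompacts.dist_eq]
  refine Metric.hausdorffDist_le_of_mem_dist (by positivity) ?_ ?_
  · intro x hx
    exact ⟨0, zero_mem_tball T' k, by simpa using hx.2⟩
  · intro x hx
    exact ⟨0, zero_mem_tball T k, by simpa using hx.2⟩

lemma summable_bound : Summable (fun k : ℕ => (2 : ℝ)⁻¹ ^ k * k) := by
  have := summable_pow_mul_geometric_of_norm_lt_one (R := ℝ) 1 (r := 2⁻¹) (by norm_num)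
  simpa [mul_comm] using this

lemma summable_dL1 (T T' : TreeL1) :
    Summable (fun k : ℕ => (2 : ℝ)⁻¹ ^ k * dist (cball T k) (cball T' k)) :=
  Summable.of_nonneg_of_le (fun k => by positivity)
    (fun k => mul_le_mul_of_nonneg_left (dist_cball_le T T' k) (by positivity)) summable_bound

lemma term_le_dL1 (T T' : TreeL1) (k : ℕ) :
    (2 : ℝ)⁻¹ ^ k * dist (cball T k) (cball T' k) ≤ dL1 T T' :=
  (summable_dL1 T T').le_tsum k (fun j _ => by positivity)

lemma dL1_tendsto {ι : Type*} {l : Filter ι} (f : ι → TreeL1) (T : TreeL1)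
    (h : ∀ k, Filter.Tendsto (fun i => cball (f i) k) l (nhds (cball T k))) :
    Filter.Tendsto (fun i => dL1 (f i) T) l (nhds 0) := by
  have : (0 : ℝ) = ∑' k : ℕ, (0 : ℝ) := by simp
  rw [this]
  simp only [dL1_eq]
  refine tendsto_tsum_of_dominated_convergence summable_bound ?_ ?_
  · intro k
    have := (tendsto_iff_dist_tendsto_zero.1 (h k)).const_mul ((2 : ℝ)⁻¹ ^ k)
    simpa using this
  · refine Filter.Eventually.of_forall fun i k => ?_
    rw [Real.norm_of_nonneg (by positivity)]
    exact mul_le_mul_of_nonneg_left (dist_cball_le _ _ k) (by positivity)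

lemma tree_eq_of_balls {T T' : TreeL1} (h : ∀ k, cball T k = cball T' k) : T = T' := by
  have key : ∀ S S' : TreeL1, (∀ k, cball S k = cball S' k) → S.1 ⊆ S'.1 := by
    intro S S' h x hx
    obtain ⟨k, hk⟩ := exists_nat_ge ‖x‖
    have : x ∈ (cball S k : Set ellOne) := ⟨hx, hk⟩
    rw [h k] at this
    exact this.1
  exact Subtype.ext (Set.Subset.antisymm (key _ _ h) (key _ _ fun k => (h k).symm))

/-- The metric structure. -/
@[reducible] def treeMetric : MetricSpace TreeL1 where
  dist := dL1
  dist_self T := by simp [dL1_eq]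
  dist_comm T T' := by simp [dL1_eq, dist_comm]
  dist_triangle T U V := by
    rw [dL1_eq, dL1_eq, dL1_eq, ← (summable_dL1 T U).tsum_add (summable_dL1 U V)]
    refine (summable_dL1 T V).tsum_le_tsum (fun k => ?_)
      ((summable_dL1 T U).add (summable_dL1 U V))
    rw [← mul_add]
    exact mul_le_mul_of_nonneg_left (dist_triangle _ _ _) (by positivity)
  eq_of_dist_eq_zero {T T'} h := by
    refine tree_eq_of_balls fun k => ?_
    have h1 := term_le_dL1 T T' k
    change dL1 T T' = 0 at h
    rw [h] at h1
    have : dist (cball T k) (cball T' k) ≤ 0 := by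
      by_contra hc
      have : 0 < (2 : ℝ)⁻¹ ^ k * dist (cball T k) (cball T' k) :=
        mul_pos (by positivity) (not_le.1 hc)
      linarith
    exact dist_le_zero.1 this

attribute [local instance] treeMetric

lemma dist_cball_le_dist (T T' : TreeL1) (k : ℕ) :
    dist (cball T k) (cball T' k) ≤ 2 ^ k * dist T T' := by
  have h := term_le_dL1 T T' k
  have h2 : (2 : ℝ) ^ k * ((2 : ℝ)⁻¹ ^ k * dist (cball T k) (cball T' k)) ≤ 2 ^ k * dL1 T T' :=
    mul_le_mul_of_nonneg_left h (by positivity)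
  rwa [← mul_assoc, ← mul_pow, mul_inv_cancel₀ two_ne_zero, one_pow, one_mul] at h2

lemma cball_continuous (k : ℕ) : Continuous (fun T : TreeL1 => cball T k) :=
  (LipschitzWith.of_dist_le_mul (K := 2 ^ k) (fun T T' => by
    simpa using dist_cball_le_dist T T' k)).continuous

lemma tree_inducing : Topology.IsInducing (fun (T : TreeL1) (k : ℕ) => cball T k) := by
  rw [Topology.isInducing_iff_nhds]
  intro T
  apply le_antisymm
  · exact (continuous_pi cball_continuous).continuousAt.le_comap
  · have : Filter.Tendsto (id : TreeL1 → TreeL1)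
        (Filter.comap (fun (T : TreeL1) (k : ℕ) => cball T k) (nhds fun k => cball T k)) (nhds T) := by
      rw [tendsto_iff_dist_tendsto_zero]
      exact dL1_tendsto id T fun k => (tendsto_pi_nhds.1 Filter.tendsto_comap) k
    exact this

lemma tree_separable : TopologicalSpace.SeparableSpace TreeL1 := by
  have : SecondCountableTopology ellOne := UniformSpace.secondCountable_of_separable _
  have : SecondCountableTopology TreeL1 := tree_inducing.secondCountableTopology
  infer_instance
section Limits
open Filter Topology

lemma limit_approx {A : ℕ → TopologicalSpace.NonemptyCompacts ellOne}
    {K : TopologicalSpace.NonemptyCompacts ellOne} (h : Tendsto A atTop (𝓝 K)) {x : ellOne}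
    (hx : x ∈ K) : ∃ u : ℕ → ellOne, (∀ n, u n ∈ A n) ∧ Tendsto u atTop (𝓝 x) := by
  have ex : ∀ n, ∃ y ∈ (A n : Set ellOne), Metric.infDist x (A n) = dist x y := fun n =>
    (A n).isCompact.exists_infDist_eq_dist (A n).nonempty x
  choose u hu hd using ex
  refine ⟨u, hu, ?_⟩
  rw [tendsto_iff_dist_tendsto_zero]
  have h1 := ((Metric.lipschitz_infDist_set x).continuous.tendsto K).comp h
  have h2 : Metric.infDist x (K : Set ellOne) = 0 := Metric.infDist_zero_of_mem hx
  rw [h2] at h1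
  refine h1.congr fun n => ?_
  simp only [Function.comp]
  rw [hd n, dist_comm]

lemma limit_subseq {A : ℕ → TopologicalSpace.NonemptyCompacts ellOne}
    {K : TopologicalSpace.NonemptyCompacts ellOne} (h : Tendsto A atTop (𝓝 K)) {u : ℕ → ellOne}
    (hu : ∀ n, u n ∈ A n) : ∃ x ∈ K, ∃ φ : ℕ → ℕ, StrictMono φ ∧ Tendsto (u ∘ φ) atTop (𝓝 x) := by
  have ex : ∀ n, ∃ y ∈ (K : Set ellOne), Metric.infDist (u n) K = dist (u n) y := fun n =>
    K.isCompact.exists_infDist_eq_dist K.nonempty (u n)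
  choose y hy hd using ex
  have h0 : Tendsto (fun n => dist (u n) (y n)) atTop (𝓝 0) := by
    refine squeeze_zero (fun n => dist_nonneg) (fun n => ?_) (tendsto_iff_dist_tendsto_zero.1 h)
    rw [← hd n, Metric.NonemptyCompacts.dist_eq]
    exact Metric.infDist_le_hausdorffDist_of_mem (hu n)
      (Metric.hausdorffEDist_ne_top_of_nonempty_of_bounded (A n).nonempty K.nonempty
        (A n).isCompact.isBounded K.isCompact.isBounded)
  obtain ⟨x, hx, φ, hφ, hlim⟩ := K.isCompact.tendsto_subseq hy
  refine ⟨x, hx, φ, hφ, ?_⟩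
  have h1 := h0.comp hφ.tendsto_atTop
  exact (tendsto_iff_of_dist h1).2 hlim

lemma limit_mem {A : ℕ → TopologicalSpace.NonemptyCompacts ellOne}
    {K : TopologicalSpace.NonemptyCompacts ellOne} (h : Tendsto A atTop (𝓝 K)) {u : ℕ → ellOne}
    (hu : ∀ n, u n ∈ A n) {x : ellOne} (hx : Tendsto u atTop (𝓝 x)) : x ∈ K := by
  obtain ⟨y, hy, φ, hφ, hlim⟩ := limit_subseq h hu
  have := tendsto_nhds_unique hlim (hx.comp hφ.tendsto_atTop)
  rwa [← this]

lemma tree_limit (S : ℕ → TreeL1) (K : ℕ → TopologicalSpace.NonemptyCompacts ellOne)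
    (h : ∀ k, Tendsto (fun n => cball (S n) k) atTop (𝓝 (K k))) :
    ∃ T : TreeL1, ∀ k, cball T k = K k := by
  let T : Set ellOne := ⋃ k, (K k : Set ellOne)
  have hnorm : ∀ k, ∀ x ∈ K k, ‖x‖ ≤ k := by
    intro k x hx
    obtain ⟨u, hu, hl⟩ := limit_approx (h k) hx
    exact le_of_tendsto hl.norm (Eventually.of_forall fun n => (hu n).2)
  have hmono : ∀ k l, k ≤ l → ∀ x ∈ K k, x ∈ K l := by
    intro k l hkl x hx
    obtain ⟨u, hu, hl⟩ := limit_approx (h k) hx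
    exact limit_mem (h l) (fun n => ⟨(hu n).1, (hu n).2.trans (by exact_mod_cast hkl)⟩) hl
  have hball : ∀ k : ℕ, ∀ x ∈ T, ‖x‖ ≤ (k : ℝ) → x ∈ K k := by
    intro k x hx hk
    obtain ⟨l, hl⟩ := Set.mem_iUnion.1 hx
    obtain ⟨u, hu, hlim⟩ := limit_approx (h l) hl
    have ex : ∀ n, ∃ y ∈ (S n).1, dist 0 y = min ‖u n‖ k ∧ dist y (u n) = ‖u n‖ - min ‖u n‖ k := by
      intro n
      have := tree_interp' (S n) (S n).2.1 (hu n).1 (r := min ‖u n‖ k)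
        (le_min (norm_nonneg _) (by positivity)) (by rw [dist_zero_left]; exact min_le_left _ _)
      rwa [dist_zero_left] at this
    choose y hy hy1 hy2 using ex
    refine limit_mem (h k) (u := y) (fun n => ⟨hy n, ?_⟩) ?_
    · have := hy1 n
      rw [dist_zero_left] at this
      rw [this]; exact min_le_right _ _
    · have h0 : Tendsto (fun n => dist (y n) (u n)) atTop (𝓝 0) := by
        simp only [hy2]
        have := hlim.norm.sub (hlim.norm.min (tendsto_const_nhds (x := (k : ℝ))))
        rwa [min_eq_left hk, sub_self] at this
      exact (tendsto_iff_of_dist h0).2 hlim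
  have hmem : ∀ k x, x ∈ K k → x ∈ T := fun k x hx => Set.mem_iUnion.2 ⟨k, hx⟩
  have htb : ∀ k, tball T k = (K k : Set ellOne) := by
    intro k
    ext x
    exact ⟨fun hx => hball k x hx.1 hx.2, fun hx => ⟨hmem k x hx, hnorm k x hx⟩⟩
  have h0 : (0 : ellOne) ∈ T := hmem 0 0 (limit_mem (h 0) (u := fun _ => 0)
    (fun n => zero_mem_tball (S n) 0) tendsto_const_nhds)
  have hex : ∀ x ∈ T, ∃ k, ∀ l, k ≤ l → x ∈ K l := by
    intro x hx
    obtain ⟨k, hk⟩ := Set.mem_iUnion.1 hx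
    exact ⟨k, fun l hl => hmono k l hl x hk⟩
  have happ : ∀ x ∈ T, ∃ u : ℕ → ellOne, (∀ n, u n ∈ (S n).1) ∧ Tendsto u atTop (𝓝 x) := by
    intro x hx
    obtain ⟨k, hk⟩ := hex x hx
    obtain ⟨u, hu, hl⟩ := limit_approx (h k) (hk k le_rfl)
    exact ⟨u, fun n => (hu n).1, hl⟩
  have hproper : ProperSpace T := by
    refine ProperSpace.of_seq_closedBall (l := atTop) (x := (⟨0, h0⟩ : T)) (r := fun k : ℕ => (k : ℝ))
      tendsto_natCast_atTop_atTop (Eventually.of_forall fun k => ?_)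
    rw [Topology.IsInducing.subtypeVal.isCompact_iff]
    convert (K k).isCompact using 1
    rw [← htb k]
    ext x
    simp [tball, and_comm]
  have hcomp : IsComplete T := completeSpace_coe_iff_isComplete.1 inferInstance
  have hfour : FourPt T := by
    rintro ⟨x, hx⟩ ⟨y, hy⟩ ⟨z, hz⟩ ⟨w, hw⟩
    change dist x y + dist z w ≤ max (dist x z + dist y w) (dist x w + dist y z)
    obtain ⟨a, ha, la⟩ := happ x hx
    obtain ⟨b, hb, lb⟩ := happ y hy
    obtain ⟨c, hc, lc⟩ := happ z hz
    obtain ⟨d, hd, ld⟩ := happ w hw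
    refine le_of_tendsto_of_tendsto' ((la.dist lb).add (lc.dist ld))
      (((la.dist lc).add (lb.dist ld)).max ((la.dist ld).add (lb.dist lc))) fun n => ?_
    exact tree_fourPt (S n).2.2.2.2 ⟨a n, ha n⟩ ⟨b n, hb n⟩ ⟨c n, hc n⟩ ⟨d n, hd n⟩
  have hint : Interp T := by
    rintro ⟨s, hs⟩ ⟨t, ht⟩ r r0 hr
    change r ≤ dist s t at hr
    obtain ⟨k, hk⟩ := hex s hs
    obtain ⟨l, hl⟩ := hex t ht
    obtain ⟨a, ha, la⟩ := limit_approx (h (max k l)) (hk _ (le_max_left _ _))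
    obtain ⟨b, hb, lb⟩ := limit_approx (h (max k l)) (hl _ (le_max_right _ _))
    have ex : ∀ n, ∃ y ∈ (S n).1, dist (a n) y = min r (dist (a n) (b n)) ∧
        dist y (b n) = dist (a n) (b n) - min r (dist (a n) (b n)) := fun n =>
      tree_interp' (S n) (ha n).1 (hb n).1 (le_min r0 dist_nonneg) (min_le_right _ _)
    choose y hy y1 y2 using ex
    have hyb : ∀ n, y n ∈ cball (S n) (3 * max k l) := by
      intro n
      refine ⟨hy n, ?_⟩
      have e1 : ‖a n‖ ≤ (max k l : ℕ) := (ha n).2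
      have e2 : ‖b n‖ ≤ (max k l : ℕ) := (hb n).2
      have e3 : dist (a n) (b n) ≤ ‖a n‖ + ‖b n‖ := dist_le_norm_add_norm _ _
      have e4 : dist (a n) (y n) ≤ dist (a n) (b n) := by rw [y1 n]; exact min_le_right _ _
      have e5 : ‖y n‖ ≤ ‖a n‖ + dist (a n) (y n) := by
        have := dist_triangle (0 : ellOne) (a n) (y n)
        rwa [dist_zero_left, dist_zero_left] at this
      have e6 : ((3 * max k l : ℕ) : ℝ) = 3 * ((max k l : ℕ) : ℝ) := by rw [Nat.cast_mul]; rfl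
      rw [e6]
      linarith
    obtain ⟨x, hx, φ, hφ, lx⟩ := limit_subseq (h _) hyb
    have la' := la.comp hφ.tendsto_atTop
    have lb' := lb.comp hφ.tendsto_atTop
    have lm := (tendsto_const_nhds (x := r)).min (la'.dist lb')
    rw [min_eq_left hr] at lm
    refine ⟨⟨x, hmem _ x hx⟩, ?_, ?_⟩
    · exact tendsto_nhds_unique (la'.dist lx) (lm.congr fun n => (y1 (φ n)).symm)
    · exact tendsto_nhds_unique (lx.dist lb')
        (((la'.dist lb').sub lm).congr fun n => (y2 (φ n)).symm)
  refine ⟨⟨T, h0, hcomp, inferInstance, isRealTree_of_s9 hint hfour⟩, fun k => ?_⟩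
  exact SetLike.coe_injective (htb k)

lemma tree_complete : CompleteSpace TreeL1 := by
  refine Metric.complete_of_cauchySeq_tendsto fun S hS => ?_
  have hc : ∀ k, ∃ K, Tendsto (fun n => cball (S n) k) atTop (𝓝 K) := fun k =>
    cauchySeq_tendsto_of_complete (((LipschitzWith.of_dist_le_mul (K := 2 ^ k)
      (f := fun T : TreeL1 => cball T k) (fun T T' => by
        simpa using dist_cball_le_dist T T' k)).uniformContinuous).comp_cauchySeq hS)
  choose K hK using hc
  obtain ⟨T, hT⟩ := tree_limit S K hK
  refine ⟨T, ?_⟩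
  rw [tendsto_iff_dist_tendsto_zero]
  exact dL1_tendsto S T fun k => by rw [hT k]; exact hK k

end Limits

/-- `(𝕋_{ℓ¹}, d)` is a complete and separable metric space: `d` is a metric on `𝕋_{ℓ¹}` and
the resulting metric space is complete and separable. -/
theorem treeL1_polish :
    ∃ m : MetricSpace TreeL1,
      (∀ T T' : TreeL1, mdist m T T' = dL1 T T') ∧
      @CompleteSpace _ (msUniform m) ∧
      @TopologicalSpace.SeparableSpace _ (msTop m) := by
  exact ⟨treeMetric, fun _ _ => rfl, tree_complete, tree_separable⟩

end
end
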